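/- For every positive integer r and every integer k ≥ 2 there exists a real constant B_{k,r} with B_{k,r} ≥ −((1 + ⌊r/2⌋)/k + ln k/(2 ln 2)) such that for every integer p ≥ 1 with m := 2^p·k − 1 > r, one has H(m−r, m) ≥ (m+1)·ln(m+1)/(2 ln 2) + B_{k,r}·(m+1) + 1 + ⌊r/2⌋. -/

import Mathlib

open Filter Polynomial

/-- `Γ` is a periodic orbit of the planar vector field `V`: the image of a
nonconstant periodic solution of `γ' = V ∘ γ`. -/
def IsPeriodicOrbit (V : ℝ × ℝ → ℝ × ℝ) (Γ : Set (ℝ × ℝ)) : Prop :=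
  ∃ γ : ℝ → ℝ × ℝ,
    (∀ t : ℝ, HasDerivAt γ (V (γ t)) t) ∧
    (∃ T : ℝ, 0 < T ∧ Function.Periodic γ T) ∧
    (∃ t₁ t₂ : ℝ, γ t₁ ≠ γ t₂) ∧
    Γ = Set.range γ

/-- `Γ` is a limit cycle of `V`: a periodic orbit which is isolated among
periodic orbits. -/
def IsLimitCycle (V : ℝ × ℝ → ℝ × ℝ) (Γ : Set (ℝ × ℝ)) : Prop :=
  IsPeriodicOrbit V Γ ∧
  ∃ U : Set (ℝ × ℝ), IsOpen U ∧ Γ ⊆ U ∧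
    ∀ Γ' : Set (ℝ × ℝ), IsPeriodicOrbit V Γ' → Γ' ⊆ U → Γ' = Γ

/-- The Liénard vector field `ẋ = y, ẏ = -g(x) - ε f(x) y`. -/
def lienard (f g : Polynomial ℝ) (ε : ℝ) : ℝ × ℝ → ℝ × ℝ :=
  fun p => (p.2, -(g.eval p.1) - ε * (f.eval p.1) * p.2)

/-- `HGe n m c` formalizes `H(n,m) ≥ c`: there are polynomials `f, g` with
`deg f ≤ n`, `deg g ≤ m` and `ε₀ > 0` such that for every `0 < ε ≤ ε₀` the
Liénard system has at least `c` pairwise distinct limit cycles. -/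
def HGe (n m : ℕ) (c : ℝ) : Prop :=
  ∃ f g : Polynomial ℝ, f.natDegree ≤ n ∧ g.natDegree ≤ m ∧
    ∃ ε₀ : ℝ, 0 < ε₀ ∧ ∀ ε : ℝ, 0 < ε → ε ≤ ε₀ →
      ∃ S : Finset (Set (ℝ × ℝ)),
        (∀ Γ ∈ S, IsLimitCycle (lienard f g ε) Γ) ∧ c ≤ (S.card : ℝ)

/-- Reparametrization of time: a positive continuous speed bounded below has a global clock. -/
lemma exists_time_change (σ : ℝ → ℝ) (hσ : Continuous σ) {m : ℝ} (hm : 0 < m)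
    (hσm : ∀ θ, m ≤ σ θ) (θ₀ : ℝ) :
    ∃ φ : ℝ → ℝ, φ 0 = θ₀ ∧ (∀ t, HasDerivAt φ (1 / σ (φ t)) t) ∧ StrictMono φ ∧
      Function.Surjective φ ∧
      ∀ T, 0 < T → Function.Periodic σ T → ∃ τ, 0 < τ ∧ ∀ t, φ (t + τ) = φ t + T := by
  set ψ : ℝ → ℝ := fun θ => ∫ s in θ₀..θ, σ s with hψ
  have hd : ∀ θ, HasDerivAt ψ (σ θ) θ := fun θ =>
    intervalIntegral.integral_hasDerivAt_right (hσ.intervalIntegrable _ _)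
      hσ.stronglyMeasurable.stronglyMeasurableAtFilter hσ.continuousAt
  have hψ0 : ψ θ₀ = 0 := by simp [hψ]
  have hmono : StrictMono ψ := strictMono_of_deriv_pos fun θ => by
    rw [(hd θ).deriv]; exact hm.trans_le (hσm θ)
  have hcont : Continuous ψ := continuous_iff_continuousAt.2 fun θ => (hd θ).continuousAt
  have hg : Monotone fun θ => ψ θ - m * θ := by
    have hd' : ∀ θ, HasDerivAt (fun θ => ψ θ - m * θ) (σ θ - m * 1) θ := fun θ =>
      (hd θ).sub ((hasDerivAt_id θ).const_mul m)
    refine monotone_of_deriv_nonneg (fun θ => (hd' θ).differentiableAt) fun θ => ?_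
    rw [(hd' θ).deriv]; linarith [hσm θ]
  have hsurj : Function.Surjective ψ := by
    refine hcont.surjective ?_ ?_
    · refine tendsto_atTop_mono' _ (f₁ := fun θ => m * θ + (ψ θ₀ - m * θ₀)) ?_ ?_
      · filter_upwards [eventually_ge_atTop θ₀] with θ hθ
        have := hg hθ; simp only at this; linarith
      · exact tendsto_atTop_add_const_right _ _ (tendsto_id.const_mul_atTop hm)
    · refine tendsto_atBot_mono' _ (f₁ := fun θ => m * θ + (ψ θ₀ - m * θ₀)) ?_ ?_
      · filter_upwards [eventually_le_atBot θ₀] with θ hθ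
        have := hg hθ; simp only at this; linarith
      · exact tendsto_atBot_add_const_right _ _ (tendsto_id.const_mul_atBot hm)
  set e := hmono.orderIsoOfSurjective ψ hsurj with he
  have hes : ∀ t, ψ (e.symm t) = t := fun t => e.apply_symm_apply t
  have hse : ∀ θ, e.symm (ψ θ) = θ := fun θ => e.symm_apply_apply θ
  refine ⟨e.symm, ?_, fun t => ?_, e.symm.strictMono, e.symm.surjective, fun T hT hper => ?_⟩
  · rw [← hψ0, hse]
  · rw [one_div]
    exact HasDerivAt.of_local_left_inverse e.symm.continuous.continuousAt (hd _)
      (hm.trans_le (hσm _)).ne' (Eventually.of_forall hes)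
  · have hconst : ∀ θ, ψ (θ + T) - ψ θ = ψ (θ₀ + T) - ψ θ₀ := by
      have hd' : ∀ θ, HasDerivAt (fun θ => ψ (θ + T) - ψ θ) 0 θ := fun θ => by
        have := ((hd (θ + T)).comp_add_const θ T).sub (hd θ)
        rwa [hper θ, sub_self] at this
      intro θ
      exact is_const_of_deriv_eq_zero (fun θ => (hd' θ).differentiableAt)
        (fun θ => (hd' θ).deriv) θ θ₀
    refine ⟨ψ (θ₀ + T) - ψ θ₀, sub_pos.2 (hmono (by linarith)), fun t => ?_⟩
    apply hmono.injective
    rw [hes, ← hconst (e.symm t), hes]; ring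

/-- Global solutions of scalar equations with bounded, uniformly Lipschitz right-hand side. -/
lemma exists_global_solution (v : ℝ → ℝ → ℝ) (hv : Continuous (Function.uncurry v)) {M : ℝ}
    (hM : ∀ h θ, |v h θ| ≤ M) {K : NNReal} (hK : ∀ θ, LipschitzWith K fun h => v h θ)
    (θ₀ h₀ : ℝ) :
    ∃ h : ℝ → ℝ, h θ₀ = h₀ ∧ ∀ θ, HasDerivAt h (v (h θ) θ) θ := by
  have hM0 : 0 ≤ M := (abs_nonneg _).trans (hM 0 0)
  have hloc : ∀ n : ℕ, ∃ α : ℝ → ℝ, α θ₀ = h₀ ∧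
      ∀ θ ∈ Set.Ioo (θ₀ - (n + 1)) (θ₀ + (n + 1)), HasDerivAt α (v (α θ) θ) θ := by
    intro n
    have hn : (0:ℝ) < n + 1 := by positivity
    have hmem : θ₀ ∈ Set.Icc (θ₀ - ((n:ℝ) + 1)) (θ₀ + (n + 1)) := ⟨by linarith, by linarith⟩
    have hpl : IsPicardLindelof (fun θ h => v h θ) (⟨θ₀, hmem⟩ : Set.Icc (θ₀ - ((n:ℝ) + 1)) (θ₀ + (n + 1))) h₀
        (⟨M * (n + 1), by positivity⟩) 0 ⟨M, hM0⟩ K :=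
      { lipschitzOnWith := fun t _ => (hK t).lipschitzOnWith
        continuousOn := fun x _ => (hv.comp (Continuous.prodMk_right x)).continuousOn
        norm_le := fun t _ x _ => hM x t
        mul_max_le := by simp only [NNReal.coe_zero, sub_zero, add_sub_cancel_left, sub_sub_cancel, max_self]; exact le_rfl }
    obtain ⟨α, hα0, hα⟩ := hpl.exists_eq_forall_mem_Icc_hasDerivWithinAt₀
    exact ⟨α, hα0, fun θ hθ => (hα θ (Set.Ioo_subset_Icc_self hθ)).hasDerivAt
      (Icc_mem_nhds hθ.1 hθ.2)⟩
  choose α hα0 hα using hloc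
  have hagree : ∀ n k : ℕ, n ≤ k → Set.EqOn (α n) (α k) (Set.Ioo (θ₀ - (n + 1)) (θ₀ + (n + 1))) := by
    intro n k hnk
    have hnk' : (n:ℝ) ≤ k := by exact_mod_cast hnk
    refine ODE_solution_unique_of_mem_Ioo (v := fun θ h => v h θ) (s := fun _ => Set.univ) (K := K) (t₀ := θ₀)
      (fun t _ => (hK t).lipschitzOnWith) ⟨by linarith [n.cast_nonneg (α := ℝ)], by linarith [n.cast_nonneg (α := ℝ)]⟩
      (fun t ht => ⟨hα n t ht, trivial⟩)
      (fun t ht => ⟨hα k t ⟨by linarith [ht.1], by linarith [ht.2]⟩, trivial⟩)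
      (by rw [hα0, hα0])
  refine ⟨fun θ => α ⌈|θ - θ₀|⌉₊ θ, by simp [hα0], fun θ => ?_⟩
  set n := ⌈|θ - θ₀|⌉₊ with hn
  have hlt : ∀ θ' : ℝ, θ' ∈ Set.Ioo (θ₀ - ((⌈|θ' - θ₀|⌉₊:ℝ) + 1)) (θ₀ + (⌈|θ' - θ₀|⌉₊ + 1)) := by
    intro θ'
    have h1 := Nat.le_ceil |θ' - θ₀|
    have h2 := abs_le.1 h1
    constructor <;> linarith [h2.1, h2.2]
  have hθ := hlt θ
  refine (hα n θ hθ).congr_of_eventuallyEq ?_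
  filter_upwards [isOpen_Ioo.mem_nhds hθ] with θ' hθ'
  rcases le_total n ⌈|θ' - θ₀|⌉₊ with hle | hle
  · exact (hagree _ _ hle hθ').symm
  · exact hagree _ _ hle (hlt θ')

/-- A closed curve tangent to `V`, up to a positive periodic speed, is a periodic orbit. -/
lemma isPeriodicOrbit_range {V : ℝ × ℝ → ℝ × ℝ} {δ : ℝ → ℝ × ℝ} {σ : ℝ → ℝ} (hσ : Continuous σ)
    {m : ℝ} (hm : 0 < m) (hσm : ∀ θ, m ≤ σ θ) {T : ℝ} (hT : 0 < T) (hσT : Function.Periodic σ T)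
    (hδT : Function.Periodic δ T) (hδ : ∀ θ, HasDerivAt δ (σ θ • V (δ θ)) θ) {θ₁ θ₂ : ℝ}
    (hne : δ θ₁ ≠ δ θ₂) : IsPeriodicOrbit V (Set.range δ) := by
  obtain ⟨φ, -, hφ, -, hφs, hφT⟩ := exists_time_change σ hσ hm hσm 0
  obtain ⟨τ, hτ, hτφ⟩ := hφT T hT hσT
  refine ⟨δ ∘ φ, fun t => ?_, ⟨τ, hτ, fun t => ?_⟩, ?_, (hφs.range_comp δ).symm⟩
  · have := (hδ (φ t)).scomp t (hφ t)
    rwa [smul_smul, one_div, inv_mul_cancel₀ (hm.trans_le (hσm _)).ne', one_smul] at this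
  · simp only [Function.comp, hτφ]; exact hδT _
  · obtain ⟨t₁, h₁⟩ := hφs θ₁
    obtain ⟨t₂, h₂⟩ := hφs θ₂
    exact ⟨t₁, t₂, by simpa [h₁, h₂] using hne⟩

/-- Existence of periodic solutions of slowly varying scalar equations from averages of
opposite sign. -/
lemma exists_periodic_solution (e : ℝ → ℝ → ℝ) (he : Continuous (Function.uncurry e)) {M : ℝ}
    (hM : ∀ h θ, |e h θ| ≤ M) {K : NNReal} (hK : ∀ θ, LipschitzWith K fun h => e h θ)
    {T : ℝ} (hT : 0 < T) (hper : ∀ h θ, e h (θ + T) = e h θ) {ε ζ ν a₀ a₁ : ℝ} (hε : 0 < ε)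
    (hεζ : ε * M * T ≤ ζ) {b₀ b₁ : ℝ → ℝ} (hb₀ : Continuous b₀) (hb₁ : Continuous b₁)
    (h₀ : ∀ θ h, |h - a₀| ≤ ζ → |e h θ - b₀ θ| ≤ ν)
    (h₁ : ∀ θ h, |h - a₁| ≤ ζ → |e h θ - b₁ θ| ≤ ν)
    (hν₀ : ν * T < |∫ θ in (0:ℝ)..T, b₀ θ|) (hν₁ : ν * T < |∫ θ in (0:ℝ)..T, b₁ θ|)
    (hsign : (∫ θ in (0:ℝ)..T, b₀ θ) * (∫ θ in (0:ℝ)..T, b₁ θ) < 0) :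
    ∃ h : ℝ → ℝ, (∀ θ, HasDerivAt h (ε * e (h θ) θ) θ) ∧ Function.Periodic h T ∧
      h 0 ∈ Set.uIcc a₀ a₁ ∧ ∀ θ ∈ Set.Icc 0 T, |h θ - h 0| ≤ ζ := by
  have hKε : ∀ θ, LipschitzWith (⟨ε, hε.le⟩ * K) fun h => ε * e h θ := fun θ => by
    have := (LipschitzWith.of_dist_le_mul (K := ⟨ε, hε.le⟩) (f := fun x : ℝ => ε * x) fun x y => by
      rw [Real.dist_eq, Real.dist_eq, ← mul_sub, abs_mul, abs_of_pos hε]; rfl).comp (hK θ)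
    exact this
  have hsol : ∀ a : ℝ, ∃ h : ℝ → ℝ, h 0 = a ∧ ∀ θ, HasDerivAt h (ε * e (h θ) θ) θ := fun a =>
    exists_global_solution (fun h θ => ε * e h θ) (continuous_const.mul he) (M := ε * M)
      (fun h θ => by rw [abs_mul, abs_of_pos hε]; gcongr; exact hM h θ) hKε 0 a
  choose h h0 hd using hsol
  have hdist : ∀ a, ∀ θ ∈ Set.Icc 0 T, |h a θ - a| ≤ ζ := by
    intro a θ hθ
    have := norm_image_sub_le_of_norm_deriv_le_segment' (f := h a) (a := 0) (b := T) (C := ε * M)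
      (fun x _ => (hd a x).hasDerivWithinAt)
      (fun x _ => by rw [Real.norm_eq_abs, abs_mul, abs_of_pos hε]; gcongr; exact hM _ _) θ hθ
    rw [Real.norm_eq_abs, h0, sub_zero] at this
    refine this.trans (le_trans ?_ hεζ)
    have : 0 ≤ ε * M := mul_nonneg hε.le ((abs_nonneg _).trans (hM 0 0))
    gcongr; exact hθ.2
  have hcont : ∀ a, Continuous (h a) := fun a =>
    continuous_iff_continuousAt.2 fun θ => (hd a θ).continuousAt
  have hcts : ∀ a, Continuous fun θ => e (h a θ) θ := fun a =>
    he.comp ((hcont a).prodMk continuous_id)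
  have hincr : ∀ (a : ℝ) (b : ℝ → ℝ), Continuous b → (∀ θ h, |h - a| ≤ ζ → |e h θ - b θ| ≤ ν) →
      |(h a T - a) - ε * ∫ θ in (0:ℝ)..T, b θ| ≤ ε * (ν * T) := by
    intro a b hb hab
    have h1 : ∫ θ in (0:ℝ)..T, ε * e (h a θ) θ = h a T - h a 0 :=
      intervalIntegral.integral_eq_sub_of_hasDerivAt (fun θ _ => hd a θ)
        ((continuous_const.mul (hcts a)).intervalIntegrable _ _)
    rw [h0, intervalIntegral.integral_const_mul] at h1
    rw [← h1, ← mul_sub, abs_mul, abs_of_pos hε,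
      ← intervalIntegral.integral_sub ((hcts a).intervalIntegrable _ _) (hb.intervalIntegrable _ _)]
    have h2 := intervalIntegral.norm_integral_le_of_norm_le_const (a := 0) (b := T) (C := ν)
      (f := fun θ => e (h a θ) θ - b θ) (fun θ hθ => by
        rw [Set.uIoc_of_le hT.le] at hθ
        exact hab θ _ (hdist a θ ⟨hθ.1.le, hθ.2⟩))
    rw [Real.norm_eq_abs, sub_zero, abs_of_pos hT] at h2
    gcongr
  have hd0 := hincr a₀ b₀ hb₀ h₀
  have hd1 := hincr a₁ b₁ hb₁ h₁
  have hdcont : Continuous fun a => h a T - a := by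
    refine Continuous.sub ?_ continuous_id
    have hLip : LipschitzWith (Real.toNNReal (Real.exp ((⟨ε, hε.le⟩ * K : NNReal) * T)))
        fun a => h a T := by
      refine LipschitzWith.of_dist_le_mul fun a b => ?_
      have := dist_le_of_trajectories_ODE (v := fun θ h => ε * e h θ) (K := ⟨ε, hε.le⟩ * K)
        (f := h a) (g := h b) (a := 0) (b := T) (δ := dist a b) hKε (hcont a).continuousOn
        (fun t _ => (hd a t).hasDerivWithinAt) (hcont b).continuousOn
        (fun t _ => (hd b t).hasDerivWithinAt) (by rw [h0, h0]) T ⟨hT.le, le_rfl⟩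
      rw [Real.coe_toNNReal _ (Real.exp_pos _).le, mul_comm]
      simpa using this
    exact hLip.continuous
  obtain ⟨a, ha, hza⟩ : ∃ a ∈ Set.uIcc a₀ a₁, h a T - a = 0 := by
    have hmem : (0:ℝ) ∈ Set.uIcc (h a₀ T - a₀) (h a₁ T - a₁) := by
      have e0 := abs_le.1 hd0
      have e1 := abs_le.1 hd1
      have f0 := mul_lt_mul_of_pos_left hν₀ hε
      have f1 := mul_lt_mul_of_pos_left hν₁ hε
      rcases mul_neg_iff.1 hsign with ⟨p, n⟩ | ⟨n, p⟩
      · rw [abs_of_pos p] at f0; rw [abs_of_neg n] at f1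
        rw [Set.mem_uIcc]; right; constructor <;> nlinarith
      · rw [abs_of_neg n] at f0; rw [abs_of_pos p] at f1
        rw [Set.mem_uIcc]; left; constructor <;> nlinarith
    exact intermediate_value_uIcc hdcont.continuousOn hmem
  refine ⟨h a, hd a, ?_, by rwa [h0], fun θ hθ => by rw [h0]; exact hdist a θ hθ⟩
  have := ODE_solution_unique_univ (v := fun θ h => ε * e h θ) (K := ⟨ε, hε.le⟩ * K)
    (s := fun _ => Set.univ) (f := fun θ => h a (θ + T)) (g := h a) (t₀ := 0)
    (fun t => (hKε t).lipschitzOnWith)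
    (fun t => ⟨by simpa only [hper] using (hd a (t + T)).comp_add_const t T, trivial⟩)
    (fun t => ⟨hd a t, trivial⟩) (by rw [zero_add, h0]; linarith)
  exact fun t => congrFun this t

/-- Uniqueness of periodic solutions of a slowly varying scalar equation near a level where the
averaged equation is hyperbolic. -/
lemma periodic_solution_unique {e : ℝ → ℝ → ℝ} {K : NNReal}
    (hK : ∀ θ, LipschitzWith K fun h => e h θ) {T ε ζ ν a : ℝ} (hT : 0 < T) (hε : 0 < ε)
    {k : ℝ → ℝ} (hk : Continuous k) (hkT : Function.Periodic k T)
    (hek : ∀ θ x y, |x - a| < ζ → |y - a| < ζ →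
      |e y θ - e x θ - k θ * (y - x)| ≤ ν * |y - x|)
    (hν : ν * T < |∫ θ in (0:ℝ)..T, k θ|) {h₁ h₂ : ℝ → ℝ}
    (hd₁ : ∀ θ, HasDerivAt h₁ (ε * e (h₁ θ) θ) θ) (hd₂ : ∀ θ, HasDerivAt h₂ (ε * e (h₂ θ) θ) θ)
    (hp₁ : Function.Periodic h₁ T) {θ₀ : ℝ} {n : ℕ} (hn : 0 < n)
    (hp₂ : h₂ (θ₀ + n * T) = h₂ θ₀) (ha₁ : ∀ θ, |h₁ θ - a| < ζ) (ha₂ : ∀ θ, |h₂ θ - a| < ζ) :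
    h₁ = h₂ := by
  have hKε : ∀ θ, LipschitzWith (⟨ε, hε.le⟩ * K) fun h => ε * e h θ := fun θ => by
    have := (LipschitzWith.of_dist_le_mul (K := ⟨ε, hε.le⟩) (f := fun x : ℝ => ε * x) fun x y => by
      rw [Real.dist_eq, Real.dist_eq, ← mul_sub, abs_mul, abs_of_pos hε]; rfl).comp (hK θ)
    exact this
  by_cases hex : ∃ θ, h₁ θ = h₂ θ
  · obtain ⟨θ, hθ⟩ := hex
    exact ODE_solution_unique_univ (v := fun θ h => ε * e h θ) (K := ⟨ε, hε.le⟩ * K)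
      (s := fun _ => Set.univ) (t₀ := θ) (fun t => (hKε t).lipschitzOnWith)
      (fun t => ⟨hd₁ t, trivial⟩) (fun t => ⟨hd₂ t, trivial⟩) hθ
  exfalso
  push Not at hex
  have hw : ∀ θ, h₂ θ - h₁ θ ≠ 0 := fun θ => sub_ne_zero.2 (hex θ).symm
  have hdΛ : ∀ θ, HasDerivAt (fun θ => Real.log (h₂ θ - h₁ θ) - ε * ∫ s in θ₀..θ, k s)
      ((ε * e (h₂ θ) θ - ε * e (h₁ θ) θ) / (h₂ θ - h₁ θ) - ε * k θ) θ := fun θ =>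
    (((hd₂ θ).sub (hd₁ θ)).log (hw θ)).sub
      ((intervalIntegral.integral_hasDerivAt_right (hk.intervalIntegrable _ _)
        hk.stronglyMeasurable.stronglyMeasurableAtFilter hk.continuousAt).const_mul ε)
  have hbd : ∀ θ, |(ε * e (h₂ θ) θ - ε * e (h₁ θ) θ) / (h₂ θ - h₁ θ) - ε * k θ| ≤ ε * ν := by
    intro θ
    have h1 := hek θ _ _ (ha₁ θ) (ha₂ θ)
    have h2 : (ε * e (h₂ θ) θ - ε * e (h₁ θ) θ) / (h₂ θ - h₁ θ) - ε * k θ =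
        ε * ((e (h₂ θ) θ - e (h₁ θ) θ - k θ * (h₂ θ - h₁ θ)) / (h₂ θ - h₁ θ)) := by
      have := hw θ; field_simp
    rw [h2, abs_mul, abs_of_pos hε, abs_div]
    gcongr
    rwa [div_le_iff₀ (abs_pos.2 (hw θ))]
  have hnT : (0:ℝ) < n * T := by positivity
  have hfin := norm_image_sub_le_of_norm_deriv_le_segment' (a := θ₀) (b := θ₀ + n * T) (C := ε * ν)
      (fun x _ => (hdΛ x).hasDerivWithinAt) (fun x _ => hbd x) (θ₀ + n * T)
      ⟨by linarith, le_rfl⟩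
  have hp₁' : h₁ (θ₀ + n * T) = h₁ θ₀ := hp₁.nat_mul n θ₀
  have h_int : ∫ s in θ₀..θ₀ + n * T, k s = n * ∫ s in (0:ℝ)..T, k s := by
    have := hkT.intervalIntegral_add_zsmul_eq n θ₀ (fun a b => hk.intervalIntegrable a b)
    rw [hkT.intervalIntegral_add_eq θ₀ 0, zero_add] at this
    simpa using this
  rw [hp₂, hp₁', intervalIntegral.integral_same, h_int, Real.norm_eq_abs] at hfin
  rw [show Real.log (h₂ θ₀ - h₁ θ₀) - ε * (n * ∫ s in (0:ℝ)..T, k s) -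
    (Real.log (h₂ θ₀ - h₁ θ₀) - ε * 0) = -(ε * n * ∫ s in (0:ℝ)..T, k s) by ring, abs_neg, abs_mul,
    abs_of_pos (by positivity : 0 < ε * n)] at hfin
  have := mul_lt_mul_of_pos_left hν (by positivity : 0 < ε * n)
  nlinarith

/-- A periodic solution of the reduced scalar equation in action-angle type coordinates
`(h, θ) ↦ X h θ` is a limit cycle if the scalar equation is hyperbolic on average. -/
lemma isLimitCycle_of_chart {V : ℝ × ℝ → ℝ × ℝ} (hV : ContDiff ℝ 1 V) {H : ℝ × ℝ → ℝ}
    (hH : Continuous H) {O : Set (ℝ × ℝ)} (hO : IsOpen O) {lo hi T : ℝ} (hT : 0 < T)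
    {X : ℝ → ℝ → ℝ × ℝ} (hX : Continuous (Function.uncurry X))
    (hXT : ∀ h θ, X h (θ + T) = X h θ) (hHX : ∀ h θ, H (X h θ) = max lo (min hi h))
    (hXO : ∀ h ∈ Set.Ioo lo hi, ∀ θ, X h θ ∈ O)
    (hOX : ∀ p ∈ O, H p ∈ Set.Ioo lo hi ∧ ∃ θ, X (H p) θ = p)
    (hinj : ∀ h θ θ', X h θ = X h θ' → ∃ n : ℤ, θ' = θ + n * T)
    {σ : ℝ → ℝ → ℝ} (hσ : Continuous (Function.uncurry σ)) {m : ℝ} (hm : 0 < m)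
    (hσm : ∀ h θ, m ≤ σ h θ) (hσT : ∀ h θ, σ h (θ + T) = σ h θ)
    {e : ℝ → ℝ → ℝ} (he : Continuous (Function.uncurry e)) {M : ℝ} (hM : ∀ h θ, |e h θ| ≤ M)
    {K : NNReal} (hK : ∀ θ, LipschitzWith K fun h => e h θ) {ε : ℝ} (hε : 0 < ε)
    (hδ : ∀ (h : ℝ → ℝ) θ, HasDerivAt h (ε * e (h θ) θ) θ → h θ ∈ Set.Ioo lo hi →
      HasDerivAt (fun θ => X (h θ) θ) (σ (h θ) θ • V (X (h θ) θ)) θ)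
    {a ζ ν : ℝ} (hlo : lo ≤ a - ζ) (hhi : a + ζ ≤ hi) {k : ℝ → ℝ} (hk : Continuous k)
    (hkT : Function.Periodic k T)
    (hek : ∀ θ x y, |x - a| < ζ → |y - a| < ζ → |e y θ - e x θ - k θ * (y - x)| ≤ ν * |y - x|)
    (hν : ν * T < |∫ θ in (0:ℝ)..T, k θ|) {h₁ : ℝ → ℝ}
    (hd₁ : ∀ θ, HasDerivAt h₁ (ε * e (h₁ θ) θ) θ) (hp₁ : Function.Periodic h₁ T)
    (ha₁ : ∀ θ, |h₁ θ - a| < ζ) :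
    IsLimitCycle V (Set.range fun θ => X (h₁ θ) θ) := by
  have hin : ∀ x, |x - a| < ζ → x ∈ Set.Ioo lo hi := fun x hx => by
    have := abs_lt.1 hx; constructor <;> linarith
  have hcl : ∀ x ∈ Set.Ioo lo hi, max lo (min hi x) = x := fun x hx => by
    rw [min_eq_right hx.2.le, max_eq_right hx.1.le]
  have hc₁ : Continuous h₁ := continuous_iff_continuousAt.2 fun θ => (hd₁ θ).continuousAt
  refine ⟨?_, {p | p ∈ O ∧ |H p - a| < ζ}, ?_, ?_, ?_⟩
  · refine isPeriodicOrbit_range (σ := fun θ => σ (h₁ θ) θ)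
      (hσ.comp (hc₁.prodMk continuous_id)) hm (fun θ => hσm _ _) hT (fun θ => ?_) (fun θ => ?_)
      (fun θ => hδ h₁ θ (hd₁ θ) (hin _ (ha₁ θ))) (θ₁ := 0) (θ₂ := T / 2) ?_
    · simp only [hσT, hp₁ θ]
    · simp only [hXT, hp₁ θ]
    · intro heq
      have hheq : h₁ 0 = h₁ (T / 2) := by
        have := congrArg H heq
        simpa only [hHX, hcl _ (hin _ (ha₁ _))] using this
      simp only [← hheq] at heq
      obtain ⟨n, hn⟩ := hinj _ _ _ heq
      have h2 : (2 * n - 1 : ℝ) * T = 0 := by linarith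
      rcases mul_eq_zero.1 h2 with h3 | h3
      · have : (2 * n - 1 : ℤ) = 0 := by exact_mod_cast h3
        omega
      · exact hT.ne' h3
  · exact hO.inter (isOpen_lt (hH.sub continuous_const).abs continuous_const)
  · rintro _ ⟨θ, rfl⟩
    refine ⟨hXO _ (hin _ (ha₁ θ)) θ, ?_⟩
    rw [hHX, hcl _ (hin _ (ha₁ θ))]; exact ha₁ θ
  · rintro Γ' ⟨γ, hγ, ⟨T', hT', hγT⟩, -, rfl⟩ hΓ'
    have hγU : ∀ t, γ t ∈ O ∧ |H (γ t) - a| < ζ := fun t => hΓ' ⟨t, rfl⟩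
    have hγc : Continuous γ := continuous_iff_continuousAt.2 fun t => (hγ t).continuousAt
    obtain ⟨hH0, θ₀, hθ₀⟩ := hOX _ (hγU 0).1
    have hKε : ∀ θ, LipschitzWith (⟨ε, hε.le⟩ * K) fun h => ε * e h θ := fun θ => by
      have := (LipschitzWith.of_dist_le_mul (K := ⟨ε, hε.le⟩) (f := fun x : ℝ => ε * x)
        fun x y => by
          rw [Real.dist_eq, Real.dist_eq, ← mul_sub, abs_mul, abs_of_pos hε]; rfl).comp (hK θ)
      exact this
    obtain ⟨h₂, h₂0, hd₂⟩ := exists_global_solution (fun h θ => ε * e h θ)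
      (continuous_const.mul he) (M := ε * M)
      (fun h θ => by rw [abs_mul, abs_of_pos hε]; gcongr; exact hM h θ) hKε θ₀ (H (γ 0))
    have hc₂ : Continuous h₂ := continuous_iff_continuousAt.2 fun θ => (hd₂ θ).continuousAt
    obtain ⟨φ, φ0, hφ, hφmono, hφs, -⟩ := exists_time_change (fun θ => σ (h₂ θ) θ)
      (hσ.comp (hc₂.prodMk continuous_id)) hm (fun θ => hσm _ _) θ₀
    have hφc : Continuous φ := continuous_iff_continuousAt.2 fun t => (hφ t).continuousAt
    set Z : Set ℝ := {t | γ t = X (h₂ (φ t)) (φ t)} with hZ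
    have hδc : Continuous fun t => X (h₂ (φ t)) (φ t) := hX.comp ((hc₂.comp hφc).prodMk hφc)
    have hZh : ∀ t ∈ Z, |h₂ (φ t) - a| < ζ := by
      intro t ht
      have h1 : H (γ t) = max lo (min hi (h₂ (φ t))) := by rw [ht, hHX]
      have h2 := (hγU t).2
      have h3 := hin _ h2
      have h4 : max lo (min hi (h₂ (φ t))) = h₂ (φ t) := by
        rw [h1] at h3
        have h5 : h₂ (φ t) < hi := by
          by_contra hc
          rw [min_eq_left (not_lt.1 hc)] at h3
          have := (le_max_right lo hi).trans_lt h3.2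
          exact lt_irrefl _ this
        rw [min_eq_right h5.le] at h3 ⊢
        have h6 : lo < h₂ (φ t) := by
          by_contra hc
          rw [max_eq_left (not_lt.1 hc)] at h3
          exact lt_irrefl _ h3.1
        exact max_eq_right h6.le
      rwa [h1, h4] at h2
    have hZall : ∀ t, γ t = X (h₂ (φ t)) (φ t) := by
      have hclosed : IsClosed Z := isClosed_eq hγc hδc
      have hopen : IsOpen Z := by
        rw [isOpen_iff_mem_nhds]
        intro t ht
        have hnear : ∀ᶠ s in nhds t, |h₂ (φ s) - a| < ζ :=
          ((hc₂.comp hφc).sub continuous_const).abs.continuousAt.eventually_lt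
            continuousAt_const (hZh t ht)
        have hδd : ∀ᶠ s in nhds t, HasDerivAt (fun t => X (h₂ (φ t)) (φ t))
            (V (X (h₂ (φ s)) (φ s))) s := by
          filter_upwards [hnear] with s hs
          have := (hδ h₂ (φ s) (hd₂ _) (hin _ hs)).scomp s (hφ s)
          rwa [smul_smul, one_div, inv_mul_cancel₀ (hm.trans_le (hσm _ _)).ne', one_smul] at this
        obtain ⟨L, S, hS, hL⟩ := hV.contDiffAt.exists_lipschitzOnWith (x := γ t)
        have hγS : ∀ᶠ s in nhds t, γ s ∈ S := hγc.continuousAt.eventually hS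
        have hδS : ∀ᶠ s in nhds t, X (h₂ (φ s)) (φ s) ∈ S :=
          hδc.continuousAt.eventually (ht ▸ hS : ∀ᶠ p in nhds (X (h₂ (φ t)) (φ t)), p ∈ S)
        exact ODE_solution_unique_of_eventually (v := fun _ => V) (s := fun _ => S) (K := L)
          (Eventually.of_forall fun _ => hL)
          (hγS.mono fun s hs => ⟨hγ s, hs⟩) (hδd.and hδS) ht
      have : Z = Set.univ := IsClopen.eq_univ ⟨hclosed, hopen⟩
        ⟨0, by rw [hZ, Set.mem_ofPred_eq, φ0, h₂0, hθ₀]⟩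
      intro t
      have ht : t ∈ Z := by rw [this]; trivial
      exact ht
    have ha₂ : ∀ θ, |h₂ θ - a| < ζ := fun θ => by
      obtain ⟨t, rfl⟩ := hφs θ
      exact hZh t (hZall t)
    have hret : X (h₂ (φ T')) (φ T') = X (h₂ (φ 0)) (φ 0) := by
      rw [← hZall, ← hZall]; simpa using hγT 0
    have hhret : h₂ (φ T') = h₂ (φ 0) := by
      have := congrArg H hret
      simpa only [hHX, hcl _ (hin _ (ha₂ _))] using this
    rw [hhret] at hret
    obtain ⟨n, hn⟩ := hinj _ _ _ hret.symm
    have hlt := hφmono hT'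
    have hn0 : 0 < n := by
      rw [hn] at hlt
      have : 0 < (n:ℝ) * T := by linarith
      exact_mod_cast pos_of_mul_pos_left this hT.le
    obtain ⟨N, rfl⟩ := Int.eq_ofNat_of_zero_le hn0.le
    rw [hn] at hhret
    have heq : h₁ = h₂ := periodic_solution_unique hK hT hε hk hkT hek hν hd₁ hd₂ hp₁
      (by exact_mod_cast hn0) (by simpa using hhret) ha₁ ha₂
    rw [heq]
    rw [show γ = (fun θ => X (h₂ θ) θ) ∘ φ from funext hZall, hφs.range_comp]

/-- Radial derivative of the energy in quasi-homogeneous polar coordinates. -/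
noncomputable def qN (d : ℕ) (g r c s : ℝ) : ℝ := c * g + (d + 1) * r ^ (2 * d + 1) * s ^ 2

/-- Radial derivative of `qN`. -/
noncomputable def qN' (d : ℕ) (g' r c s : ℝ) : ℝ :=
  c * (c * g') + (d + 1) * ((2 * d + 1) * r ^ (2 * d)) * s ^ 2

/-- Numerator of the angular velocity of the perturbed field. -/
noncomputable def qD (d : ℕ) (ε g F r c s : ℝ) : ℝ := qN d g r c s + ε * ((d + 1) * (F * r ^ d) * s)

/-- Radial derivative of `qD`. -/
noncomputable def qD' (d : ℕ) (ε g' F F' r c s : ℝ) : ℝ :=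
  qN' d g' r c s + ε * ((d + 1) * (c * F' * r ^ d + F * (d * r ^ (d - 1))) * s)

/-- Numerator of the rate of change of the energy with the angle. -/
noncomputable def qY (d : ℕ) (g F r c s : ℝ) : ℝ :=
  -(g * F * r ^ (d + 1) * (c ^ 2 + (d + 1) * s ^ 2))

/-- Radial derivative of `qY`. -/
noncomputable def qY' (d : ℕ) (g g' F F' r c s : ℝ) : ℝ :=
  -(((c * g' * F + g * (c * F')) * r ^ (d + 1) + g * F * ((d + 1) * r ^ d)) *
    (c ^ 2 + (d + 1) * s ^ 2))

/-- Rate of change of the energy with the angle, divided by `ε`. -/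
noncomputable def qE (d : ℕ) (ε g F r c s : ℝ) : ℝ := qY d g F r c s / qD d ε g F r c s

/-- Derivative of `qE` with respect to the energy. -/
noncomputable def qK (d : ℕ) (ε g g' F F' r c s : ℝ) : ℝ :=
  (qY' d g g' F F' r c s * qD d ε g F r c s - qY d g F r c s * qD' d ε g' F F' r c s) /
    qD d ε g F r c s ^ 2 / qN d g r c s

lemma hasDerivAt_comp_mul {f : ℝ → ℝ} {f' r c : ℝ} (hf : HasDerivAt f f' (r * c)) :
    HasDerivAt (fun r => f (r * c)) (c * f') r := by
  have := hf.comp r ((hasDerivAt_id r).mul_const c)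
  simpa [mul_comm, Function.comp_def] using this

lemma hasDerivAt_qN {d : ℕ} {g : ℝ → ℝ} {g' r c s : ℝ} (hg : HasDerivAt g g' (r * c)) :
    HasDerivAt (fun r => qN d (g (r * c)) r c s) (qN' d g' r c s) r := by
  have h1 := (hasDerivAt_comp_mul hg).const_mul c
  have h2 := (((hasDerivAt_pow (2 * d + 1) r).const_mul ((d:ℝ) + 1)).mul_const (s ^ 2))
  refine (h1.add h2).congr_deriv ?_
  simp only [qN']; push_cast; simp

lemma hasDerivAt_qD {d : ℕ} {g F : ℝ → ℝ} {ε g' F' r c s : ℝ} (hg : HasDerivAt g g' (r * c))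
    (hF : HasDerivAt F F' (r * c)) :
    HasDerivAt (fun r => qD d ε (g (r * c)) (F (r * c)) r c s)
      (qD' d ε g' (F (r * c)) F' r c s) r := by
  have h1 := ((((hasDerivAt_comp_mul hF).mul (hasDerivAt_pow d r)).const_mul
    ((d:ℝ) + 1)).mul_const s).const_mul ε
  exact (hasDerivAt_qN hg).add h1

lemma hasDerivAt_qY {d : ℕ} {g F : ℝ → ℝ} {g' F' r c s : ℝ} (hg : HasDerivAt g g' (r * c))
    (hF : HasDerivAt F F' (r * c)) :
    HasDerivAt (fun r => qY d (g (r * c)) (F (r * c)) r c s)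
      (qY' d (g (r * c)) g' (F (r * c)) F' r c s) r := by
  have h1 := ((((hasDerivAt_comp_mul hg).mul (hasDerivAt_comp_mul hF)).mul
    (hasDerivAt_pow (d + 1) r)).mul_const (c ^ 2 + (d + 1) * s ^ 2)).neg
  refine h1.congr_deriv ?_
  simp only [qY', Pi.mul_apply]; push_cast; simp

lemma hasDerivAt_qE {d : ℕ} {g F : ℝ → ℝ} {ε g' F' r c s : ℝ} (hg : HasDerivAt g g' (r * c))
    (hF : HasDerivAt F F' (r * c)) (hD : qD d ε (g (r * c)) (F (r * c)) r c s ≠ 0)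
    (hN : qN d (g (r * c)) r c s ≠ 0) :
    HasDerivAt (fun r => qE d ε (g (r * c)) (F (r * c)) r c s)
      (qK d ε (g (r * c)) g' (F (r * c)) F' r c s * qN d (g (r * c)) r c s) r := by
  have := (hasDerivAt_qY (d := d) (s := s) hg hF).div (hasDerivAt_qD (d := d) (ε := ε) (s := s) hg hF) hD
  simp only [qK]
  rw [div_mul_cancel₀ _ hN]
  exact this

/-- A conservative system `ẋ = v, v̇ = -g(x)` with odd `g`, with quasi-homogeneous polar coordinates
`x = r cos θ, v = -r ^ (d + 1) sin θ` on an annulus foliated by the energy levels in `[lo, hi]`. -/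
structure EnergyAnnulus where
  d : ℕ
  g : ℝ → ℝ
  g' : ℝ → ℝ
  G : ℝ → ℝ
  ra : ℝ
  rb : ℝ
  lo : ℝ
  hi : ℝ
  L : ℝ
  hG : ∀ x, HasDerivAt G (g x) x
  hg : ∀ x, HasDerivAt g (g' x) x
  hg' : Continuous g'
  g_neg : ∀ x, g (-x) = -g x
  G_neg : ∀ x, G (-x) = G x
  ra_pos : 0 < ra
  ra_lt_rb : ra < rb
  rb_lt : rb < L
  lo_lt_hi : lo < hi
  pos : ∀ r ∈ Set.Icc ra rb, ∀ θ,
    0 < qN d (g (r * Real.cos θ)) r (Real.cos θ) (Real.sin θ)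
  at_ra : ∀ θ, (ra ^ (d + 1) * Real.sin θ) ^ 2 / 2 + G (ra * Real.cos θ) < lo
  at_rb : ∀ θ, hi < (rb ^ (d + 1) * Real.sin θ) ^ 2 / 2 + G (rb * Real.cos θ)
  surj : ∀ x v : ℝ, |x| < L → v ^ 2 / 2 + G x ∈ Set.Ioo lo hi →
    ∃ r ∈ Set.Icc ra rb, ∃ θ, x = r * Real.cos θ ∧ v = -(r ^ (d + 1) * Real.sin θ)

namespace EnergyAnnulus

variable (A : EnergyAnnulus)

/-- The energy in polar coordinates. -/
noncomputable def Hp (r θ : ℝ) : ℝ := (r ^ (A.d + 1) * Real.sin θ) ^ 2 / 2 + A.G (r * Real.cos θ)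

/-- The energy. -/
noncomputable def H (p : ℝ × ℝ) : ℝ := p.2 ^ 2 / 2 + A.G p.1

lemma continuous_G : Continuous A.G := continuous_iff_continuousAt.2 fun x => (A.hG x).continuousAt

lemma continuous_g : Continuous A.g := continuous_iff_continuousAt.2 fun x => (A.hg x).continuousAt

lemma continuous_H : Continuous A.H := by
  have := A.continuous_G
  unfold H; fun_prop

lemma continuous_Hp : Continuous (Function.uncurry A.Hp) := by
  have := A.continuous_G
  unfold Hp Function.uncurry; fun_prop

lemma hasDerivAt_Hp (r θ : ℝ) : HasDerivAt (fun r => A.Hp r θ)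
    (qN A.d (A.g (r * Real.cos θ)) r (Real.cos θ) (Real.sin θ)) r := by
  have h1 := ((((hasDerivAt_pow (A.d + 1) r).mul_const (Real.sin θ)).pow 2).div_const 2).add
    (hasDerivAt_comp_mul (A.hG (r * Real.cos θ)))
  refine h1.congr_deriv ?_
  simp only [qN]; push_cast; ring

lemma strictMonoOn_Hp (θ : ℝ) : StrictMonoOn (fun r => A.Hp r θ) (Set.Icc A.ra A.rb) := by
  refine strictMonoOn_of_deriv_pos (convex_Icc _ _)
    (fun r _ => (A.hasDerivAt_Hp r θ).continuousAt.continuousWithinAt) fun r hr => ?_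
  rw [interior_Icc] at hr
  rw [(A.hasDerivAt_Hp r θ).deriv]
  exact A.pos r (Set.Ioo_subset_Icc_self hr) θ

/-- Truncation of the energy to `[lo, hi]`. -/
noncomputable def cl (h : ℝ) : ℝ := max A.lo (min A.hi h)

lemma cl_mem (h : ℝ) : A.cl h ∈ Set.Icc A.lo A.hi :=
  ⟨le_max_left _ _, max_le A.lo_lt_hi.le (min_le_left _ _)⟩

lemma cl_of_mem {h : ℝ} (hh : h ∈ Set.Icc A.lo A.hi) : A.cl h = h := by
  rw [cl, min_eq_right hh.2, max_eq_right hh.1]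

lemma continuous_cl : Continuous A.cl := by unfold cl; fun_prop

lemma exists_rho (h θ : ℝ) : ∃ r ∈ Set.Icc A.ra A.rb, A.Hp r θ = A.cl h :=
  intermediate_value_Icc A.ra_lt_rb.le (f := fun r => A.Hp r θ)
    (fun r _ => (A.hasDerivAt_Hp r θ).continuousAt.continuousWithinAt)
    ⟨(A.at_ra θ).le.trans (A.cl_mem h).1, (A.cl_mem h).2.trans (A.at_rb θ).le⟩

/-- The radius as a function of energy and angle. -/
noncomputable def rho (h θ : ℝ) : ℝ := (A.exists_rho h θ).choose

lemma rho_mem (h θ : ℝ) : A.rho h θ ∈ Set.Icc A.ra A.rb := (A.exists_rho h θ).choose_spec.1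

lemma Hp_rho (h θ : ℝ) : A.Hp (A.rho h θ) θ = A.cl h := (A.exists_rho h θ).choose_spec.2

lemma rho_pos (h θ : ℝ) : 0 < A.rho h θ := A.ra_pos.trans_le (A.rho_mem h θ).1

lemma rho_eq {h θ r : ℝ} (hr : r ∈ Set.Icc A.ra A.rb) (h1 : A.Hp r θ = A.cl h) :
    A.rho h θ = r :=
  (A.strictMonoOn_Hp θ).injOn (A.rho_mem h θ) hr ((A.Hp_rho h θ).trans h1.symm)

lemma rho_periodic (h θ : ℝ) : A.rho h (θ + 2 * Real.pi) = A.rho h θ := by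
  refine A.rho_eq (A.rho_mem h θ) ?_
  rw [← A.Hp_rho h θ, Hp, Hp, Real.sin_add_two_pi, Real.cos_add_two_pi]

lemma rho_symm (h θ : ℝ) : A.rho h (Real.pi - θ) = A.rho h θ := by
  refine A.rho_eq (A.rho_mem h θ) ?_
  rw [← A.Hp_rho h θ, Hp, Hp, Real.sin_pi_sub, Real.cos_pi_sub, mul_neg, A.G_neg]

lemma continuous_rho : Continuous (Function.uncurry A.rho) := by
  rw [continuous_iff_continuousAt]
  rintro ⟨h₀, θ₀⟩
  have hcl : ContinuousAt (fun z : ℝ × ℝ => A.cl z.1) (h₀, θ₀) :=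
    (A.continuous_cl.comp continuous_fst).continuousAt
  have hHp : ∀ b, ContinuousAt (fun z : ℝ × ℝ => A.Hp b z.2) (h₀, θ₀) := fun b =>
    (A.continuous_Hp.comp (continuous_const.prodMk continuous_snd)).continuousAt
  refine tendsto_order.2 ⟨fun b hb => ?_, fun b hb => ?_⟩
  · rcases lt_or_ge b A.ra with hba | hba
    · exact Eventually.of_forall fun z => hba.trans_le (A.rho_mem _ _).1
    have hb' : b ∈ Set.Icc A.ra A.rb := ⟨hba, hb.le.trans (A.rho_mem _ _).2⟩
    have hlt : A.Hp b θ₀ < A.cl h₀ := by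
      rw [← A.Hp_rho h₀ θ₀]; exact A.strictMonoOn_Hp θ₀ hb' (A.rho_mem _ _) hb
    filter_upwards [(hHp b).eventually_lt hcl hlt] with z hz
    rw [← A.Hp_rho z.1 z.2] at hz
    exact ((A.strictMonoOn_Hp z.2).lt_iff_lt hb' (A.rho_mem _ _)).1 hz
  · rcases lt_or_ge A.rb b with hba | hba
    · exact Eventually.of_forall fun z => (A.rho_mem _ _).2.trans_lt hba
    have hb' : b ∈ Set.Icc A.ra A.rb := ⟨(A.rho_mem _ _).1.trans hb.le, hba⟩
    have hlt : A.cl h₀ < A.Hp b θ₀ := by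
      rw [← A.Hp_rho h₀ θ₀]; exact A.strictMonoOn_Hp θ₀ (A.rho_mem _ _) hb' hb
    filter_upwards [hcl.eventually_lt (hHp b) hlt] with z hz
    rw [← A.Hp_rho z.1 z.2] at hz
    exact ((A.strictMonoOn_Hp z.2).lt_iff_lt (A.rho_mem _ _) hb').1 hz

end EnergyAnnulus

/-- The Liénard system in the Liénard plane. -/
noncomputable def liePlane (F g : ℝ → ℝ) (ε : ℝ) (p : ℝ × ℝ) : ℝ × ℝ :=
  (p.2 - ε * F p.1, -g p.1)

lemma le_of_polar_eq {d : ℕ} {r r' θ θ' : ℝ} (hr : 0 < r)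
    (hc : r * Real.cos θ = r' * Real.cos θ')
    (hs : r ^ (d + 1) * Real.sin θ = r' ^ (d + 1) * Real.sin θ') : r' ≤ r := by
  by_contra! h
  have hq : 1 < r' / r := (one_lt_div hr).2 h
  have hq0 : 0 < r' / r := one_pos.trans hq
  have h1 : Real.cos θ = r' / r * Real.cos θ' := by field_simp; linarith
  have h2 : Real.sin θ = (r' / r) ^ (d + 1) * Real.sin θ' := by
    rw [div_pow]; field_simp; linarith
  have h3 : r' / r ≤ (r' / r) ^ (d + 1) := le_self_pow₀ hq.le (by simp)
  have h4 : (r' / r) ^ 2 ≤ ((r' / r) ^ (d + 1)) ^ 2 := by gcongr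
  have h5 := Real.sin_sq_add_cos_sq θ
  have h6 := Real.sin_sq_add_cos_sq θ'
  rw [h1, h2, mul_pow, mul_pow] at h5
  nlinarith [sq_nonneg (Real.sin θ'), mul_le_mul_of_nonneg_right h4 (sq_nonneg (Real.sin θ'))]

namespace EnergyAnnulus

variable (A : EnergyAnnulus)

/-- Angular derivative of the energy in polar coordinates. -/
noncomputable def Hθ (r θ : ℝ) : ℝ :=
  r ^ (2 * A.d + 2) * Real.sin θ * Real.cos θ - r * Real.sin θ * A.g (r * Real.cos θ)

lemma hasFDerivAt_Hp (r θ : ℝ) : HasFDerivAt (Function.uncurry A.Hp)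
    (qN A.d (A.g (r * Real.cos θ)) r (Real.cos θ) (Real.sin θ) • ContinuousLinearMap.fst ℝ ℝ ℝ +
      A.Hθ r θ • ContinuousLinearMap.snd ℝ ℝ ℝ) (r, θ) := by
  have hf : HasFDerivAt (fun p : ℝ × ℝ => p.1) (ContinuousLinearMap.fst ℝ ℝ ℝ) (r, θ) :=
    hasFDerivAt_fst
  have hs : HasFDerivAt (fun p : ℝ × ℝ => p.2) (ContinuousLinearMap.snd ℝ ℝ ℝ) (r, θ) :=
    hasFDerivAt_snd
  have h1 := (((hf.pow (A.d + 1)).mul hs.sin).pow 2).mul_const (1 / 2 : ℝ)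
  have h2 := (A.hG (r * Real.cos θ)).comp_hasFDerivAt (r, θ) (hf.mul hs.cos)
  have h3 := h1.add h2
  have h4 : Function.uncurry A.Hp = fun p : ℝ × ℝ =>
      (p.1 ^ (A.d + 1) * Real.sin p.2) ^ 2 * (1 / 2) + A.G (p.1 * Real.cos p.2) := by
    funext p; simp only [Function.uncurry, Hp]; ring
  rw [h4]
  refine h3.congr_fderiv ?_
  ext <;> simp [qN, Hθ] <;> ring

/-- Differentiability of the radius along a curve of varying energy. -/
lemma hasDerivAt_rho {h : ℝ → ℝ} {h' θ : ℝ} (hh : HasDerivAt h h' θ)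
    (hmem : h θ ∈ Set.Ioo A.lo A.hi) :
    HasDerivAt (fun θ => A.rho (h θ) θ)
      ((h' - A.Hθ (A.rho (h θ) θ) θ) /
        qN A.d (A.g (A.rho (h θ) θ * Real.cos θ)) (A.rho (h θ) θ) (Real.cos θ) (Real.sin θ)) θ := by
  set r := A.rho (h θ) θ with hr
  set N := qN A.d (A.g (r * Real.cos θ)) r (Real.cos θ) (Real.sin θ) with hN
  have hN0 : N ≠ 0 := (A.pos _ (A.rho_mem _ _) θ).ne'
  have hF := (A.hasFDerivAt_Hp r θ).prodMk (hasFDerivAt_snd (𝕜 := ℝ) (p := (r, θ)))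
  rw [← hN] at hF
  set P := A.Hθ r θ with hP
  set e : (ℝ × ℝ) ≃L[ℝ] (ℝ × ℝ) := ContinuousLinearEquiv.equivOfInverse
    ((N • ContinuousLinearMap.fst ℝ ℝ ℝ + P • ContinuousLinearMap.snd ℝ ℝ ℝ).prod
      (ContinuousLinearMap.snd ℝ ℝ ℝ))
    ((N⁻¹ • (ContinuousLinearMap.fst ℝ ℝ ℝ - P • ContinuousLinearMap.snd ℝ ℝ ℝ)).prod
      (ContinuousLinearMap.snd ℝ ℝ ℝ))
    (fun z => by ext <;> simp [hN0]) (fun z => by ext <;> simp [hN0]) with he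
  have hg : HasFDerivAt (fun z : ℝ × ℝ => (A.rho z.1 z.2, z.2)) (e.symm : (ℝ × ℝ) →L[ℝ] (ℝ × ℝ))
      (h θ, θ) := by
    refine HasFDerivAt.of_local_left_inverse (f := fun z : ℝ × ℝ => (A.Hp z.1 z.2, z.2))
      (A.continuous_rho.prodMk continuous_snd).continuousAt hF ?_
    have : ∀ᶠ z : ℝ × ℝ in nhds (h θ, θ), z.1 ∈ Set.Ioo A.lo A.hi :=
      continuous_fst.continuousAt.eventually (isOpen_Ioo.mem_nhds hmem)
    filter_upwards [this] with z hz
    simp only [A.Hp_rho, A.cl_of_mem (Set.Ioo_subset_Icc_self hz)]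
  have hp : HasDerivAt (fun t => (h t, t)) (h', 1) θ := hh.prodMk (hasDerivAt_id θ)
  have h1 := HasFDerivAt.comp_hasDerivAt (f := fun t => (h t, t)) θ hg hp
  have h2 := (ContinuousLinearMap.fst ℝ ℝ ℝ).hasFDerivAt.comp_hasDerivAt θ h1
  refine h2.congr_deriv ?_
  have : e.symm (h', 1) = (N⁻¹ * (h' - P * 1), 1) := rfl
  simp only [ContinuousLinearEquiv.coe_coe, this, ContinuousLinearMap.coe_fst']
  field_simp

/-- The point with energy `h` and angle `θ`. -/
noncomputable def X (h θ : ℝ) : ℝ × ℝ :=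
  (A.rho h θ * Real.cos θ, -(A.rho h θ ^ (A.d + 1) * Real.sin θ))

lemma continuous_X : Continuous (Function.uncurry A.X) := by
  have h1 : Continuous fun z : ℝ × ℝ => A.rho z.1 z.2 := A.continuous_rho
  unfold X Function.uncurry; fun_prop

lemma H_X (h θ : ℝ) : A.H (A.X h θ) = max A.lo (min A.hi h) := by
  rw [← cl, ← A.Hp_rho h θ, H, Hp, X, neg_sq]

lemma X_periodic (h θ : ℝ) : A.X h (θ + 2 * Real.pi) = A.X h θ := by
  simp only [X, A.rho_periodic, Real.sin_add_two_pi, Real.cos_add_two_pi]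

lemma X_inj (h θ θ' : ℝ) (hX : A.X h θ = A.X h θ') : ∃ n : ℤ, θ' = θ + n * (2 * Real.pi) := by
  simp only [X, Prod.mk.injEq, neg_inj] at hX
  obtain ⟨hc, hs⟩ := hX
  have hr : A.rho h θ = A.rho h θ' := le_antisymm
    (le_of_polar_eq (A.rho_pos h θ') hc.symm hs.symm) (le_of_polar_eq (A.rho_pos h θ) hc hs)
  rw [← hr] at hc hs
  have hp := A.rho_pos h θ
  have hc' := mul_left_cancel₀ hp.ne' hc
  have hs' := mul_left_cancel₀ (pow_pos hp _).ne' hs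
  obtain ⟨n, hn⟩ := Real.Angle.angle_eq_iff_two_pi_dvd_sub.1 (Real.Angle.cos_sin_inj hc'.symm hs'.symm)
  exact ⟨n, by linarith⟩

/-- The open region covered by the coordinates. -/
def O : Set (ℝ × ℝ) := {p | |p.1| < A.L ∧ A.lo < A.H p ∧ A.H p < A.hi}

lemma isOpen_O : IsOpen A.O :=
  (isOpen_lt continuous_fst.abs continuous_const).inter
    ((isOpen_lt continuous_const A.continuous_H).inter
      (isOpen_lt A.continuous_H continuous_const))

lemma X_mem_O {h : ℝ} (hh : h ∈ Set.Ioo A.lo A.hi) (θ : ℝ) : A.X h θ ∈ A.O := by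
  have h1 := A.H_X h θ
  rw [← cl, A.cl_of_mem (Set.Ioo_subset_Icc_self hh)] at h1
  refine ⟨?_, by rw [h1]; exact hh.1, by rw [h1]; exact hh.2⟩
  simp only [X, abs_mul, abs_of_pos (A.rho_pos h θ)]
  calc A.rho h θ * |Real.cos θ| ≤ A.rho h θ * 1 := by
        gcongr; exacts [(A.rho_pos h θ).le, Real.abs_cos_le_one θ]
    _ < A.L := by linarith [(A.rho_mem h θ).2, A.rb_lt]

lemma exists_X_eq {p : ℝ × ℝ} (hp : p ∈ A.O) :
    A.H p ∈ Set.Ioo A.lo A.hi ∧ ∃ θ, A.X (A.H p) θ = p := by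
  obtain ⟨hx, hh⟩ := hp
  refine ⟨hh, ?_⟩
  obtain ⟨r, hr, θ, h1, h2⟩ := A.surj p.1 p.2 hx hh
  refine ⟨θ, ?_⟩
  have : A.rho (A.H p) θ = r := by
    refine A.rho_eq hr ?_
    rw [A.cl_of_mem (Set.Ioo_subset_Icc_self hh), Hp, H, h1, h2, neg_sq]
  rw [X, this, ← h1, ← h2]

/-- Rate of change of the energy. -/
noncomputable def e (F : ℝ → ℝ) (ε h θ : ℝ) : ℝ :=
  qE A.d ε (A.g (A.rho h θ * Real.cos θ)) (F (A.rho h θ * Real.cos θ)) (A.rho h θ)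
    (Real.cos θ) (Real.sin θ)

/-- The inverse angular velocity. -/
noncomputable def σ (F : ℝ → ℝ) (ε h θ : ℝ) : ℝ :=
  A.rho h θ ^ (A.d + 1) * (Real.cos θ ^ 2 + (A.d + 1) * Real.sin θ ^ 2) /
    qD A.d ε (A.g (A.rho h θ * Real.cos θ)) (F (A.rho h θ * Real.cos θ)) (A.rho h θ)
      (Real.cos θ) (Real.sin θ)

lemma hasDerivAt_X {F : ℝ → ℝ} {ε : ℝ} {h : ℝ → ℝ} {θ : ℝ}
    (hD : qD A.d ε (A.g (A.rho (h θ) θ * Real.cos θ)) (F (A.rho (h θ) θ * Real.cos θ))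
      (A.rho (h θ) θ) (Real.cos θ) (Real.sin θ) ≠ 0)
    (hh : HasDerivAt h (ε * A.e F ε (h θ) θ) θ) (hmem : h θ ∈ Set.Ioo A.lo A.hi) :
    HasDerivAt (fun θ => A.X (h θ) θ)
      (A.σ F ε (h θ) θ • liePlane F A.g ε (A.X (h θ) θ)) θ := by
  have hρ := A.hasDerivAt_rho hh hmem
  have hN0 : qN A.d (A.g (A.rho (h θ) θ * Real.cos θ)) (A.rho (h θ) θ) (Real.cos θ) (Real.sin θ) ≠ 0 :=
    (A.pos _ (A.rho_mem _ _) θ).ne'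
  have h1 := hρ.mul (Real.hasDerivAt_cos θ)
  have h2 := ((hρ.pow (A.d + 1)).mul (Real.hasDerivAt_sin θ)).neg
  have hsc := Real.sin_sq_add_cos_sq θ
  refine (h1.prodMk h2).congr_deriv ?_
  simp only [e, σ, X, liePlane, qE, Hθ, Pi.pow_apply] at *
  generalize A.rho (h θ) θ = r at *
  generalize A.g (r * Real.cos θ) = g at *
  generalize F (r * Real.cos θ) = f at *
  generalize Real.cos θ = c at *
  generalize Real.sin θ = s at *
  have hND : qD A.d ε g f r c s = qN A.d g r c s + ε * ((A.d + 1) * (f * r ^ A.d) * s) := rfl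
  have hNdef : qN A.d g r c s = c * g + (A.d + 1) * r ^ (2 * A.d + 1) * s ^ 2 := rfl
  have hc : c ^ 2 = 1 - s ^ 2 := by linarith
  ext
  · simp only [Prod.smul_fst, smul_eq_mul]
    field_simp
    simp only [qY, hND, hNdef]
    ring
  · simp only [Prod.smul_snd, smul_eq_mul]
    field_simp
    simp only [qY, hND, hNdef]
    push_cast
    ring_nf

end EnergyAnnulus

namespace EnergyAnnulus

variable (A : EnergyAnnulus)

/-- Derivative of `EnergyAnnulus.e` with respect to the energy. -/
noncomputable def κ (F F' : ℝ → ℝ) (ε h θ : ℝ) : ℝ :=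
  qK A.d ε (A.g (A.rho h θ * Real.cos θ)) (A.g' (A.rho h θ * Real.cos θ))
    (F (A.rho h θ * Real.cos θ)) (F' (A.rho h θ * Real.cos θ)) (A.rho h θ)
    (Real.cos θ) (Real.sin θ)

/-- The numerator of the angular velocity, as a function of energy and angle. -/
noncomputable def D (F : ℝ → ℝ) (ε h θ : ℝ) : ℝ :=
  qD A.d ε (A.g (A.rho h θ * Real.cos θ)) (F (A.rho h θ * Real.cos θ)) (A.rho h θ)
    (Real.cos θ) (Real.sin θ)

lemma cl_cl (h : ℝ) : A.cl (A.cl h) = A.cl h := A.cl_of_mem (A.cl_mem h)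

lemma rho_cl (h θ : ℝ) : A.rho (A.cl h) θ = A.rho h θ :=
  A.rho_eq (A.rho_mem h θ) (by rw [A.Hp_rho, A.cl_cl])

lemma abs_cl_sub_le (x y : ℝ) : |A.cl x - A.cl y| ≤ |x - y| := by
  refine (abs_max_sub_max_le_max _ _ _ _).trans (max_le (by simp) ?_)
  exact (abs_min_sub_min_le_max _ _ _ _).trans (by simp)

lemma exists_isMin {f : ℝ → ℝ → ℝ} (hf : Continuous (Function.uncurry f))
    (hcl : ∀ h θ, f (A.cl h) θ = f h θ) (hper : ∀ h θ, f h (θ + 2 * Real.pi) = f h θ) :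
    ∃ h₀ θ₀, ∀ h θ, f h₀ θ₀ ≤ f h θ := by
  obtain ⟨z, -, hz⟩ := (isCompact_Icc.prod isCompact_Icc :
    IsCompact (Set.Icc A.lo A.hi ×ˢ Set.Icc 0 (2 * Real.pi))).exists_isMinOn
    ⟨(A.lo, 0), ⟨le_rfl, A.lo_lt_hi.le⟩, ⟨le_rfl, Real.two_pi_pos.le⟩⟩ hf.continuousOn
  refine ⟨z.1, z.2, fun h θ => ?_⟩
  obtain ⟨y, hy, hθy⟩ := Function.Periodic.exists_mem_Ico₀ (f := f h) (hper h) Real.two_pi_pos θ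
  rw [hθy, ← hcl h y]
  exact hz (Set.mk_mem_prod (A.cl_mem h) (Set.Ico_subset_Icc_self hy))

lemma exists_abs_le {f : ℝ → ℝ → ℝ} (hf : Continuous (Function.uncurry f))
    (hcl : ∀ h θ, f (A.cl h) θ = f h θ) (hper : ∀ h θ, f h (θ + 2 * Real.pi) = f h θ) :
    ∃ M, 0 < M ∧ ∀ h θ, |f h θ| ≤ M := by
  obtain ⟨h₀, θ₀, h0⟩ := A.exists_isMin (f := fun h θ => -|f h θ|) (by
    have : Continuous fun z : ℝ × ℝ => f z.1 z.2 := hf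
    exact this.abs.neg) (fun h θ => by rw [hcl])
    (fun h θ => by rw [hper])
  exact ⟨|f h₀ θ₀| + 1, by positivity, fun h θ => by linarith [h0 h θ]⟩

lemma exists_uniform {f : ℝ → ℝ → ℝ → ℝ} {ε₁ : ℝ} (hε₁ : 0 ≤ ε₁)
    (hf : ContinuousOn (fun z : ℝ × ℝ × ℝ => f z.1 z.2.1 z.2.2) (Set.Icc 0 ε₁ ×ˢ Set.univ))
    (hcl : ∀ ε h θ, f ε (A.cl h) θ = f ε h θ)
    (hper : ∀ ε h θ, f ε h (θ + 2 * Real.pi) = f ε h θ) {ν : ℝ} (hν : 0 < ν) :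
    ∃ ζ, 0 < ζ ∧ ∀ ε ∈ Set.Icc 0 ε₁, ε < ζ → ∀ h a θ, |h - a| < ζ →
      |f ε h θ - f 0 a θ| < ν := by
  have hK : IsCompact (Set.Icc 0 ε₁ ×ˢ (Set.Icc A.lo A.hi ×ˢ Set.Icc 0 (2 * Real.pi))) :=
    isCompact_Icc.prod (isCompact_Icc.prod isCompact_Icc)
  have hu := hK.uniformContinuousOn_of_continuous
    (hf.mono (Set.prod_mono le_rfl (Set.subset_univ _)))
  obtain ⟨ζ, hζ, h1⟩ := Metric.uniformContinuousOn_iff.1 hu ν hν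
  refine ⟨ζ, hζ, fun ε hε hεζ h a θ hha => ?_⟩
  obtain ⟨y, hy, hθy⟩ := Function.Periodic.exists_mem_Ico₀
    (f := fun θ => (f ε h θ, f 0 a θ)) (c := 2 * Real.pi) (fun θ => by simp only [hper])
    Real.two_pi_pos θ
  simp only [Prod.mk.injEq] at hθy
  rw [hθy.1, hθy.2, ← hcl ε h, ← hcl 0 a, ← Real.dist_eq]
  refine h1 (ε, A.cl h, y) ⟨hε, A.cl_mem h, Set.Ico_subset_Icc_self hy⟩
    (0, A.cl a, y) ⟨⟨le_rfl, hε₁⟩, A.cl_mem a, Set.Ico_subset_Icc_self hy⟩ ?_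
  simp only [Prod.dist_eq, Real.dist_eq, sub_self, abs_zero, sub_zero, abs_of_nonneg hε.1]
  exact max_lt hεζ (max_lt ((A.abs_cl_sub_le h a).trans_lt hha) hζ)

section

variable {F F' : ℝ → ℝ}

lemma D_cl (ε h θ : ℝ) : A.D F ε (A.cl h) θ = A.D F ε h θ := by simp only [D, rho_cl]

lemma e_cl (ε h θ : ℝ) : A.e F ε (A.cl h) θ = A.e F ε h θ := by simp only [e, rho_cl]

lemma κ_cl (ε h θ : ℝ) : A.κ F F' ε (A.cl h) θ = A.κ F F' ε h θ := by simp only [κ, rho_cl]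

lemma D_periodic (ε h θ : ℝ) : A.D F ε h (θ + 2 * Real.pi) = A.D F ε h θ := by
  simp only [D, rho_periodic, Real.cos_add_two_pi, Real.sin_add_two_pi]

lemma e_periodic (ε h θ : ℝ) : A.e F ε h (θ + 2 * Real.pi) = A.e F ε h θ := by
  simp only [e, rho_periodic, Real.cos_add_two_pi, Real.sin_add_two_pi]

lemma κ_periodic (ε h θ : ℝ) : A.κ F F' ε h (θ + 2 * Real.pi) = A.κ F F' ε h θ := by
  simp only [κ, rho_periodic, Real.cos_add_two_pi, Real.sin_add_two_pi]

lemma σ_periodic (ε h θ : ℝ) : A.σ F ε h (θ + 2 * Real.pi) = A.σ F ε h θ := by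
  simp only [σ, rho_periodic, Real.cos_add_two_pi, Real.sin_add_two_pi]

lemma continuous_D (hF : Continuous F) :
    Continuous fun z : ℝ × ℝ × ℝ => A.D F z.1 z.2.1 z.2.2 := by
  have h1 : Continuous fun z : ℝ × ℝ × ℝ => A.rho z.2.1 z.2.2 := A.continuous_rho.comp continuous_snd
  have h2 := A.continuous_g
  unfold D qD qN; fun_prop

lemma exists_D_pos (hF : Continuous F) :
    ∃ ε₁, 0 < ε₁ ∧ ∃ m, 0 < m ∧ ∀ ε ∈ Set.Icc 0 ε₁, ∀ h θ, m ≤ A.D F ε h θ := by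
  have hD := A.continuous_D hF
  have hD0 : Continuous (Function.uncurry (A.D F 0)) :=
    hD.comp (g := fun z : ℝ × ℝ × ℝ => A.D F z.1 z.2.1 z.2.2) (f := fun z : ℝ × ℝ => (0, z))
      (continuous_const.prodMk continuous_id)
  obtain ⟨h₀, θ₀, h0⟩ := A.exists_isMin hD0 (A.D_cl 0) (A.D_periodic 0)
  have hpos : 0 < A.D F 0 h₀ θ₀ := by
    have := A.pos _ (A.rho_mem h₀ θ₀) θ₀
    simpa [D, qD] using this
  obtain ⟨ζ, hζ, h1⟩ := A.exists_uniform (f := A.D F) zero_le_one hD.continuousOn A.D_cl A.D_periodic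
    (half_pos hpos)
  refine ⟨min 1 (ζ / 2), by positivity, A.D F 0 h₀ θ₀ / 2, half_pos hpos, fun ε hε h θ => ?_⟩
  have h2 := h1 ε ⟨hε.1, hε.2.trans (min_le_left _ _)⟩
    (by linarith [hε.2.trans (min_le_right _ _)]) h h θ (by simpa using hζ)
  have := (abs_lt.1 h2).1
  linarith [h0 h θ]

lemma continuousOn_e (hF : Continuous F) {s : Set ℝ} (hs : ∀ ε ∈ s, ∀ h θ, A.D F ε h θ ≠ 0) :
    ContinuousOn (fun z : ℝ × ℝ × ℝ => A.e F z.1 z.2.1 z.2.2) (s ×ˢ Set.univ) := by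
  have h1 : Continuous fun z : ℝ × ℝ × ℝ => A.rho z.2.1 z.2.2 := A.continuous_rho.comp continuous_snd
  have h2 := A.continuous_g
  refine ContinuousOn.div (Continuous.continuousOn ?_) (A.continuous_D hF).continuousOn
    fun z hz => hs _ hz.1 _ _
  unfold qY; fun_prop

lemma continuousOn_σ (hF : Continuous F) {s : Set ℝ} (hs : ∀ ε ∈ s, ∀ h θ, A.D F ε h θ ≠ 0) :
    ContinuousOn (fun z : ℝ × ℝ × ℝ => A.σ F z.1 z.2.1 z.2.2) (s ×ˢ Set.univ) := by
  have h1 : Continuous fun z : ℝ × ℝ × ℝ => A.rho z.2.1 z.2.2 := A.continuous_rho.comp continuous_snd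
  refine ContinuousOn.div (Continuous.continuousOn ?_) (A.continuous_D hF).continuousOn
    fun z hz => hs _ hz.1 _ _
  fun_prop

lemma continuousOn_κ (hF : Continuous F) (hF' : Continuous F') {s : Set ℝ}
    (hs : ∀ ε ∈ s, ∀ h θ, A.D F ε h θ ≠ 0) :
    ContinuousOn (fun z : ℝ × ℝ × ℝ => A.κ F F' z.1 z.2.1 z.2.2) (s ×ˢ Set.univ) := by
  have h1 : Continuous fun z : ℝ × ℝ × ℝ => A.rho z.2.1 z.2.2 := A.continuous_rho.comp continuous_snd
  have h2 := A.continuous_g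
  have h3 := A.hg'
  have h4 := A.continuous_D hF
  unfold D at h4
  refine ContinuousOn.div (ContinuousOn.div (Continuous.continuousOn ?_)
    (h4.pow 2).continuousOn fun z hz => pow_ne_zero _ (hs _ hz.1 _ _))
    (Continuous.continuousOn ?_) fun z _ => (A.pos _ (A.rho_mem _ _) _).ne'
  · unfold qY qY' qD' qN'; fun_prop
  · unfold qN; fun_prop

lemma exists_e_sub_eq_of_lt (hF : ∀ x, HasDerivAt F (F' x) x) {ε θ x y : ℝ}
    (hD : ∀ h, A.D F ε h θ ≠ 0) (hxy : A.cl x < A.cl y) :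
    ∃ ξ ∈ Set.Ioo (A.cl x) (A.cl y),
      A.e F ε y θ - A.e F ε x θ = A.κ F F' ε ξ θ * (A.cl y - A.cl x) := by
  have hlt : A.rho x θ < A.rho y θ := by
    rw [← A.Hp_rho x θ, ← A.Hp_rho y θ] at hxy
    exact ((A.strictMonoOn_Hp θ).lt_iff_lt (A.rho_mem _ _) (A.rho_mem _ _)).1 hxy
  have hsub : Set.Icc (A.rho x θ) (A.rho y θ) ⊆ Set.Icc A.ra A.rb :=
    Set.Icc_subset_Icc (A.rho_mem _ _).1 (A.rho_mem _ _).2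
  have hcl : ∀ r ∈ Set.Icc (A.rho x θ) (A.rho y θ), A.Hp r θ ∈ Set.Icc (A.cl x) (A.cl y) := by
    intro r hr
    rw [← A.Hp_rho x θ, ← A.Hp_rho y θ]
    exact ⟨(A.strictMonoOn_Hp θ).monotoneOn (A.rho_mem _ _) (hsub hr) hr.1,
      (A.strictMonoOn_Hp θ).monotoneOn (hsub hr) (A.rho_mem _ _) hr.2⟩
  have hclr : ∀ r ∈ Set.Icc (A.rho x θ) (A.rho y θ), A.rho (A.Hp r θ) θ = r := by
    intro r hr
    refine A.rho_eq (hsub hr) (A.cl_of_mem ?_).symm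
    exact ⟨(A.cl_mem x).1.trans (hcl r hr).1, (hcl r hr).2.trans (A.cl_mem y).2⟩
  have hd : ∀ r ∈ Set.Icc (A.rho x θ) (A.rho y θ), HasDerivAt
      (fun r => qE A.d ε (A.g (r * Real.cos θ)) (F (r * Real.cos θ)) r (Real.cos θ) (Real.sin θ))
      (qK A.d ε (A.g (r * Real.cos θ)) (A.g' (r * Real.cos θ)) (F (r * Real.cos θ))
        (F' (r * Real.cos θ)) r (Real.cos θ) (Real.sin θ) *
          qN A.d (A.g (r * Real.cos θ)) r (Real.cos θ) (Real.sin θ)) r := by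
    intro r hr
    refine hasDerivAt_qE (A.hg _) (hF _) ?_ (A.pos r (hsub hr) θ).ne'
    have := hD (A.Hp r θ)
    rwa [D, hclr r hr] at this
  obtain ⟨r, hr, h1⟩ := exists_ratio_hasDerivAt_eq_ratio_slope (fun r => A.Hp r θ) _ hlt
    (fun r _ => (A.hasDerivAt_Hp r θ).continuousAt.continuousWithinAt)
    (fun r _ => A.hasDerivAt_Hp r θ) _ _ (fun r hr => (hd r hr).continuousAt.continuousWithinAt)
    (fun r hr => hd r (Set.Ioo_subset_Icc_self hr))
  have hr' := Set.Ioo_subset_Icc_self hr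
  refine ⟨A.Hp r θ, ?_, ?_⟩
  · rw [← A.Hp_rho x θ, ← A.Hp_rho y θ]
    exact ⟨A.strictMonoOn_Hp θ (A.rho_mem _ _) (hsub hr') hr.1,
      A.strictMonoOn_Hp θ (hsub hr') (A.rho_mem _ _) hr.2⟩
  · rw [A.Hp_rho, A.Hp_rho] at h1
    simp only [κ, hclr r hr', e]
    have hN := (A.pos r (hsub hr') θ).ne'
    refine mul_right_cancel₀ hN ?_
    linear_combination h1

lemma exists_e_sub_eq (hF : ∀ x, HasDerivAt F (F' x) x) {ε θ : ℝ}
    (hD : ∀ h, A.D F ε h θ ≠ 0) (x y : ℝ) :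
    ∃ ξ ∈ Set.uIcc (A.cl x) (A.cl y),
      A.e F ε y θ - A.e F ε x θ = A.κ F F' ε ξ θ * (A.cl y - A.cl x) := by
  rcases lt_trichotomy (A.cl x) (A.cl y) with h | h | h
  · obtain ⟨ξ, h1, h2⟩ := A.exists_e_sub_eq_of_lt hF hD h
    exact ⟨ξ, Set.Icc_subset_uIcc (Set.Ioo_subset_Icc_self h1), h2⟩
  · exact ⟨A.cl x, Set.left_mem_uIcc, by rw [← A.e_cl ε x, ← A.e_cl ε y, h]; ring⟩
  · obtain ⟨ξ, h1, h2⟩ := A.exists_e_sub_eq_of_lt hF hD h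
    exact ⟨ξ, Set.Icc_subset_uIcc' (Set.Ioo_subset_Icc_self h1), by linear_combination -h2⟩

end

end EnergyAnnulus

lemma contDiff_one_of_hasDerivAt {F F' : ℝ → ℝ} (hF : ∀ x, HasDerivAt F (F' x) x)
    (hF' : Continuous F') : ContDiff ℝ 1 F :=
  contDiff_one_iff_deriv.2 ⟨fun x => (hF x).differentiableAt, by
    rwa [show deriv F = F' from funext fun x => (hF x).deriv]⟩

lemma contDiff_liePlane {F F' g g' : ℝ → ℝ} (hF : ∀ x, HasDerivAt F (F' x) x)
    (hF' : Continuous F') (hg : ∀ x, HasDerivAt g (g' x) x) (hg' : Continuous g') (ε : ℝ) :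
    ContDiff ℝ 1 (liePlane F g ε) := by
  have h1 := contDiff_one_of_hasDerivAt hF hF'
  have h2 := contDiff_one_of_hasDerivAt hg hg'
  unfold liePlane; fun_prop

namespace EnergyAnnulus

variable (A : EnergyAnnulus)

/-- A simple zero of the averaged energy change yields a limit cycle. -/
theorem exists_isLimitCycle {F F' : ℝ → ℝ} (hF : ∀ x, HasDerivAt F (F' x) x)
    (hF' : Continuous F') {lo a₀ a₁ hi : ℝ} (hlo' : A.lo ≤ lo) (hlo : lo < a₀) (h01 : a₀ < a₁)
    (hhi : a₁ < hi) (hhi' : hi ≤ A.hi)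
    (hJ : (∫ θ in (0:ℝ)..2 * Real.pi, A.e F 0 a₀ θ) *
      (∫ θ in (0:ℝ)..2 * Real.pi, A.e F 0 a₁ θ) < 0)
    (hK : ∀ a ∈ Set.Icc a₀ a₁, ∫ θ in (0:ℝ)..2 * Real.pi, A.κ F F' 0 a θ ≠ 0) :
    ∃ ε₀, 0 < ε₀ ∧ ∀ ε, 0 < ε → ε ≤ ε₀ → ∃ Γ, IsLimitCycle (liePlane F A.g ε) Γ ∧ Γ ⊆ A.O ∧
      (∀ p ∈ Γ, A.H p ∈ Set.Ioo lo hi) ∧ (∃ p ∈ Γ, 0 < p.1) ∧ ∃ p ∈ Γ, p.1 < 0 := by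
  have hFc : Continuous F := continuous_iff_continuousAt.2 fun x => (hF x).continuousAt
  obtain ⟨ε₁, hε₁, m, hm, hD⟩ := A.exists_D_pos hFc
  have hs : ∀ ε ∈ Set.Icc 0 ε₁, ∀ h θ, A.D F ε h θ ≠ 0 := fun ε hε h θ =>
    (hm.trans_le (hD ε hε h θ)).ne'
  have hec := A.continuousOn_e hFc hs
  have hκc := A.continuousOn_κ hFc hF' hs
  have hσc := A.continuousOn_σ hFc hs
  have hslice : ∀ {f : ℝ → ℝ → ℝ → ℝ}, ContinuousOn (fun z : ℝ × ℝ × ℝ => f z.1 z.2.1 z.2.2)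
      (Set.Icc 0 ε₁ ×ˢ Set.univ) → ∀ ε ∈ Set.Icc 0 ε₁, Continuous (Function.uncurry (f ε)) := by
    intro f hf ε hε
    rw [← continuousOn_univ]
    exact hf.comp (f := fun z : ℝ × ℝ => (ε, z)) (by fun_prop) fun z _ => ⟨hε, trivial⟩
  have h0mem : (0:ℝ) ∈ Set.Icc 0 ε₁ := ⟨le_rfl, hε₁.le⟩
  have he0 := hslice hec 0 h0mem
  have hκ0 := hslice hκc 0 h0mem
  set T := 2 * Real.pi with hT
  have hT0 : 0 < T := Real.two_pi_pos
  have hKc : Continuous fun a => ∫ θ in (0:ℝ)..T, A.κ F F' 0 a θ :=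
    intervalIntegral.continuous_parametric_intervalIntegral_of_continuous' hκ0 0 T
  obtain ⟨am, ham, hmin⟩ := isCompact_Icc.exists_isMinOn (Set.nonempty_Icc.2 h01.le)
    hKc.abs.continuousOn
  set J₀ := ∫ θ in (0:ℝ)..T, A.e F 0 a₀ θ with hJ₀
  set J₁ := ∫ θ in (0:ℝ)..T, A.e F 0 a₁ θ with hJ₁
  set Km := |∫ θ in (0:ℝ)..T, A.κ F F' 0 am θ| with hKm
  have hJ₀0 : 0 < |J₀| := abs_pos.2 fun h => by simp [h] at hJ
  have hJ₁0 : 0 < |J₁| := abs_pos.2 fun h => by simp [h] at hJ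
  have hKm0 : 0 < Km := abs_pos.2 (hK am ham)
  obtain ⟨w, hw, hwJ₀, hwJ₁, hwK⟩ : ∃ w, 0 < w ∧ w < |J₀| ∧ w < |J₁| ∧ w < Km :=
    ⟨min |J₀| (min |J₁| Km) / 2, by positivity, by
      linarith [min_le_left |J₀| (min |J₁| Km)], by
      linarith [min_le_right |J₀| (min |J₁| Km), min_le_left |J₁| Km], by
      linarith [min_le_right |J₀| (min |J₁| Km), min_le_right |J₁| Km]⟩
  set ν := w / T with hν
  have hνT : ν * T = w := div_mul_cancel₀ _ hT0.ne'
  have hν0 : 0 < ν := by positivity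
  obtain ⟨ζe, hζe, hue⟩ := A.exists_uniform hε₁.le hec A.e_cl A.e_periodic hν0
  obtain ⟨ζk, hζk, huk⟩ := A.exists_uniform hε₁.le hκc A.κ_cl A.κ_periodic hν0
  obtain ⟨ζ, hζ, hζ1, hζ2, hζ3, hζ4⟩ : ∃ ζ, 0 < ζ ∧ ζ < ζe ∧ ζ < ζk ∧ ζ ≤ a₀ - lo ∧ ζ ≤ hi - a₁ := by
    refine ⟨min (min ζe ζk) (min (a₀ - lo) (hi - a₁)) / 2, ?_, ?_⟩
    · have : 0 < min (min ζe ζk) (min (a₀ - lo) (hi - a₁)) :=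
        lt_min (lt_min hζe hζk) (lt_min (by linarith) (by linarith))
      linarith
    · have h1 := min_le_left (min ζe ζk) (min (a₀ - lo) (hi - a₁))
      have h2 := min_le_right (min ζe ζk) (min (a₀ - lo) (hi - a₁))
      have h3 := min_le_left ζe ζk
      have h4 := min_le_right ζe ζk
      have h5 := min_le_left (a₀ - lo) (hi - a₁)
      have h6 := min_le_right (a₀ - lo) (hi - a₁)
      refine ⟨?_, ?_, ?_, ?_⟩ <;> linarith
  obtain ⟨M₀, hM₀, hM⟩ := A.exists_abs_le he0 (A.e_cl 0) (A.e_periodic 0)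
  refine ⟨min ε₁ (min ζ (ζ / 2 / ((M₀ + ν) * T))), by positivity, fun ε hε hεle => ?_⟩
  have hmem : ε ∈ Set.Icc 0 ε₁ := ⟨hε.le, hεle.trans (min_le_left _ _)⟩
  have hεζ : ε ≤ ζ := hεle.trans ((min_le_right _ _).trans (min_le_left _ _))
  have hεM : ε * (M₀ + ν) * T ≤ ζ / 2 := by
    have := hεle.trans ((min_le_right _ _).trans (min_le_right _ _))
    rw [le_div_iff₀ (by positivity)] at this
    linarith
  have heε := hslice hec ε hmem
  have hMε : ∀ h θ, |A.e F ε h θ| ≤ M₀ + ν := fun h θ => by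
    have h1 := hue ε hmem (hεζ.trans_lt hζ1) h h θ (by simpa using hζe)
    have h2 := abs_sub_abs_le_abs_sub (A.e F ε h θ) (A.e F 0 h θ)
    linarith [hM h θ]
  obtain ⟨K, hK0, hKb⟩ := A.exists_abs_le (hslice hκc ε hmem) (A.κ_cl ε) (A.κ_periodic ε)
  have hLip : ∀ θ, LipschitzWith ⟨K, hK0.le⟩ fun h => A.e F ε h θ := fun θ =>
    LipschitzWith.of_dist_le_mul fun y x => by
      obtain ⟨ξ, -, h1⟩ := A.exists_e_sub_eq (ε := ε) (θ := θ) hF (fun h => hs ε hmem h θ) x y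
      rw [Real.dist_eq, Real.dist_eq, h1, abs_mul]
      exact mul_le_mul (hKb _ _) (A.abs_cl_sub_le _ _) (abs_nonneg _) hK0.le
  have hsl : ∀ {f : ℝ → ℝ → ℝ}, Continuous (Function.uncurry f) → ∀ a, Continuous (f a) :=
    fun hf a => hf.comp (continuous_const.prodMk continuous_id)
  obtain ⟨h, hd, hp, hh0, hdist⟩ := exists_periodic_solution (A.e F ε) heε hMε hLip hT0
    (A.e_periodic ε) hε hεM (hsl he0 a₀) (hsl he0 a₁)
    (fun θ x (hx : |x - a₀| ≤ ζ / 2) => (hue ε hmem (hεζ.trans_lt hζ1) x a₀ θ (by linarith)).le)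
    (fun θ x (hx : |x - a₁| ≤ ζ / 2) => (hue ε hmem (hεζ.trans_lt hζ1) x a₁ θ (by linarith)).le)
    (by rw [hνT]; exact hwJ₀) (by rw [hνT]; exact hwJ₁) hJ
  rw [Set.uIcc_of_le h01.le] at hh0
  have hdist' : ∀ θ, |h θ - h 0| < ζ := fun θ => by
    obtain ⟨y, hy, hθy⟩ := hp.exists_mem_Ico₀ hT0 θ
    rw [hθy]
    exact (hdist y (Set.Ico_subset_Icc_self hy)).trans_lt (by linarith)
  have hin : ∀ x, |x - h 0| < ζ → x ∈ Set.Ioo lo hi := fun x hx => by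
    have := abs_lt.1 hx
    constructor <;> linarith [hh0.1, hh0.2]
  have hsub : Set.Ioo lo hi ⊆ Set.Ioo A.lo A.hi := Set.Ioo_subset_Ioo hlo' hhi'
  have hσε := hslice hσc ε hmem
  obtain ⟨hσ₀, θσ, hσmin⟩ := A.exists_isMin hσε (fun h θ => by simp only [σ, rho_cl])
    (A.σ_periodic ε)
  have hσpos : 0 < A.σ F ε hσ₀ θσ := by
    refine div_pos (mul_pos (pow_pos (A.rho_pos _ _) _) ?_) (hm.trans_le (hD ε hmem _ _))
    nlinarith [Real.sin_sq_add_cos_sq θσ, sq_nonneg (Real.sin θσ),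
      mul_nonneg (Nat.cast_nonneg (α := ℝ) A.d) (sq_nonneg (Real.sin θσ))]
  refine ⟨_, isLimitCycle_of_chart (contDiff_liePlane hF hF' A.hg A.hg' ε) A.continuous_H A.isOpen_O
    hT0 A.continuous_X A.X_periodic A.H_X (fun _ hh => A.X_mem_O hh) (fun _ hp => A.exists_X_eq hp)
    A.X_inj hσε hσpos hσmin (A.σ_periodic ε) heε hMε hLip hε
    (fun h θ hh hm => A.hasDerivAt_X (hs ε hmem (h θ) θ) hh hm)
    (a := h 0) (ζ := ζ) (ν := ν) (by linarith [hh0.1]) (by linarith [hh0.2])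
    (k := fun θ => A.κ F F' 0 (h 0) θ) (hsl hκ0 _) (A.κ_periodic 0 _) ?_ ?_ hd hp hdist', ?_, ?_, ?_, ?_⟩
  · intro θ x y hx hy
    obtain ⟨ξ, hξ, h1⟩ := A.exists_e_sub_eq (ε := ε) (θ := θ) hF (fun h => hs ε hmem h θ) x y
    rw [A.cl_of_mem (Set.Ioo_subset_Icc_self (hsub (hin x hx))),
      A.cl_of_mem (Set.Ioo_subset_Icc_self (hsub (hin y hy)))] at hξ h1
    rw [h1, ← sub_mul, abs_mul]
    refine mul_le_mul_of_nonneg_right (huk ε hmem (hεζ.trans_lt hζ2) ξ (h 0) θ ?_).le (abs_nonneg _)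
    have hx' := abs_lt.1 hx
    have hy' := abs_lt.1 hy
    refine lt_trans (abs_lt.2 ?_) hζ2
    rcases Set.mem_uIcc.1 hξ with h2 | h2 <;> constructor <;> linarith [h2.1, h2.2]
  · rw [hνT]
    exact hwK.trans_le (hmin hh0)
  · rintro _ ⟨θ, rfl⟩
    exact A.X_mem_O (hsub (hin _ (hdist' θ))) θ
  · rintro _ ⟨θ, rfl⟩
    rw [A.H_X, ← cl, A.cl_of_mem (Set.Ioo_subset_Icc_self (hsub (hin _ (hdist' θ))))]
    exact hin _ (hdist' θ)
  · exact ⟨_, ⟨0, rfl⟩, by simpa [EnergyAnnulus.X] using A.rho_pos _ _⟩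
  · exact ⟨_, ⟨Real.pi, rfl⟩, by simpa [EnergyAnnulus.X] using A.rho_pos _ _⟩

end EnergyAnnulus

lemma exists_pos_forall_le {ι : Type*} [Finite ι] {f : ι → ℝ} (hf : ∀ i, 0 < f i) :
    ∃ ν, 0 < ν ∧ ∀ i, ν ≤ f i := by
  cases isEmpty_or_nonempty ι
  · exact ⟨1, one_pos, fun i => isEmptyElim i⟩
  · obtain ⟨i, hi⟩ := Finite.exists_min f
    exact ⟨f i, hf i, hi⟩

lemma IsCompact.exists_dist_lt {α : Type*} [PseudoMetricSpace α] {s : Set α} (hs : IsCompact s)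
    {β : Type*} [PseudoMetricSpace β] {f : α → β} (hf : ∀ a ∈ s, ContinuousAt f a) {ν : ℝ}
    (hν : 0 < ν) : ∃ ζ, 0 < ζ ∧ ∀ x ∈ s, ∀ y, dist x y < ζ → dist (f x) (f y) < ν := by
  have := hs.uniformContinuousAt_of_continuousAt f hf (Metric.dist_mem_uniformity hν)
  obtain ⟨ζ, hζ, h1⟩ := Metric.mem_uniformity_dist.1 this
  exact ⟨ζ, hζ, fun x hx y hxy => h1 hxy hx⟩

/-- The unit circle, as a compact set of pairs `(cos θ, sin θ)`. -/
def circ : Set (ℝ × ℝ) := (fun θ => (Real.cos θ, Real.sin θ)) '' Set.Icc 0 (2 * Real.pi)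

lemma isCompact_circ : IsCompact circ := isCompact_Icc.image (by fun_prop)

lemma mem_circ (θ : ℝ) : (Real.cos θ, Real.sin θ) ∈ circ := by
  obtain ⟨y, hy, h⟩ := Function.Periodic.exists_mem_Ico₀ (f := fun θ => (Real.cos θ, Real.sin θ))
    (c := 2 * Real.pi) (fun θ => by simp only [Real.cos_add_two_pi, Real.sin_add_two_pi])
    Real.two_pi_pos θ
  exact ⟨y, Set.Ico_subset_Icc_self hy, h.symm⟩

namespace EnergyAnnulus

variable (A₀ : EnergyAnnulus)

lemma exists_qN_le : ∃ m, 0 < m ∧ ∀ r ∈ Set.Icc A₀.ra A₀.rb, ∀ θ,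
    m ≤ qN A₀.d (A₀.g (r * Real.cos θ)) r (Real.cos θ) (Real.sin θ) := by
  have hg := A₀.continuous_g
  have hc : Continuous fun z : ℝ × ℝ × ℝ => qN A₀.d (A₀.g (z.1 * z.2.1)) z.1 z.2.1 z.2.2 := by
    unfold qN; fun_prop
  obtain ⟨z, hz, hmin⟩ := (isCompact_Icc.prod isCompact_circ :
    IsCompact (Set.Icc A₀.ra A₀.rb ×ˢ circ)).exists_isMinOn
    ⟨(A₀.ra, _), ⟨le_rfl, A₀.ra_lt_rb.le⟩, mem_circ 0⟩ hc.continuousOn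
  refine ⟨_, ?_, fun r hr θ => hmin (Set.mk_mem_prod hr (mem_circ θ))⟩
  obtain ⟨r, c, s⟩ := z
  obtain ⟨hr, θ, -, h⟩ := hz
  simp only [Prod.mk.injEq] at h
  rw [← h.1, ← h.2]
  exact A₀.pos r hr θ

lemma mul_abs_sub_le_Hp {m : ℝ} (hm : ∀ r ∈ Set.Icc A₀.ra A₀.rb, ∀ θ,
    m ≤ qN A₀.d (A₀.g (r * Real.cos θ)) r (Real.cos θ) (Real.sin θ)) {r r' : ℝ}
    (hr : r ∈ Set.Icc A₀.ra A₀.rb) (hr' : r' ∈ Set.Icc A₀.ra A₀.rb) (θ : ℝ) :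
    m * |r - r'| ≤ |A₀.Hp r θ - A₀.Hp r' θ| := by
  have key : ∀ r ∈ Set.Icc A₀.ra A₀.rb, ∀ r' ∈ Set.Icc A₀.ra A₀.rb, r ≤ r' →
      m * (r' - r) ≤ A₀.Hp r' θ - A₀.Hp r θ := fun r hr r' hr' h =>
    (convex_Icc A₀.ra A₀.rb).mul_sub_le_image_sub_of_le_deriv (f := fun r => A₀.Hp r θ)
      (fun r _ => (A₀.hasDerivAt_Hp r θ).continuousAt.continuousWithinAt)
      (fun r _ => (A₀.hasDerivAt_Hp r θ).differentiableAt.differentiableWithinAt)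
      (fun r hr => by
        rw [(A₀.hasDerivAt_Hp r θ).deriv]; exact hm r (interior_subset hr) θ) r hr r' hr' h
  rcases le_total r r' with h | h
  · rw [abs_sub_comm, abs_of_nonneg (sub_nonneg.2 h), abs_sub_comm]
    exact (key r hr r' hr' h).trans (le_abs_self _)
  · rw [abs_of_nonneg (sub_nonneg.2 h)]
    exact (key r' hr' r hr h).trans (le_abs_self _)

/-- The unperturbed averaged quantities depend continuously on the data, uniformly in energy and
angle. -/
lemma exists_stable {F₀ F₀' : ℝ → ℝ} (hF₀ : Continuous F₀) (hF₀' : Continuous F₀') {ν : ℝ}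
    (hν : 0 < ν) : ∃ μ, 0 < μ ∧ ∀ A : EnergyAnnulus, A.d = A₀.d → A.ra = A₀.ra → A.rb = A₀.rb →
      A.lo = A₀.lo → A.hi = A₀.hi → (∀ x, |x| ≤ A₀.rb →
        |A.g x - A₀.g x| ≤ μ ∧ |A.g' x - A₀.g' x| ≤ μ ∧ |A.G x - A₀.G x| ≤ μ) →
      ∀ F F' : ℝ → ℝ, (∀ x, |x| ≤ A₀.rb → |F x - F₀ x| ≤ μ ∧ |F' x - F₀' x| ≤ μ) →
      ∀ h θ, |A.e F 0 h θ - A₀.e F₀ 0 h θ| < ν ∧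
        |A.κ F F' 0 h θ - A₀.κ F₀ F₀' 0 h θ| < ν := by
  have hg := A₀.continuous_g
  have hg' := A₀.hg'
  set ψ : ℝ × ℝ × ℝ → ℝ × ℝ × ℝ × ℝ × ℝ × ℝ × ℝ := fun z => (A₀.g (z.1 * z.2.1),
    A₀.g' (z.1 * z.2.1), F₀ (z.1 * z.2.1), F₀' (z.1 * z.2.1), z.1, z.2.1, z.2.2) with hψ
  have hψc : Continuous ψ := by fun_prop
  set f : ℝ × ℝ × ℝ × ℝ × ℝ × ℝ × ℝ → ℝ × ℝ := fun w =>
    (qE A₀.d 0 w.1 w.2.2.1 w.2.2.2.2.1 w.2.2.2.2.2.1 w.2.2.2.2.2.2,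
      qK A₀.d 0 w.1 w.2.1 w.2.2.1 w.2.2.2.1 w.2.2.2.2.1 w.2.2.2.2.2.1 w.2.2.2.2.2.2) with hf
  have hK : IsCompact (Set.Icc A₀.ra A₀.rb ×ˢ circ) := isCompact_Icc.prod isCompact_circ
  have hfc : ∀ w ∈ ψ '' (Set.Icc A₀.ra A₀.rb ×ˢ circ), ContinuousAt f w := by
    rintro _ ⟨⟨r, c, s⟩, ⟨hr, θ, -, h⟩, rfl⟩
    simp only [Prod.mk.injEq] at h
    have hpos := (A₀.pos r hr θ).ne'
    rw [h.1, h.2] at hpos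
    have hD : qD A₀.d 0 (A₀.g (r * c)) (F₀ (r * c)) r c s ≠ 0 := by simpa [qD] using hpos
    refine ContinuousAt.prodMk (ContinuousAt.div ?_ ?_ hD)
      (ContinuousAt.div (ContinuousAt.div ?_ ?_ (pow_ne_zero 2 hD)) ?_ hpos)
    all_goals apply Continuous.continuousAt
    all_goals simp only [qY, qY', qD, qD', qN, qN']
    all_goals fun_prop
  obtain ⟨ζ, hζ, h1⟩ := (hK.image hψc).exists_dist_lt hfc hν
  obtain ⟨δ, hδ, h2⟩ := hK.exists_dist_lt (fun a _ => hψc.continuousAt) (half_pos hζ)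
  obtain ⟨m, hm, hmN⟩ := A₀.exists_qN_le
  refine ⟨min (ζ / 3) (m * δ / 2), by positivity, ?_⟩
  intro A hd hra hrb hlo hhi hclose F F' hFclose h θ
  set r := A.rho h θ with hr
  set r₀ := A₀.rho h θ with hr₀
  have hrm : r ∈ Set.Icc A₀.ra A₀.rb := by rw [← hra, ← hrb]; exact A.rho_mem h θ
  have hr₀m := A₀.rho_mem h θ
  have hx : |r * Real.cos θ| ≤ A₀.rb := by
    rw [abs_mul, abs_of_pos (A₀.ra_pos.trans_le hrm.1)]
    calc r * |Real.cos θ| ≤ r * 1 := by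
          gcongr; exacts [(A₀.ra_pos.trans_le hrm.1).le, Real.abs_cos_le_one θ]
      _ ≤ A₀.rb := by linarith [hrm.2]
  obtain ⟨hc1, hc2, hc3⟩ := hclose _ hx
  obtain ⟨hc4, hc5⟩ := hFclose _ hx
  have hrr : |r₀ - r| < δ := by
    have e1 := A₀.mul_abs_sub_le_Hp hmN hr₀m hrm θ
    have e2 : A₀.Hp r₀ θ = A.Hp r θ := by
      rw [A₀.Hp_rho, A.Hp_rho, cl, cl, hlo, hhi]
    have e3 : |A₀.Hp r₀ θ - A₀.Hp r θ| = |A.G (r * Real.cos θ) - A₀.G (r * Real.cos θ)| := by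
      rw [e2, Hp, Hp, hd]; congr 1; ring
    rw [e3] at e1
    have e4 := e1.trans (hc3.trans (min_le_right _ _))
    by_contra! hcon
    nlinarith [mul_le_mul_of_nonneg_left hcon hm.le, mul_pos hm hδ]
  have hmem : (r₀, Real.cos θ, Real.sin θ) ∈ Set.Icc A₀.ra A₀.rb ×ˢ circ :=
    Set.mk_mem_prod hr₀m (mem_circ θ)
  have e5 := h2 _ hmem (r, Real.cos θ, Real.sin θ) (by
    simp only [Prod.dist_eq, dist_self, Real.dist_eq]
    simpa using hrr)
  have e6 := h1 _ ⟨_, hmem, rfl⟩ (A.g (r * Real.cos θ), A.g' (r * Real.cos θ),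
    F (r * Real.cos θ), F' (r * Real.cos θ), r, Real.cos θ, Real.sin θ) (by
      refine (dist_triangle _ _ _).trans_lt ((add_lt_add e5 (d := ζ / 2) ?_).trans_le
        (by linarith))
      have hz : min (ζ / 3) (m * δ / 2) < ζ / 2 := (min_le_left _ _).trans_lt (by linarith)
      simp only [hψ, Prod.dist_eq, dist_self, Real.dist_eq]
      rw [abs_sub_comm] at hc1 hc2 hc4 hc5
      simp only [max_lt_iff]
      refine ⟨hc1.trans_lt hz, hc2.trans_lt hz, hc4.trans_lt hz, hc5.trans_lt hz, ?_⟩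
      simpa using hζ)
  rw [Prod.dist_eq, Real.dist_eq, Real.dist_eq, max_lt_iff] at e6
  rw [abs_sub_comm, abs_sub_comm (A.κ F F' 0 h θ)]
  unfold e κ
  rw [hd]
  exact e6

end EnergyAnnulus

lemma integral_symm_average {f : ℝ → ℝ} (hf : Continuous f)
    (hper : Function.Periodic f (2 * Real.pi)) :
    ∫ θ in (0:ℝ)..2 * Real.pi, (f θ + f (Real.pi - θ)) / 2 = ∫ θ in (0:ℝ)..2 * Real.pi, f θ := by
  have h1 : ∫ θ in (0:ℝ)..2 * Real.pi, f (Real.pi - θ) = ∫ θ in (0:ℝ)..2 * Real.pi, f θ := by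
    rw [intervalIntegral.integral_comp_sub_left]
    have := hper.intervalIntegral_add_eq (-Real.pi) 0
    rw [show Real.pi - 2 * Real.pi = -Real.pi by ring, sub_zero]
    rw [zero_add] at this
    rw [← this]; congr 1; ring
  rw [intervalIntegral.integral_div, intervalIntegral.integral_add, h1]
  · ring
  · exact hf.intervalIntegrable _ _
  · exact (hf.comp (continuous_const.sub continuous_id)).intervalIntegrable _ _

/-- The odd part of a function. -/
noncomputable def oddPart (F : ℝ → ℝ) (x : ℝ) : ℝ := (F x - F (-x)) / 2

/-- The even part of a function. -/
noncomputable def evenPart (F : ℝ → ℝ) (x : ℝ) : ℝ := (F x + F (-x)) / 2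

namespace EnergyAnnulus

variable (A : EnergyAnnulus)

lemma D_zero_ne {F : ℝ → ℝ} (h θ : ℝ) : A.D F 0 h θ ≠ 0 := by
  have := (A.pos _ (A.rho_mem h θ) θ).ne'
  simpa [D, qD] using this

lemma continuous_e_zero {F : ℝ → ℝ} (hF : Continuous F) (h : ℝ) :
    Continuous fun θ => A.e F 0 h θ := by
  rw [← continuousOn_univ]
  exact (A.continuousOn_e hF (s := {0}) fun ε hε h θ => by
    rw [Set.mem_singleton_iff.1 hε]; exact A.D_zero_ne h θ).comp (f := fun θ : ℝ => (0, h, θ))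
    (by fun_prop) fun θ _ => ⟨rfl, trivial⟩

lemma continuous_κ_zero {F F' : ℝ → ℝ} (hF : Continuous F) (hF' : Continuous F') (h : ℝ) :
    Continuous fun θ => A.κ F F' 0 h θ := by
  rw [← continuousOn_univ]
  exact (A.continuousOn_κ hF hF' (s := {0}) fun ε hε h θ => by
    rw [Set.mem_singleton_iff.1 hε]; exact A.D_zero_ne h θ).comp (f := fun θ : ℝ => (0, h, θ))
    (by fun_prop) fun θ _ => ⟨rfl, trivial⟩

lemma integral_e_oddPart {F : ℝ → ℝ} (hF : Continuous F) (h : ℝ) :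
    ∫ θ in (0:ℝ)..2 * Real.pi, A.e (oddPart F) 0 h θ = ∫ θ in (0:ℝ)..2 * Real.pi, A.e F 0 h θ := by
  rw [← integral_symm_average (A.continuous_e_zero hF h) (A.e_periodic 0 h)]
  congr 1; funext θ
  simp only [e, rho_symm, Real.cos_pi_sub, Real.sin_pi_sub, mul_neg, A.g_neg, oddPart, qE, qD, qN,
    qY, neg_mul, neg_neg, neg_sq, zero_mul, add_zero]
  ring

lemma integral_κ_oddPart {F F' : ℝ → ℝ} (hF : Continuous F) (hF' : Continuous F') (h : ℝ) :
    ∫ θ in (0:ℝ)..2 * Real.pi, A.κ (oddPart F) (evenPart F') 0 h θ =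
      ∫ θ in (0:ℝ)..2 * Real.pi, A.κ F F' 0 h θ := by
  have hg' : ∀ x, A.g' (-x) = A.g' x := by
    intro x
    have h1 := (A.hg (-x)).comp x (hasDerivAt_neg x)
    have h2 := (A.hg x).neg
    have : (A.g ∘ fun x => -x) = -A.g := by funext y; simp [A.g_neg]
    rw [this] at h1
    have := h1.unique h2
    linarith
  rw [← integral_symm_average (A.continuous_κ_zero hF hF' h) (A.κ_periodic 0 h)]
  congr 1; funext θ
  simp only [κ, rho_symm, Real.cos_pi_sub, Real.sin_pi_sub, mul_neg, A.g_neg, hg', oddPart,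
    evenPart, qK, qD, qD', qN, qN', qY, qY', neg_mul, neg_neg, neg_sq, zero_mul, add_zero]
  ring

end EnergyAnnulus

lemma inv_two_pow_le_of_one_le {u w : ℝ} (d : ℕ) (h : 1 ≤ u ^ 2 + w ^ 2) :
    (1 / 2) ^ (d + 1) ≤ (u ^ 2) ^ (d + 1) + w ^ 2 := by
  rcases le_total (1 / 2) (u ^ 2) with hu | hu
  · have := pow_le_pow_left₀ (by norm_num : (0:ℝ) ≤ 1 / 2) hu (d + 1)
    nlinarith [sq_nonneg w]
  · have h1 : ((1:ℝ) / 2) ^ (d + 1) ≤ (1 / 2) ^ 1 :=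
      pow_le_pow_of_le_one (by norm_num) (by norm_num) (by omega)
    have : 0 ≤ (u ^ 2) ^ (d + 1) := by positivity
    linarith

lemma sq_pow_add_le_one {u w : ℝ} (d : ℕ) (h : u ^ 2 + w ^ 2 ≤ 1) :
    (u ^ 2) ^ (d + 1) + w ^ 2 ≤ 1 := by
  have : (u ^ 2) ^ (d + 1) ≤ (u ^ 2) ^ 1 :=
    pow_le_pow_of_le_one (sq_nonneg u) (by nlinarith [sq_nonneg w]) (by omega)
  linarith

lemma exists_cos_sin {u w : ℝ} (h : u ^ 2 + w ^ 2 = 1) :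
    ∃ θ, u = Real.cos θ ∧ w = Real.sin θ := by
  have hn : ‖(⟨u, w⟩ : ℂ)‖ = 1 := by
    rw [Complex.norm_def, Complex.normSq_mk, ← sq, ← sq, h, Real.sqrt_one]
  refine ⟨Complex.arg ⟨u, w⟩, ?_, ?_⟩
  · rw [Complex.cos_arg (by intro h0; simp [h0] at hn), hn]; simp
  · rw [Complex.sin_arg, hn]; simp

lemma exists_polar {d : ℕ} {ra rb x v : ℝ} (ha : 0 < ra) (hab : ra < rb)
    (h1 : 1 ≤ (x / ra) ^ 2 + (v / ra ^ (d + 1)) ^ 2)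
    (h2 : (x / rb) ^ 2 + (v / rb ^ (d + 1)) ^ 2 ≤ 1) :
    ∃ r ∈ Set.Icc ra rb, ∃ θ, x = r * Real.cos θ ∧ v = -(r ^ (d + 1) * Real.sin θ) := by
  have hc : ContinuousOn (fun r : ℝ => (x / r) ^ 2 + (v / r ^ (d + 1)) ^ 2) (Set.Icc ra rb) := by
    intro r hr
    have : 0 < r := ha.trans_le hr.1
    exact ContinuousAt.continuousWithinAt (by fun_prop (disch := positivity))
  obtain ⟨r, hr, hr1⟩ := intermediate_value_Icc' hab.le hc ⟨h2, h1⟩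
  have hr0 : 0 < r := ha.trans_le hr.1
  obtain ⟨θ, hu, hw⟩ := exists_cos_sin (u := x / r) (w := -(v / r ^ (d + 1)))
    (by simpa using hr1)
  refine ⟨r, hr, θ, ?_, ?_⟩
  · rw [← hu]; field_simp
  · rw [← hw]; field_simp

/-- Odd restoring forces close to the homogeneous one give annuli. -/
lemma exists_annulus (d : ℕ) {R : ℝ} (hR : 1 ≤ R) : ∃ μ, 0 < μ ∧ ∀ g g' G : ℝ → ℝ,
    (∀ x, HasDerivAt G (g x) x) → (∀ x, HasDerivAt g (g' x) x) → Continuous g' →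
    (∀ x, g (-x) = -g x) → (∀ x, G (-x) = G x) →
    (∀ x, |x| ≤ 2 * R + 1 → |g x - (d + 1) * x ^ (2 * d + 1)| ≤ μ ∧
      |G x - x ^ (2 * d + 2) / 2| ≤ μ) →
    ∃ A : EnergyAnnulus, A.d = d ∧ A.g = g ∧ A.g' = g' ∧ A.G = G ∧ A.ra = 1 / 4 ∧ A.rb = 2 * R ∧
      A.lo = (1 / 2) ^ (2 * d + 2) / 2 ∧ A.hi = R ^ (2 * d + 2) / 2 ∧ A.L = 2 * R + 1 := by
  have hm1 : (0:ℝ) < ((1 / 2) ^ (2 * d + 2) - (1 / 4) ^ (2 * d + 2)) / 4 := by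
    have := pow_lt_pow_left₀ (by norm_num : (1:ℝ) / 4 < 1 / 2) (by norm_num) (n := 2 * d + 2)
      (by omega)
    linarith
  have e1 : ((2 * R) ^ 2) ^ (d + 1) * (1 / 2) ^ (d + 1) = 2 ^ (d + 1) * R ^ (2 * d + 2) := by
    rw [← mul_pow, show 2 * d + 2 = 2 * (d + 1) by ring, pow_mul, ← mul_pow]; congr 1; ring
  have h2d : (2:ℝ) ≤ 2 ^ (d + 1) := by
    have := pow_le_pow_right₀ (by norm_num : (1:ℝ) ≤ 2) (show 1 ≤ d + 1 by omega)
    simpa using this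
  have hRp : 1 ≤ R ^ (2 * d + 2) := one_le_pow₀ hR
  obtain ⟨μ, hμ, hμ'⟩ : ∃ μ : ℝ, 0 < μ ∧ μ < (d + 1) * (1 / 4) ^ (2 * d + 1) * (1 / 2) ^ (d + 1) ∧
      μ < ((1 / 2) ^ (2 * d + 2) - (1 / 4) ^ (2 * d + 2)) / 4 ∧ μ < 1 / 4 := by
    obtain ⟨μ, h0, h1⟩ := exists_between
      (lt_min (a := (0:ℝ)) (b := (d + 1) * (1 / 4) ^ (2 * d + 1) * (1 / 2) ^ (d + 1))
        (by positivity) (lt_min hm1 (by norm_num : (0:ℝ) < 1 / 4)))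
    rw [lt_min_iff, lt_min_iff] at h1
    exact ⟨μ, h0, h1⟩
  obtain ⟨hμ1, hμ2, hμ3⟩ := hμ'
  refine ⟨μ, hμ, fun g g' G hG hg hg' go Ge hcl => ?_⟩
  have hab : ∀ r : ℝ, 0 < r → r ≤ 2 * R → ∀ θ, |r * Real.cos θ| ≤ 2 * R + 1 := by
    intro r h0 h1 θ
    rw [abs_mul, abs_of_pos h0]
    nlinarith [Real.abs_cos_le_one θ, abs_nonneg (Real.cos θ)]
  have hlo : ∀ x v : ℝ, |x| ≤ 2 * R + 1 → (x / (1 / 4)) ^ 2 + (v / (1 / 4) ^ (d + 1)) ^ 2 ≤ 1 →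
      v ^ 2 / 2 + G x < (1 / 2) ^ (2 * d + 2) / 2 := by
    intro x v hx h
    have h1 := sq_pow_add_le_one d h
    have h2 := (abs_le.1 (hcl x hx).2).2
    have h3 : x ^ (2 * d + 2) + v ^ 2 =
        (1 / 4) ^ (2 * d + 2) * (((x / (1 / 4)) ^ 2) ^ (d + 1) + (v / (1 / 4) ^ (d + 1)) ^ 2) := by
      rw [show 2 * d + 2 = 2 * (d + 1) by ring, pow_mul, pow_mul, mul_add, ← mul_pow]
      congr 1
      · congr 1; ring
      · have : ((1:ℝ) / 4) ^ (d + 1) ≠ 0 := by positivity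
        rw [pow_right_comm, ← mul_pow, mul_div_cancel₀ _ this]
    have h4 : (0:ℝ) < (1 / 4) ^ (2 * d + 2) := by positivity
    nlinarith
  have hhi : ∀ x v : ℝ, |x| ≤ 2 * R + 1 → 1 ≤ (x / (2 * R)) ^ 2 + (v / (2 * R) ^ (d + 1)) ^ 2 →
      R ^ (2 * d + 2) / 2 < v ^ 2 / 2 + G x := by
    intro x v hx h
    have h1 := inv_two_pow_le_of_one_le d h
    have h2 := (abs_le.1 (hcl x hx).2).1
    have h3 : x ^ (2 * d + 2) + v ^ 2 =
        ((2 * R) ^ 2) ^ (d + 1) * (((x / (2 * R)) ^ 2) ^ (d + 1) + (v / (2 * R) ^ (d + 1)) ^ 2) := by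
      rw [show 2 * d + 2 = 2 * (d + 1) by ring, pow_mul, mul_add, ← mul_pow]
      congr 1
      · congr 1; field_simp
      · have : (2 * R) ^ (d + 1) ≠ 0 := by positivity
        rw [pow_right_comm, ← mul_pow, mul_div_cancel₀ _ this]
    have h4 := mul_le_mul_of_nonneg_left h1 (show 0 ≤ ((2 * R) ^ 2) ^ (d + 1) by positivity)
    rw [e1, ← h3] at h4
    nlinarith
  refine ⟨⟨d, g, g', G, 1 / 4, 2 * R, (1 / 2) ^ (2 * d + 2) / 2, R ^ (2 * d + 2) / 2, 2 * R + 1,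
    hG, hg, hg', go, Ge, by norm_num, by linarith, by linarith, ?_, ?_, ?_, ?_, ?_⟩,
    rfl, rfl, rfl, rfl, rfl, rfl, rfl, rfl, rfl⟩
  · have : (1 / 2 : ℝ) ^ (2 * d + 2) < 1 := pow_lt_one₀ (by norm_num) (by norm_num) (by omega)
    linarith
  · intro r hr θ
    have hr0 : 0 < r := lt_of_lt_of_le (by norm_num) hr.1
    have h1 := (hcl _ (hab r hr0 hr.2 θ)).1
    have h2 := inv_two_pow_le_of_one_le (u := Real.cos θ) (w := Real.sin θ) d
      (Real.cos_sq_add_sin_sq θ).ge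
    have h3 : (1 / 4 : ℝ) ^ (2 * d + 1) ≤ r ^ (2 * d + 1) :=
      pow_le_pow_left₀ (by norm_num) hr.1 _
    have h4 : (d + 1) * (1 / 4) ^ (2 * d + 1) * (1 / 2) ^ (d + 1) ≤
        (d + 1) * r ^ (2 * d + 1) * ((Real.cos θ ^ 2) ^ (d + 1) + Real.sin θ ^ 2) := by
      gcongr
    have h5 : |Real.cos θ * (g (r * Real.cos θ) - (d + 1) * (r * Real.cos θ) ^ (2 * d + 1))| ≤ μ := by
      rw [abs_mul]
      exact (mul_le_of_le_one_left (abs_nonneg _) (Real.abs_cos_le_one θ)).trans h1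
    have h6 := (abs_le.1 h5).1
    have h7 : qN d (g (r * Real.cos θ)) r (Real.cos θ) (Real.sin θ) =
      (d + 1) * r ^ (2 * d + 1) * ((Real.cos θ ^ 2) ^ (d + 1) + Real.sin θ ^ 2) +
      Real.cos θ * (g (r * Real.cos θ) - (d + 1) * (r * Real.cos θ) ^ (2 * d + 1)) := by
      rw [qN, ← pow_mul]; ring
    rw [h7]; linarith
  · intro θ
    refine hlo _ _ (hab _ (by norm_num) (by linarith) θ) (le_of_eq ?_)
    rw [← Real.cos_sq_add_sin_sq θ]; field_simp
  · intro θ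
    refine hhi _ _ (hab _ (by linarith) le_rfl θ) (le_of_eq ?_)
    rw [← Real.cos_sq_add_sin_sq θ]; field_simp
  · intro x v hx hE
    refine exists_polar (by norm_num) (by linarith) ?_ ?_
    · by_contra! h
      exact absurd (hlo x v hx.le h.le) (not_lt.2 hE.1.le)
    · by_contra! h
      exact absurd (hhi x v hx.le h.le) (not_lt.2 hE.2.le)

lemma qE_homogeneous {d : ℕ} {F r c s : ℝ} (hr : r ≠ 0) :
    qE d 0 ((d + 1) * (r * c) ^ (2 * d + 1)) F r c s =
      -(c ^ (2 * d + 1) * F * r ^ (d + 1) * (c ^ 2 + (d + 1) * s ^ 2) /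
        (c ^ (2 * d + 2) + s ^ 2)) := by
  have hD : qD d 0 ((d + 1) * (r * c) ^ (2 * d + 1)) F r c s =
      ((d + 1) * r ^ (2 * d + 1)) * (c ^ (2 * d + 2) + s ^ 2) := by
    simp only [qD, qN]; ring
  have hY : qY d ((d + 1) * (r * c) ^ (2 * d + 1)) F r c s = ((d + 1) * r ^ (2 * d + 1)) *
      -(c ^ (2 * d + 1) * F * r ^ (d + 1) * (c ^ 2 + (d + 1) * s ^ 2)) := by
    simp only [qY]; ring
  rw [qE, hD, hY, mul_div_mul_left _ _ (by positivity), neg_div]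

lemma qK_homogeneous {d : ℕ} {F F' r c s : ℝ} (hr : r ≠ 0) (hσ : c ^ (2 * d + 2) + s ^ 2 ≠ 0) :
    qK d 0 ((d + 1) * (r * c) ^ (2 * d + 1)) ((d + 1) * ((2 * d + 1) * (r * c) ^ (2 * d))) F F' r c s =
      qE d 0 ((d + 1) * (r * c) ^ (2 * d + 1)) (r * c * F' + (d + 1) * F) r c s /
        ((d + 1) * (r ^ (2 * d + 2) * (c ^ (2 * d + 2) + s ^ 2))) := by
  have hN : qN d ((d + 1) * (r * c) ^ (2 * d + 1)) r c s =
      ((d + 1) * r ^ (2 * d + 1)) * (c ^ (2 * d + 2) + s ^ 2) := by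
    simp only [qN]; ring
  have hN' : r * qN' d ((d + 1) * ((2 * d + 1) * (r * c) ^ (2 * d))) r c s =
      (2 * d + 1) * (((d + 1) * r ^ (2 * d + 1)) * (c ^ (2 * d + 2) + s ^ 2)) := by
    simp only [qN']; ring
  have hY' : r * qY' d ((d + 1) * (r * c) ^ (2 * d + 1)) ((d + 1) * ((2 * d + 1) * (r * c) ^ (2 * d)))
      F F' r c s = qY d ((d + 1) * (r * c) ^ (2 * d + 1)) (r * c * F' + (d + 1) * F) r c s +
        (2 * d + 1) * qY d ((d + 1) * (r * c) ^ (2 * d + 1)) F r c s := by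
    simp only [qY', qY]; ring
  have hne : ((d + 1) * r ^ (2 * d + 1)) * (c ^ (2 * d + 2) + s ^ 2) ≠ 0 := by positivity
  have hden : (d + 1) * (r ^ (2 * d + 2) * (c ^ (2 * d + 2) + s ^ 2)) =
      r * (((d + 1) * r ^ (2 * d + 1)) * (c ^ (2 * d + 2) + s ^ 2)) := by ring
  rw [qK, qE, qD, qD, qD', hden]
  simp only [zero_mul, add_zero, hN]
  set Nv := ((d + 1) * r ^ (2 * d + 1)) * (c ^ (2 * d + 2) + s ^ 2)
  set Y' := qY' d ((d + 1) * (r * c) ^ (2 * d + 1)) ((d + 1) * ((2 * d + 1) * (r * c) ^ (2 * d))) F F' r c s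
  set N' := qN' d ((d + 1) * ((2 * d + 1) * (r * c) ^ (2 * d))) r c s
  rw [← sub_eq_iff_eq_add] at hY'
  rw [← hY']
  field_simp
  linear_combination (-qY d ((d + 1) * (r * c) ^ (2 * d + 1)) F r c s) * hN'

namespace EnergyAnnulus

/-- An annulus with homogeneous restoring force. -/
structure IsHomogeneous (A : EnergyAnnulus) (R : ℝ) : Prop where
  g_eq : A.g = fun x : ℝ => ((A.d:ℝ) + 1) * x ^ (2 * A.d + 1)
  g'_eq : A.g' = fun x : ℝ => ((A.d:ℝ) + 1) * ((2 * A.d + 1) * x ^ (2 * A.d))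
  G_eq : A.G = fun x : ℝ => x ^ (2 * A.d + 2) / 2
  lo_eq : A.lo = (1 / 2) ^ (2 * A.d + 2) / 2
  hi_eq : A.hi = R ^ (2 * A.d + 2) / 2
  one_le : 1 ≤ R

lemma exists_isHomogeneous (d : ℕ) {R : ℝ} (hR : 1 ≤ R) : ∃ A : EnergyAnnulus, A.IsHomogeneous R ∧
    A.d = d ∧ A.ra = 1 / 4 ∧ A.rb = 2 * R ∧ A.L = 2 * R + 1 := by
  obtain ⟨μ, hμ, h⟩ := exists_annulus d hR
  obtain ⟨A, rfl, h1, h2, h3, h4, h5, h6, h7, h8⟩ := h (fun x => (d + 1) * x ^ (2 * d + 1))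
    (fun x => (d + 1) * ((2 * d + 1) * x ^ (2 * d))) (fun x => x ^ (2 * d + 2) / 2)
    (fun x => ((hasDerivAt_pow _ x).div_const 2).congr_deriv (by push_cast; ring_nf))
    (fun x => ((hasDerivAt_pow _ x).const_mul _).congr_deriv (by push_cast; simp))
    (by fun_prop)
    (fun x => by rw [Odd.neg_pow ⟨d, rfl⟩]; ring)
    (fun x => by rw [Even.neg_pow ⟨d + 1, by ring⟩])
    (fun x _ => by simp [hμ.le])
  exact ⟨A, ⟨h1, h2, h3, h6, h7, hR⟩, rfl, h4, h5, h8⟩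

lemma _root_.cos_pow_add_sin_sq_pos (d : ℕ) (θ : ℝ) : 0 < Real.cos θ ^ (2 * d + 2) + Real.sin θ ^ 2 := by
  have := inv_two_pow_le_of_one_le (u := Real.cos θ) (w := Real.sin θ) d
    (Real.cos_sq_add_sin_sq θ).ge
  rw [← pow_mul] at this
  exact lt_of_lt_of_le (by positivity) this

/-- The weights of the averages of odd monomials. -/
noncomputable def weight (A : EnergyAnnulus) (i : ℕ) (θ : ℝ) : ℝ :=
  Real.cos θ ^ (2 * (A.d + 1 + i)) * A.rho (1 / 2) θ ^ (2 * i + A.d + 2) *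
    (Real.cos θ ^ 2 + (A.d + 1) * Real.sin θ ^ 2) / (Real.cos θ ^ (2 * A.d + 2) + Real.sin θ ^ 2)

lemma continuous_weight (A : EnergyAnnulus) (i : ℕ) : Continuous (A.weight i) := by
  have h1 : Continuous fun θ => A.rho (1 / 2) θ :=
    A.continuous_rho.comp (f := fun θ : ℝ => ((1 / 2 : ℝ), θ)) (by fun_prop)
  have h2 := fun θ => (cos_pow_add_sin_sq_pos A.d θ).ne'
  refine Continuous.div (by fun_prop) (by fun_prop) h2

lemma integral_weight_pos (A : EnergyAnnulus) (i : ℕ) : 0 < ∫ θ in (0:ℝ)..2 * Real.pi, A.weight i θ := by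
  have hw : ∀ θ, 0 < A.rho (1 / 2) θ ∧ 0 < Real.cos θ ^ (2 * A.d + 2) + Real.sin θ ^ 2 :=
    fun θ => ⟨A.rho_pos _ _, cos_pow_add_sin_sq_pos A.d θ⟩
  refine intervalIntegral.integral_pos (by positivity) (A.continuous_weight i).continuousOn
    (fun θ _ => ?_) ⟨0, ⟨le_rfl, by positivity⟩, ?_⟩
  · have := hw θ
    have h3 : 0 ≤ Real.cos θ ^ (2 * (A.d + 1 + i)) := by rw [pow_mul]; positivity
    unfold weight
    have := this.1; have := (hw θ).2
    positivity
  · have := (hw 0).1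
    simp only [weight, Real.cos_zero, Real.sin_zero]
    simp only [one_pow]
    positivity

namespace IsHomogeneous

variable {A : EnergyAnnulus} {R : ℝ} (hA : A.IsHomogeneous R)
include hA

lemma rho_pow {τ θ : ℝ} (h : τ ∈ Set.Icc (1 / 2) R) :
    A.rho (τ ^ (2 * A.d + 2) / 2) θ ^ (2 * A.d + 2) *
      (Real.cos θ ^ (2 * A.d + 2) + Real.sin θ ^ 2) = τ ^ (2 * A.d + 2) := by
  have h1 := A.Hp_rho (τ ^ (2 * A.d + 2) / 2) θ
  have h0 : 0 < τ := lt_of_lt_of_le (by norm_num) h.1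
  rw [A.cl_of_mem ⟨?_, ?_⟩, Hp, hA.G_eq] at h1
  · linear_combination 2 * h1
  · rw [hA.lo_eq]
    have := pow_le_pow_left₀ (by norm_num) h.1 (2 * A.d + 2)
    linarith
  · rw [hA.hi_eq]
    have := pow_le_pow_left₀ h0.le h.2 (2 * A.d + 2)
    linarith

lemma rho_eq_mul {τ θ : ℝ} (h : τ ∈ Set.Icc (1 / 2) R) :
    A.rho (τ ^ (2 * A.d + 2) / 2) θ = τ * A.rho (1 / 2) θ := by
  have h0 : 0 < τ := lt_of_lt_of_le (by norm_num) h.1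
  have h1 := hA.rho_pow (θ := θ) h
  have h2 := hA.rho_pow (τ := 1) (θ := θ) ⟨by norm_num, hA.one_le⟩
  rw [one_pow] at h2
  have h3 := cos_pow_add_sin_sq_pos A.d θ
  refine (pow_left_inj₀ (A.rho_pos _ _).le (mul_pos h0 (A.rho_pos _ _)).le
    (show 2 * A.d + 2 ≠ 0 by omega)).1 (mul_right_cancel₀ h3.ne' ?_)
  rw [h1, mul_pow, mul_assoc, h2, mul_one]

lemma e_sum (s : Finset ℕ) (c : ℕ → ℝ) {τ θ : ℝ} (h : τ ∈ Set.Icc (1 / 2) R) :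
    A.e (fun x => ∑ i ∈ s, c i * x ^ (2 * i + 1)) 0 (τ ^ (2 * A.d + 2) / 2) θ =
      ∑ i ∈ s, -(c i * τ ^ (2 * i + A.d + 2)) * A.weight i θ := by
  rw [e, hA.g_eq, qE_homogeneous (A.rho_pos _ _).ne', hA.rho_eq_mul h]
  rw [Finset.mul_sum, Finset.sum_mul, Finset.sum_mul, Finset.sum_div, ← Finset.sum_neg_distrib]
  refine Finset.sum_congr rfl fun i _ => ?_
  rw [weight]; ring

lemma integral_e_sum (s : Finset ℕ) (c : ℕ → ℝ) {τ : ℝ} (h : τ ∈ Set.Icc (1 / 2) R) :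
    ∫ θ in (0:ℝ)..2 * Real.pi,
      A.e (fun x => ∑ i ∈ s, c i * x ^ (2 * i + 1)) 0 (τ ^ (2 * A.d + 2) / 2) θ =
      ∑ i ∈ s, -(c i * τ ^ (2 * i + A.d + 2)) * ∫ θ in (0:ℝ)..2 * Real.pi, A.weight i θ := by
  simp only [hA.e_sum s c h]
  rw [intervalIntegral.integral_finsetSum]
  · simp only [intervalIntegral.integral_const_mul]
  · exact fun i _ => ((A.continuous_weight i).const_mul _).intervalIntegrable _ _

lemma integral_κ_sum (s : Finset ℕ) (c : ℕ → ℝ) {τ : ℝ} (h : τ ∈ Set.Icc (1 / 2) R) :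
    ∫ θ in (0:ℝ)..2 * Real.pi, A.κ (fun x => ∑ i ∈ s, c i * x ^ (2 * i + 1))
      (fun x => ∑ i ∈ s, c i * ((2 * i + 1) * x ^ (2 * i))) 0 (τ ^ (2 * A.d + 2) / 2) θ =
      (∑ i ∈ s, -(c i * ((2 * i + A.d + 2) * τ ^ (2 * i + A.d + 2))) *
        ∫ θ in (0:ℝ)..2 * Real.pi, A.weight i θ) / ((A.d + 1) * τ ^ (2 * A.d + 2)) := by
  have : ∀ θ, A.κ (fun x => ∑ i ∈ s, c i * x ^ (2 * i + 1))
      (fun x => ∑ i ∈ s, c i * ((2 * i + 1) * x ^ (2 * i))) 0 (τ ^ (2 * A.d + 2) / 2) θ =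
      A.e (fun x => ∑ i ∈ s, (c i * (2 * i + A.d + 2)) * x ^ (2 * i + 1)) 0
        (τ ^ (2 * A.d + 2) / 2) θ / ((A.d + 1) * τ ^ (2 * A.d + 2)) := by
    intro θ
    rw [κ, hA.g_eq, hA.g'_eq, qK_homogeneous (A.rho_pos _ _).ne' (cos_pow_add_sin_sq_pos A.d _).ne',
      hA.rho_pow h, e, hA.g_eq]
    congr 2
    rw [Finset.mul_sum, Finset.mul_sum, ← Finset.sum_add_distrib]
    exact Finset.sum_congr rfl fun i _ => by ring
  simp only [this]
  rw [intervalIntegral.integral_div, hA.integral_e_sum s _ h]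
  congr 1
  exact Finset.sum_congr rfl fun i _ => by ring

end IsHomogeneous

end EnergyAnnulus

lemma Polynomial.exists_window {f : ℝ[X]} {a : ℝ} (h0 : f.eval a = 0)
    (h1 : f.derivative.eval a ≠ 0) : ∃ w, 0 < w ∧ w ≤ 1 / 8 ∧
      (∀ x ∈ Set.Icc (a - w) (a + w), f.derivative.eval x ≠ 0) ∧
      f.eval (a - w) * f.eval (a + w) < 0 := by
  have hev : ∀ᶠ x in nhds a, 0 < f.derivative.eval a * f.derivative.eval x :=
    (f.derivative.continuous.const_mul _).continuousAt.eventually_const_lt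
      (mul_self_pos.2 h1)
  obtain ⟨u, hu, hev⟩ := Metric.eventually_nhds_iff_ball.1 hev
  have hw : 0 < min (u / 2) (1 / 8) := by positivity
  set w := min (u / 2) (1 / 8)
  have hpos : ∀ x ∈ Set.Icc (a - w) (a + w), 0 < f.derivative.eval a * f.derivative.eval x := by
    intro x hx
    refine hev x ?_
    rw [Metric.mem_ball, Real.dist_eq]
    have : |x - a| ≤ w := abs_le.2 ⟨by linarith [hx.1], by linarith [hx.2]⟩
    linarith [min_le_left (u / 2) (1 / 8 : ℝ)]
  have hmono : StrictMonoOn (fun x => f.derivative.eval a * f.eval x)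
      (Set.Icc (a - w) (a + w)) := by
    refine strictMonoOn_of_deriv_pos (convex_Icc _ _)
      (f.continuous.const_mul _).continuousOn fun x hx => ?_
    rw [interior_Icc] at hx
    rw [((f.hasDerivAt x).const_mul _).deriv]
    exact hpos x (Set.Ioo_subset_Icc_self hx)
  refine ⟨w, hw, min_le_right _ _, fun x hx => right_ne_zero_of_mul (hpos x hx).ne', ?_⟩
  have ha : a ∈ Set.Icc (a - w) (a + w) := ⟨by linarith, by linarith⟩
  have h2 := hmono ⟨le_rfl, by linarith⟩ ha (by linarith : a - w < a)
  have h3 := hmono ha ⟨by linarith, le_rfl⟩ (by linarith : a < a + w)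
  simp only [h0, mul_zero] at h2 h3
  have h4 := mul_neg_of_neg_of_pos h2 h3
  have h5 : 0 < f.derivative.eval a ^ 2 := by positivity
  by_contra! hc
  nlinarith [mul_nonneg h5.le hc]

/-- An even polynomial times a power of `x` with simple zeros at `1, …, N`. -/
lemma exists_coeff_windows (d N : ℕ) : ∃ b : ℕ → ℝ, ∀ j < N, ∃ w : ℝ, 0 < w ∧ w ≤ 1 / 8 ∧
    (∀ τ ∈ Set.Icc (j + 1 - w) (j + 1 + w),
      ∑ i ∈ Finset.range (N + 1), b i * ((2 * i + d + 2) * τ ^ (2 * i + d + 2)) ≠ 0) ∧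
    (∑ i ∈ Finset.range (N + 1), b i * (j + 1 - w) ^ (2 * i + d + 2)) *
      (∑ i ∈ Finset.range (N + 1), b i * (j + 1 + w) ^ (2 * i + d + 2)) < 0 := by
  set v : ℕ → ℝ := fun j => (j + 1) ^ 2 with hv
  set Q : ℝ[X] := Lagrange.nodal (Finset.range N) v with hQ
  have hvinj : ∀ i j, v i = v j → i = j := by
    intro i j h
    have := (pow_left_inj₀ (by positivity) (by positivity) two_ne_zero).1 h
    exact_mod_cast add_right_cancel this
  set f : ℝ[X] := ∑ i ∈ Finset.range (N + 1), C (Q.coeff i) * X ^ (2 * i + d + 2) with hf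
  have hfe : ∀ τ, f.eval τ = ∑ i ∈ Finset.range (N + 1), Q.coeff i * τ ^ (2 * i + d + 2) := by
    intro τ; simp [hf, eval_finsetSum]
  have hfd : ∀ τ, τ * f.derivative.eval τ =
      ∑ i ∈ Finset.range (N + 1), Q.coeff i * ((2 * i + d + 2) * τ ^ (2 * i + d + 2)) := by
    intro τ
    simp only [hf, derivative_sum, derivative_C_mul_X_pow, eval_finsetSum, eval_mul, eval_C, eval_pow,
      eval_X, Finset.mul_sum]
    refine Finset.sum_congr rfl fun i _ => ?_
    rw [show 2 * i + d + 2 - 1 = 2 * i + d + 1 by omega]; push_cast; ring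
  have hfQ : ∀ τ, f.eval τ = τ ^ (d + 2) * Q.eval (τ ^ 2) := by
    intro τ
    rw [hfe, eval_eq_sum_range, Lagrange.natDegree_nodal, Finset.card_range, Finset.mul_sum]
    refine Finset.sum_congr rfl fun i _ => ?_
    rw [← pow_mul]; ring
  refine ⟨fun i => Q.coeff i, fun j hj => ?_⟩
  have hjm : j ∈ Finset.range N := Finset.mem_range.2 hj
  have hQj : Q.eval (((j:ℝ) + 1) ^ 2) = 0 := Lagrange.eval_nodal_at_node (v := v) hjm
  have hQj' : Q.derivative.eval (((j:ℝ) + 1) ^ 2) ≠ 0 := by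
    have := Lagrange.eval_nodal_derivative_eval_node_eq (v := v) hjm
    rw [show ((j:ℝ) + 1) ^ 2 = v j from rfl, this]
    refine Lagrange.eval_nodal_not_at_node fun i hi h => ?_
    exact (Finset.mem_erase.1 hi).1 (hvinj _ _ h).symm
  have h0 : f.eval ((j:ℝ) + 1) = 0 := by rw [hfQ, hQj, mul_zero]
  have h1 : f.derivative.eval ((j:ℝ) + 1) ≠ 0 := by
    have h2 : HasDerivAt (fun τ => τ ^ (d + 2) * Q.eval (τ ^ 2)) (f.derivative.eval ((j:ℝ) + 1))
        ((j:ℝ) + 1) := by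
      have := f.hasDerivAt ((j:ℝ) + 1)
      rwa [show (fun τ => f.eval τ) = fun τ => τ ^ (d + 2) * Q.eval (τ ^ 2) from funext hfQ] at this
    have h3 := (hasDerivAt_pow (d + 2) ((j:ℝ) + 1)).mul
      ((Q.hasDerivAt (((j:ℝ) + 1) ^ 2)).comp ((j:ℝ) + 1) (hasDerivAt_pow 2 ((j:ℝ) + 1)))
    rw [h2.unique h3]
    simp only [Function.comp, hQj]
    have : (j:ℝ) + 1 ≠ 0 := by positivity
    simp [hQj', this]
  obtain ⟨w, hw, hw8, h2, h3⟩ := exists_window h0 h1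
  refine ⟨w, hw, hw8, fun τ hτ => ?_, ?_⟩
  · rw [← hfd]
    refine mul_ne_zero ?_ (h2 τ hτ)
    have : (0:ℝ) ≤ j := j.cast_nonneg
    linarith [hτ.1]
  · rwa [hfe, hfe] at h3

namespace EnergyAnnulus

lemma IsHomogeneous.exists_averages {A : EnergyAnnulus} {N : ℕ} (hA : A.IsHomogeneous (N + 1)) :
    ∃ c : ℕ → ℝ, ∀ j < N, ∃ w : ℝ, 0 < w ∧ w ≤ 1 / 8 ∧ ∃ ν, 0 < ν ∧ ∃ I K : ℝ → ℝ,
      (∀ τ, I τ = ∫ θ in (0:ℝ)..2 * Real.pi,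
        A.e (fun x => ∑ i ∈ Finset.range (N + 1), c i * x ^ (2 * i + 1)) 0
          (τ ^ (2 * A.d + 2) / 2) θ) ∧
      (∀ τ, K τ = ∫ θ in (0:ℝ)..2 * Real.pi,
        A.κ (fun x => ∑ i ∈ Finset.range (N + 1), c i * x ^ (2 * i + 1))
          (fun x => ∑ i ∈ Finset.range (N + 1), c i * ((2 * i + 1) * x ^ (2 * i))) 0
          (τ ^ (2 * A.d + 2) / 2) θ) ∧
      I (j + 1 - w) * I (j + 1 + w) < 0 ∧ ν ≤ |I (j + 1 - w)| ∧ ν ≤ |I (j + 1 + w)| ∧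
      ∀ τ ∈ Set.Icc (j + 1 - w) (j + 1 + w), ν ≤ |K τ| := by
  obtain ⟨b, hb⟩ := exists_coeff_windows A.d N
  refine ⟨fun i => b i / ∫ θ in (0:ℝ)..2 * Real.pi, A.weight i θ, fun j hj => ?_⟩
  obtain ⟨w, hw, hw8, h1, h2⟩ := hb j hj
  have hjN : (j:ℝ) + 1 ≤ N := by exact_mod_cast hj
  have hj0 : (0:ℝ) ≤ j := j.cast_nonneg
  have hmem : ∀ τ ∈ Set.Icc ((j:ℝ) + 1 - w) (j + 1 + w), τ ∈ Set.Icc (1 / 2) ((N:ℝ) + 1) :=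
    fun τ hτ => ⟨by linarith [hτ.1], by linarith [hτ.2]⟩
  have hk := fun i => (A.integral_weight_pos i).ne'
  have hI := fun τ hτ => hA.integral_e_sum (Finset.range (N + 1))
    (fun i => b i / ∫ θ in (0:ℝ)..2 * Real.pi, A.weight i θ) (hmem τ hτ)
  have hK := fun τ hτ => hA.integral_κ_sum (Finset.range (N + 1))
    (fun i => b i / ∫ θ in (0:ℝ)..2 * Real.pi, A.weight i θ) (hmem τ hτ)
  have hcancel : ∀ y : ℕ → ℝ, ∑ i ∈ Finset.range (N + 1),
      -((b i / ∫ θ in (0:ℝ)..2 * Real.pi, A.weight i θ) * y i) *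
        ∫ θ in (0:ℝ)..2 * Real.pi, A.weight i θ = -∑ i ∈ Finset.range (N + 1), b i * y i := by
    intro y
    rw [← Finset.sum_neg_distrib]
    refine Finset.sum_congr rfl fun i _ => ?_
    have := hk i; field_simp
  have hI' := fun τ hτ => (hI τ hτ).trans (hcancel _)
  have hK' := fun τ hτ => (hK τ hτ).trans (congrArg (· / _) (hcancel _))
  have hl : (j:ℝ) + 1 - w ∈ Set.Icc ((j:ℝ) + 1 - w) (j + 1 + w) := ⟨le_rfl, by linarith⟩
  have hr : (j:ℝ) + 1 + w ∈ Set.Icc ((j:ℝ) + 1 - w) (j + 1 + w) := ⟨by linarith, le_rfl⟩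
  have hden : ∀ τ ∈ Set.Icc ((j:ℝ) + 1 - w) (j + 1 + w), ((A.d:ℝ) + 1) * τ ^ (2 * A.d + 2) ≠ 0 := by
    intro τ hτ
    have : 0 < τ := by linarith [(hmem τ hτ).1]
    positivity
  obtain ⟨τ₀, hτ₀, hmin⟩ := (isCompact_Icc (a := (j:ℝ) + 1 - w) (b := j + 1 + w)).exists_isMinOn
    ⟨_, hl⟩ (f := fun τ => |-(∑ i ∈ Finset.range (N + 1),
      b i * ((2 * i + A.d + 2) * τ ^ (2 * i + A.d + 2))) / ((A.d + 1) * τ ^ (2 * A.d + 2))|)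
    (ContinuousOn.abs (ContinuousOn.div (by fun_prop) (by fun_prop) hden))
  have hne := div_ne_zero (neg_ne_zero.2 (h1 τ₀ hτ₀)) (hden τ₀ hτ₀)
  refine ⟨w, hw, hw8, min |_| (min |_| |_|), lt_min (abs_pos.2 hne)
    (lt_min (abs_pos.2 (left_ne_zero_of_mul h2.ne)) (abs_pos.2 (right_ne_zero_of_mul h2.ne))),
    _, _, fun _ => rfl, fun _ => rfl, ?_, ?_, ?_, ?_⟩
  · rw [hI' _ hl, hI' _ hr, neg_mul_neg]; exact h2
  · rw [hI' _ hl, abs_neg]; exact (min_le_right _ _).trans (min_le_left _ _)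
  · rw [hI' _ hr, abs_neg]; exact (min_le_right _ _).trans (min_le_right _ _)
  · intro τ hτ
    rw [hK' _ hτ]; exact (min_le_left _ _).trans (hmin hτ)

end EnergyAnnulus

lemma abs_intervalIntegral_sub_le {f g : ℝ → ℝ} (hf : Continuous f) (hg : Continuous g) {ν : ℝ}
    (h : ∀ θ, |f θ - g θ| < ν) :
    |(∫ θ in (0:ℝ)..2 * Real.pi, f θ) - ∫ θ in (0:ℝ)..2 * Real.pi, g θ| ≤ ν * (2 * Real.pi) := by
  rw [← intervalIntegral.integral_sub (hf.intervalIntegrable _ _) (hg.intervalIntegrable _ _)]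
  have := intervalIntegral.norm_integral_le_of_norm_le_const (a := 0) (b := 2 * Real.pi) (C := ν)
    (f := fun θ => f θ - g θ) fun θ _ => (h θ).le
  rwa [sub_zero, abs_of_pos Real.two_pi_pos] at this

lemma mul_neg_of_abs_sub_lt {a b a' b' : ℝ} (h : a * b < 0) (ha : |a' - a| < |a|)
    (hb : |b' - b| < |b|) : a' * b' < 0 := by
  rcases mul_neg_iff.1 h with ⟨h1, h2⟩ | ⟨h1, h2⟩
  · rw [abs_of_pos h1] at ha
    rw [abs_of_neg h2] at hb
    exact mul_neg_of_pos_of_neg (by linarith [(abs_lt.1 ha).1]) (by linarith [(abs_lt.1 hb).2])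
  · rw [abs_of_neg h1] at ha
    rw [abs_of_pos h2] at hb
    exact mul_neg_of_neg_of_pos (by linarith [(abs_lt.1 ha).2]) (by linarith [(abs_lt.1 hb).1])

/-- An odd damping polynomial with `N` nested limit cycles that survive small changes of the
damping and of the (odd, nearly homogeneous) restoring force. -/
theorem exists_robust_odd (d N : ℕ) : ∃ P : ℝ[X], P.natDegree ≤ 2 * N + 1 ∧ (N = 0 → P = 0) ∧
    (∀ x, P.eval (-x) = -P.eval x) ∧ ∃ L μ : ℝ, 0 < L ∧ 0 < μ ∧ ∀ g g' G : ℝ → ℝ,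
      (∀ x, HasDerivAt G (g x) x) → (∀ x, HasDerivAt g (g' x) x) → Continuous g' →
      (∀ x, g (-x) = -g x) → (∀ x, G (-x) = G x) →
      (∀ x, |x| ≤ L → |g x - (d + 1) * x ^ (2 * d + 1)| ≤ μ ∧
        |g' x - (d + 1) * ((2 * d + 1) * x ^ (2 * d))| ≤ μ ∧ |G x - x ^ (2 * d + 2) / 2| ≤ μ) →
      ∀ F F' : ℝ → ℝ, (∀ x, HasDerivAt F (F' x) x) → Continuous F' →
      (∀ x, |x| ≤ L → |oddPart F x - P.eval x| ≤ μ ∧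
        |evenPart F' x - P.derivative.eval x| ≤ μ) →
      ∃ ε₀, 0 < ε₀ ∧ ∀ ε, 0 < ε → ε ≤ ε₀ → ∃ Γ : Fin N → Set (ℝ × ℝ), Function.Injective Γ ∧
        ∀ j, IsLimitCycle (liePlane F g ε) (Γ j) ∧ (∀ p ∈ Γ j, |p.1| < L) ∧
          (∃ p ∈ Γ j, 0 < p.1) ∧ ∃ p ∈ Γ j, p.1 < 0 := by
  have hR : (1:ℝ) ≤ N + 1 := by simp
  obtain ⟨μ₁, hμ₁, hann⟩ := exists_annulus d hR
  obtain ⟨A₀, hA₀, rfl, hra, hrb, hL⟩ := EnergyAnnulus.exists_isHomogeneous d hR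
  obtain ⟨c, hc⟩ := hA₀.exists_averages
  choose! w hw hw8 ν hν I K hI hK hII hIl hIr hKK using hc
  obtain ⟨ν₀, hν₀, hνle⟩ := exists_pos_forall_le (f := fun j : Fin N => ν j) fun j => hν j j.2
  have hν₁ : 0 < ν₀ / (4 * Real.pi) := by positivity
  set P : ℝ[X] := if N = 0 then 0 else ∑ i ∈ Finset.range (N + 1), C (c i) * X ^ (2 * i + 1) with hP
  have hPe : N ≠ 0 → (fun x => P.eval x) = fun x => ∑ i ∈ Finset.range (N + 1), c i * x ^ (2 * i + 1) := by
    intro h; funext x; simp [hP, h, eval_finsetSum]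
  have hPd : N ≠ 0 → (fun x => P.derivative.eval x) =
      fun x => ∑ i ∈ Finset.range (N + 1), c i * ((2 * i + 1) * x ^ (2 * i)) := by
    intro h; funext x
    simp only [hP, h, if_false, derivative_sum, derivative_C_mul_X_pow, eval_finsetSum, eval_mul, eval_C, eval_pow, eval_X]
    refine Finset.sum_congr rfl fun i _ => ?_
    rw [Nat.add_sub_cancel]; push_cast; ring
  obtain ⟨μ₂, hμ₂, hst⟩ := A₀.exists_stable P.continuous P.derivative.continuous hν₁
  refine ⟨P, ?_, fun h => by simp [hP, h], ?_, 2 * (N + 1) + 1, min μ₁ μ₂, by positivity,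
    lt_min hμ₁ hμ₂, ?_⟩
  · rw [hP]; split_ifs
    · simp
    · refine natDegree_sum_le_of_forall_le _ _ fun i hi => (natDegree_C_mul_X_pow_le _ _).trans ?_
      have := Finset.mem_range.1 hi; omega
  · intro x
    by_cases h : N = 0
    · simp [hP, h]
    · rw [congrFun (hPe h) x, congrFun (hPe h) (-x), ← Finset.sum_neg_distrib]
      exact Finset.sum_congr rfl fun i _ => by rw [Odd.neg_pow ⟨i, rfl⟩]; ring
  intro g g' G hG hg hg' go Ge hclose F F' hF hF' hclF
  obtain ⟨A, hAd, rfl, rfl, rfl, hAra, hArb, hAlo, hAhi, hAL⟩ := hann g g' G hG hg hg' go Ge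
    fun x hx => ⟨(hclose x hx).1.trans (min_le_left _ _), (hclose x hx).2.2.trans (min_le_left _ _)⟩
  have hF0 : Continuous F := continuous_iff_continuousAt.2 fun x => (hF x).continuousAt
  have hrbL : ∀ x, |x| ≤ A₀.rb → |x| ≤ 2 * ((N:ℝ) + 1) + 1 := fun x hx => by rw [hrb] at hx; linarith
  have hst' := hst A hAd (hAra.trans hra.symm) (hArb.trans hrb.symm) (hAlo.trans hA₀.lo_eq.symm)
    (hAhi.trans hA₀.hi_eq.symm) (fun x hx => by
      rw [hA₀.g_eq, hA₀.g'_eq, hA₀.G_eq]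
      have := hclose x (hrbL x hx)
      exact ⟨this.1.trans (min_le_right _ _), this.2.1.trans (min_le_right _ _),
        this.2.2.trans (min_le_right _ _)⟩) (oddPart F) (evenPart F') (fun x hx => by
      have := hclF x (hrbL x hx)
      exact ⟨this.1.trans (min_le_right _ _), this.2.trans (min_le_right _ _)⟩)
  have hodd : Continuous (oddPart F) := by unfold oddPart; fun_prop
  have heven : Continuous (evenPart F') := by unfold evenPart; fun_prop
  have h2π : ν₀ / (4 * Real.pi) * (2 * Real.pi) = ν₀ / 2 := by
    have := Real.pi_pos; field_simp; norm_num
  have hIe : ∀ j < N, ∀ τ, |(∫ θ in (0:ℝ)..2 * Real.pi, A.e F 0 (τ ^ (2 * A₀.d + 2) / 2) θ) - I j τ| ≤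
      ν₀ / 2 := by
    intro j hj τ
    rw [hI j hj, ← hPe (by omega), ← A.integral_e_oddPart hF0, ← h2π]
    exact abs_intervalIntegral_sub_le (A.continuous_e_zero hodd _)
      (A₀.continuous_e_zero P.continuous _) fun θ => (hst' _ θ).1
  have hKe : ∀ j < N, ∀ τ, |(∫ θ in (0:ℝ)..2 * Real.pi, A.κ F F' 0 (τ ^ (2 * A₀.d + 2) / 2) θ) -
      K j τ| ≤ ν₀ / 2 := by
    intro j hj τ
    rw [hK j hj, ← hPe (by omega), ← hPd (by omega), ← A.integral_κ_oddPart hF0 hF', ← h2π]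
    exact abs_intervalIntegral_sub_le (A.continuous_κ_zero hodd heven _)
      (A₀.continuous_κ_zero P.continuous P.derivative.continuous _) fun θ => (hst' _ θ).2
  have hpow : ∀ {a b : ℝ}, 0 ≤ a → a < b → a ^ (2 * A₀.d + 2) / 2 < b ^ (2 * A₀.d + 2) / 2 :=
    fun ha hab => div_lt_div_of_pos_right (pow_lt_pow_left₀ hab ha (by omega)) two_pos
  have hpow' : ∀ {a b : ℝ}, 0 ≤ a → a ≤ b → a ^ (2 * A₀.d + 2) / 2 ≤ b ^ (2 * A₀.d + 2) / 2 :=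
    fun ha hab => div_le_div_of_nonneg_right (pow_le_pow_left₀ ha hab _) two_pos.le
  have key : ∀ j : Fin N, ∃ ε₀, 0 < ε₀ ∧ ∀ ε, 0 < ε → ε ≤ ε₀ → ∃ Γ,
      IsLimitCycle (liePlane F A.g ε) Γ ∧ Γ ⊆ A.O ∧ (∀ p ∈ Γ, A.H p ∈
        Set.Ioo (((j:ℝ) + 1 / 2) ^ (2 * A₀.d + 2) / 2) (((j:ℝ) + 3 / 2) ^ (2 * A₀.d + 2) / 2)) ∧
      (∃ p ∈ Γ, 0 < p.1) ∧ ∃ p ∈ Γ, p.1 < 0 := by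
    rintro ⟨j, hj⟩
    have hj0 : (0:ℝ) ≤ j := j.cast_nonneg
    have hjN : (j:ℝ) + 1 ≤ N := by exact_mod_cast hj
    have h1 := hw j hj
    have h2 := hw8 j hj
    have hνj : ν₀ ≤ ν j := hνle ⟨j, hj⟩
    refine A.exists_isLimitCycle hF hF' (a₀ := (j + 1 - w j) ^ (2 * A₀.d + 2) / 2)
      (a₁ := (j + 1 + w j) ^ (2 * A₀.d + 2) / 2) ?_ (hpow (by positivity) (by dsimp only; linarith))
      (hpow (by linarith) (by linarith)) (hpow (by linarith) (by dsimp only; linarith)) ?_ ?_ ?_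
    · rw [hAlo]; exact hpow' (by norm_num) (by dsimp only; linarith)
    · rw [hAhi]; exact hpow' (by positivity) (by dsimp only; linarith)
    · refine mul_neg_of_abs_sub_lt (hII j hj) ((hIe j hj _).trans_lt ?_) ((hIe j hj _).trans_lt ?_)
      · linarith [hIl j hj]
      · linarith [hIr j hj]
    · intro a ha
      obtain ⟨τ, hτ, rfl⟩ := intermediate_value_Icc (by linarith : (j:ℝ) + 1 - w j ≤ j + 1 + w j)
        (f := fun τ : ℝ => τ ^ (2 * A₀.d + 2) / 2) (by fun_prop) ha
      intro h0
      have h3 := hKe j hj τ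
      rw [h0, zero_sub, abs_neg] at h3
      linarith [hKK j hj τ hτ]
  choose ε₀ hε₀ h using key
  obtain ⟨ε₁, hε₁, hle⟩ := exists_pos_forall_le hε₀
  refine ⟨ε₁, hε₁, fun ε hε hε' => ?_⟩
  choose Γ hΓ hΓO hΓH hΓp hΓn using fun j => h j ε hε (hε'.trans (hle j))
  have hlt : ∀ i j : Fin N, i < j → Γ i ≠ Γ j := by
    intro i j hij heq
    obtain ⟨p, hp, -⟩ := hΓp i
    have h1 := (hΓH i p hp).2
    have h2 := (hΓH j p (heq ▸ hp)).1
    have h3 : ((i:ℕ):ℝ) + 1 ≤ ((j:ℕ):ℝ) := by exact_mod_cast hij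
    have := hpow' (a := ((i:ℕ):ℝ) + 3 / 2) (b := ((j:ℕ):ℝ) + 1 / 2) (by positivity) (by linarith)
    linarith
  refine ⟨Γ, fun i j hij => ?_, fun j => ⟨hΓ j, fun p hp => ?_, hΓp j, hΓn j⟩⟩
  · by_contra hne
    rcases lt_or_gt_of_ne hne with h | h
    · exact hlt i j h hij
    · exact hlt j i h hij.symm
  · rw [← hAL]; exact (hΓO j hp).1

lemma Function.Periodic.exists_pos_le {σ : ℝ → ℝ} {T : ℝ} (h : Function.Periodic σ T) (hT : 0 < T)
    (hc : Continuous σ) (hσ : ∀ t, 0 < σ t) : ∃ m, 0 < m ∧ ∀ t, m ≤ σ t := by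
  obtain ⟨_, ⟨t, rfl⟩, hmin⟩ := (h.compact_of_continuous hT.ne' hc).exists_isLeast (Set.range_nonempty σ)
  exact ⟨σ t, hσ t, fun u => hmin ⟨u, rfl⟩⟩

/-- `Φ` sends solutions of `V` in `A` to solutions of `W` up to a change of time with speed `s` of
constant sign `c`. -/
structure MapsOrbits (V W : ℝ × ℝ → ℝ × ℝ) (A : Set (ℝ × ℝ)) (Φ : ℝ × ℝ → ℝ × ℝ) (s : ℝ × ℝ → ℝ)
    (c : ℝ) : Prop where
  sign : c = 1 ∨ c = -1
  pos : ∀ p ∈ A, 0 < c * s p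
  continuousOn : ContinuousOn s A
  injOn : Set.InjOn Φ A
  hasDerivAt : ∀ (γ : ℝ → ℝ × ℝ) (t : ℝ), γ t ∈ A → HasDerivAt γ (V (γ t)) t →
    HasDerivAt (fun t => Φ (γ t)) (s (γ t) • W (Φ (γ t))) t

lemma MapsOrbits.isPeriodicOrbit {V W : ℝ × ℝ → ℝ × ℝ} {A : Set (ℝ × ℝ)} {Φ : ℝ × ℝ → ℝ × ℝ}
    {s : ℝ × ℝ → ℝ} {c : ℝ} (h : MapsOrbits V W A Φ s c) {Γ : Set (ℝ × ℝ)}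
    (hΓ : IsPeriodicOrbit V Γ) (hΓA : Γ ⊆ A) : IsPeriodicOrbit W (Φ '' Γ) := by
  obtain ⟨γ, hγ, ⟨T, hT, hγT⟩, ⟨t₁, t₂, hne⟩, rfl⟩ := hΓ
  have hA : ∀ t, γ t ∈ A := fun t => hΓA ⟨t, rfl⟩
  have hγc : Continuous γ := continuous_iff_continuousAt.2 fun t => (hγ t).continuousAt
  have hcc : c * c = 1 := by rcases h.sign with rfl | rfl <;> norm_num
  have hγT' : Function.Periodic (fun t => γ (c * t)) T := by
    intro t
    rcases h.sign with rfl | rfl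
    · simpa using hγT t
    · have := hγT.sub_eq (-t)
      dsimp only; rw [neg_one_mul t, ← this]; congr 1; ring
  have hσc : Continuous fun t => c * s (γ (c * t)) :=
    continuous_const.mul (h.continuousOn.comp_continuous (hγc.comp (continuous_const.mul continuous_id))
      fun t => hA _)
  have hσT : Function.Periodic (fun t => c * s (γ (c * t))) T := fun t => by
    have := hγT' t; dsimp only at this ⊢; rw [this]
  obtain ⟨m, hm, hmle⟩ := hσT.exists_pos_le hT hσc fun t => h.pos _ (hA _)
  have hr : Φ '' Set.range γ = Set.range fun t => Φ (γ (c * t)) := by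
    rw [← Set.range_comp]
    have : Function.Surjective fun t : ℝ => c * t := fun t => ⟨c * t, by
      dsimp only; rw [← mul_assoc, hcc, one_mul]⟩
    exact (this.range_comp (Φ ∘ γ)).symm
  rw [hr]
  refine isPeriodicOrbit_range hσc hm hmle hT hσT (fun t => by
    have := hγT' t; dsimp only at this ⊢; rw [this]) (fun t => ?_) (θ₁ := c * t₁) (θ₂ := c * t₂) ?_
  · have h1 := h.hasDerivAt γ (c * t) (hA _) (hγ _)
    have h2 := h1.scomp t ((hasDerivAt_id t).const_mul c)
    rw [mul_one, smul_smul] at h2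
    exact h2
  · simp only [← mul_assoc, hcc, one_mul]
    exact fun h' => hne (h.injOn (hA _) (hA _) h')

/-- Limit cycles are preserved by orbital equivalences. -/
lemma IsLimitCycle.image {V W : ℝ × ℝ → ℝ × ℝ} {A B : Set (ℝ × ℝ)} {Φ Ψ : ℝ × ℝ → ℝ × ℝ}
    {s t : ℝ × ℝ → ℝ} {c : ℝ} (hΦ : MapsOrbits V W A Φ s c) (hΨ : MapsOrbits W V B Ψ t c)
    (hA : IsOpen A) (hΦc : ContinuousOn Φ A) (hΨA : Set.MapsTo Ψ B A)
    (hΦΨ : Set.LeftInvOn Φ Ψ B) (hΨΦ : Set.LeftInvOn Ψ Φ A) {Γ : Set (ℝ × ℝ)}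
    (hΓ : IsLimitCycle W Γ) (hΓB : Γ ⊆ B) : IsLimitCycle V (Ψ '' Γ) := by
  obtain ⟨hp, U, hU, hΓU, hiso⟩ := hΓ
  refine ⟨hΨ.isPeriodicOrbit hp hΓB, A ∩ Φ ⁻¹' U, hΦc.isOpen_inter_preimage hA hU, ?_, ?_⟩
  · rintro _ ⟨p, hpΓ, rfl⟩
    refine ⟨hΨA (hΓB hpΓ), ?_⟩
    rw [Set.mem_preimage, hΦΨ (hΓB hpΓ)]
    exact hΓU hpΓ
  · intro Γ' hΓ' hsub
    have hsA : Γ' ⊆ A := fun p hp => (hsub hp).1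
    have h1 := hiso _ (hΦ.isPeriodicOrbit hΓ' hsA) (by rintro _ ⟨p, hp, rfl⟩; exact (hsub hp).2)
    rw [← h1]
    exact ((hΨΦ.mono hsA).image_image).symm

lemma HasDerivAt.fst_snd {γ : ℝ → ℝ × ℝ} {v : ℝ × ℝ} {t : ℝ} (h : HasDerivAt γ v t) :
    HasDerivAt (fun t => (γ t).1) v.1 t ∧ HasDerivAt (fun t => (γ t).2) v.2 t :=
  ⟨(hasFDerivAt_fst (𝕜 := ℝ) (p := γ t)).comp_hasDerivAt t h,
    (hasFDerivAt_snd (𝕜 := ℝ) (p := γ t)).comp_hasDerivAt t h⟩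

/-- The folding map `u = x² / s² - a` turns limit cycles of a small copy of the system `(F₂, g₀)`
into limit cycles in a half-plane. -/
lemma isLimitCycle_unfold {F₁ g₁ F₂ g₀ : ℝ → ℝ} {d : ℕ} {c s a L ε : ℝ} (hc : c = 1 ∨ c = -1)
    (hs : 0 < s) (hL : L < a) (hg : ∀ x, g₁ x = 2 * x * s ^ (2 * d) * g₀ (x ^ 2 / s ^ 2 - a))
    (hF : ∀ u, |u| < L → F₁ (c * (s * √(u + a))) = F₂ u * s ^ (d + 1)) {Γ : Set (ℝ × ℝ)}
    (hΓ : IsLimitCycle (liePlane F₂ g₀ ε) Γ) (hΓL : ∀ p ∈ Γ, |p.1| < L) :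
    IsLimitCycle (liePlane F₁ g₁ ε)
      ((fun p : ℝ × ℝ => (c * (s * √(p.1 + a)), s ^ (d + 1) * p.2)) '' Γ) := by
  have hcc : c * c = 1 := by rcases hc with rfl | rfl <;> norm_num
  have hc2 : c ^ 2 = 1 := by rw [sq, hcc]
  have hc0 : c ≠ 0 := left_ne_zero_of_mul_eq_one hcc
  set A : Set (ℝ × ℝ) := {p | 0 < c * p.1 ∧ |p.1 ^ 2 / s ^ 2 - a| < L} with hA
  set B : Set (ℝ × ℝ) := {p | |p.1| < L} with hB
  set Φ : ℝ × ℝ → ℝ × ℝ := fun p => (p.1 ^ 2 / s ^ 2 - a, p.2 / s ^ (d + 1)) with hΦ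
  set Ψ : ℝ × ℝ → ℝ × ℝ := fun p => (c * (s * √(p.1 + a)), s ^ (d + 1) * p.2) with hΨ
  have hroot : ∀ u, |u| < L → 0 < √(u + a) ∧ √(u + a) ^ 2 = u + a := by
    intro u hu
    have : 0 < u + a := by linarith [(abs_lt.1 hu).1]
    exact ⟨Real.sqrt_pos.2 this, Real.sq_sqrt this.le⟩
  have hsq : ∀ u, |u| < L → (c * (s * √(u + a))) ^ 2 / s ^ 2 - a = u := by
    intro u hu
    rw [mul_pow, mul_pow, hc2, (hroot u hu).2]; field_simp; ring
  have hback : ∀ x, 0 < c * x → c * (s * √(x ^ 2 / s ^ 2 - a + a)) = x := by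
    intro x hx
    have h1 : x ^ 2 / s ^ 2 - a + a = (c * x / s) ^ 2 := by
      rw [div_pow, mul_pow, hc2]; ring
    rw [h1, Real.sqrt_sq (by positivity), mul_div_cancel₀ _ hs.ne', ← mul_assoc, hcc, one_mul]
  have hΨA : Set.MapsTo Ψ B A := by
    intro p hp
    have h1 := hroot p.1 hp
    refine ⟨?_, ?_⟩
    · simp only [hΨ]; rw [← mul_assoc, hcc]; have := h1.1; positivity
    · simp only [hΨ]; rw [hsq p.1 hp]; exact hp
  have hΦΨ : Set.LeftInvOn Φ Ψ B := by
    intro p hp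
    simp only [hΦ, hΨ]
    rw [hsq p.1 hp, mul_div_cancel_left₀ _ (by positivity)]
  have hΨΦ : Set.LeftInvOn Ψ Φ A := by
    intro p hp
    simp only [hΦ, hΨ]
    rw [hback p.1 hp.1, mul_div_cancel₀ _ (by positivity)]
  refine IsLimitCycle.image (A := A) (B := B) (Φ := Φ) (Ψ := Ψ) (c := c)
    (s := fun p => 2 * p.1 * s ^ (d + 1) / s ^ 2)
    (t := fun p => s ^ 2 / (2 * (c * (s * √(p.1 + a))) * s ^ (d + 1))) ?_ ?_ ?_ ?_ hΨA hΦΨ hΨΦ hΓ hΓL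
  · refine ⟨hc, fun p hp => ?_, by fun_prop (disch := positivity), hΨΦ.injOn, fun γ t hγ h => ?_⟩
    · have h1 := hp.1
      rw [show c * (2 * p.1 * s ^ (d + 1) / s ^ 2) = (c * p.1) * (2 * s ^ (d + 1) / s ^ 2) by ring]
      positivity
    · obtain ⟨h1, h2⟩ := h.fst_snd
      have h3 := (((h1.pow 2).div_const (s ^ 2)).sub_const a).prodMk (h2.div_const (s ^ (d + 1)))
      refine h3.congr_deriv ?_
      have hF' := hF _ hγ.2
      rw [hback _ hγ.1] at hF'
      simp only [liePlane, hΦ, Prod.smul_mk, smul_eq_mul, Prod.mk.injEq, hg, hF']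
      constructor
      · field_simp; push_cast; ring
      · field_simp; ring
  · refine ⟨hc, fun p hp => ?_, ?_, hΦΨ.injOn, fun γ t hγ h => ?_⟩
    · have := (hroot p.1 hp).1
      rw [show c * (s ^ 2 / (2 * (c * (s * √(p.1 + a))) * s ^ (d + 1))) =
        s ^ 2 / (2 * (s * √(p.1 + a)) * s ^ (d + 1)) by field_simp]
      positivity
    · refine ContinuousOn.div (by fun_prop) (by fun_prop) fun p hp => ?_
      have := (hroot p.1 hp).1
      positivity
    · obtain ⟨h1, h2⟩ := h.fst_snd
      obtain ⟨hr1, hr2⟩ := hroot _ hγ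
      have hne : (γ t).1 + a ≠ 0 := by rw [← hr2]; positivity
      have h3 := ((((h1.add_const a).sqrt hne).const_mul s).const_mul c).prodMk
        (h2.const_mul (s ^ (d + 1)))
      refine h3.congr_deriv ?_
      have hF' := hF _ hγ
      have hsq' := hsq _ hγ
      simp only [liePlane, hΨ, Prod.smul_mk, smul_eq_mul, Prod.mk.injEq, hg, hF', hsq']
      constructor
      · field_simp; rw [hc2]; ring
      · field_simp; ring
  · have h1 : Continuous fun p : ℝ × ℝ => c * p.1 := by fun_prop
    have h2 : Continuous fun p : ℝ × ℝ => |p.1 ^ 2 / s ^ 2 - a| := by fun_prop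
    exact (isOpen_lt continuous_const h1).inter (isOpen_lt h2 continuous_const)
  · exact Continuous.continuousOn (by fun_prop)

lemma exists_hasDerivAt_extension {F F' : ℝ → ℝ} {L : ℝ} (hL : 0 < L)
    (hF : ∀ x, |x| ≤ L → HasDerivAt F (F' x) x) (hF' : ContinuousOn F' (Set.Icc (-L) L)) :
    ∃ E E' : ℝ → ℝ, (∀ x, HasDerivAt E (E' x) x) ∧ Continuous E' ∧
      ∀ x, |x| ≤ L → E x = F x ∧ E' x = F' x := by
  have hLL : -L ≤ L := by linarith
  set E' : ℝ → ℝ := Set.IccExtend hLL ((Set.Icc (-L) L).domRestrict F') with hE'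
  have hc : Continuous E' := (continuousOn_iff_continuous_domRestrict.1 hF').Icc_extend'
  have heq : ∀ x, |x| ≤ L → E' x = F' x := fun x hx => by
    rw [hE', Set.IccExtend_of_mem hLL _ (abs_le.1 hx)]; rfl
  refine ⟨fun x => F 0 + ∫ t in (0:ℝ)..x, E' t, E', fun x => ?_, hc, fun x hx => ⟨?_, heq x hx⟩⟩
  · exact (hc.integral_hasStrictDerivAt 0 x).hasDerivAt.const_add _
  · have hsub : ∀ t ∈ Set.uIcc 0 x, |t| ≤ L := fun t ht => by
      rcases Set.mem_uIcc.1 ht with h | h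
      · rw [abs_of_nonneg h.1]; exact h.2.trans ((le_abs_self x).trans hx)
      · rw [abs_of_nonpos h.2]; linarith [neg_abs_le x, h.1]
    have : ∫ t in (0:ℝ)..x, E' t = F x - F 0 :=
      intervalIntegral.integral_eq_sub_of_hasDerivAt
        (fun t ht => by rw [heq t (hsub t ht)]; exact hF t (hsub t ht)) (hc.intervalIntegrable _ _)
    simp only [this]; ring

/-- The polynomial `∑ bᵢ s ^ (2 (d - i)) 2 x (x² - a s²) ^ i`, which equals
`2 x s ^ (2 d) b(x² / s² - a)` for `s ≠ 0`. -/
noncomputable def foldPoly (b : ℕ → ℝ) (d : ℕ) (a s : ℝ) : ℝ[X] :=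
  ∑ i ∈ Finset.range (d + 1), C (2 * (b i * s ^ (2 * (d - i)))) * (X * (X ^ 2 - C (a * s ^ 2)) ^ i)

/-- An even antiderivative of `foldPoly`. -/
noncomputable def foldPot (b : ℕ → ℝ) (d : ℕ) (a s x : ℝ) : ℝ :=
  ∑ i ∈ Finset.range (d + 1), b i * s ^ (2 * (d - i)) * ((x ^ 2 - a * s ^ 2) ^ (i + 1) / (i + 1))

/-- The derivative of `foldPoly`. -/
noncomputable def foldDeriv (b : ℕ → ℝ) (d : ℕ) (a s x : ℝ) : ℝ :=
  ∑ i ∈ Finset.range (d + 1), 2 * (b i * s ^ (2 * (d - i))) *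
    ((x ^ 2 - a * s ^ 2) ^ i + x * (i * (x ^ 2 - a * s ^ 2) ^ (i - 1) * (2 * x)))

lemma eval_foldPoly (b : ℕ → ℝ) (d : ℕ) (a s x : ℝ) : (foldPoly b d a s).eval x =
    ∑ i ∈ Finset.range (d + 1), 2 * (b i * s ^ (2 * (d - i))) * (x * (x ^ 2 - a * s ^ 2) ^ i) := by
  simp [foldPoly, eval_finsetSum]

lemma hasDerivAt_sq_sub (c x : ℝ) : HasDerivAt (fun x : ℝ => x ^ 2 - c) (2 * x) x := by
  simpa using (hasDerivAt_pow 2 x).sub_const c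

lemma hasDerivAt_foldPot (b : ℕ → ℝ) (d : ℕ) (a s x : ℝ) :
    HasDerivAt (foldPot b d a s) ((foldPoly b d a s).eval x) x := by
  rw [eval_foldPoly]
  refine HasDerivAt.fun_sum fun i _ => ?_
  refine ((((hasDerivAt_sq_sub (a * s ^ 2) x).fun_pow (i + 1)).div_const _).const_mul _).congr_deriv ?_
  have : (i:ℝ) + 1 ≠ 0 := by positivity
  push_cast; field_simp

lemma hasDerivAt_foldPoly (b : ℕ → ℝ) (d : ℕ) (a s x : ℝ) :
    HasDerivAt (fun x => (foldPoly b d a s).eval x) (foldDeriv b d a s x) x := by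
  simp_rw [eval_foldPoly]
  refine HasDerivAt.fun_sum fun i _ => ?_
  refine (((hasDerivAt_id' x).mul ((hasDerivAt_sq_sub (a * s ^ 2) x).fun_pow i)).const_mul _).congr_deriv ?_
  ring

lemma eval_foldPoly_neg (b : ℕ → ℝ) (d : ℕ) (a s x : ℝ) :
    (foldPoly b d a s).eval (-x) = -(foldPoly b d a s).eval x := by
  rw [eval_foldPoly, eval_foldPoly, ← Finset.sum_neg_distrib]
  exact Finset.sum_congr rfl fun i _ => by rw [neg_sq]; ring

lemma foldPot_neg (b : ℕ → ℝ) (d : ℕ) (a s x : ℝ) : foldPot b d a s (-x) = foldPot b d a s x := by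
  simp [foldPot]

lemma eval_foldPoly_eq {g : ℝ[X]} {d : ℕ} (hg : g.natDegree ≤ d) (a x : ℝ) {s : ℝ} (hs : s ≠ 0) :
    (foldPoly g.coeff d a s).eval x = 2 * x * s ^ (2 * d) * g.eval (x ^ 2 / s ^ 2 - a) := by
  rw [eval_foldPoly, eval_eq_sum_range' (Nat.lt_succ_of_le hg), Finset.mul_sum]
  refine Finset.sum_congr rfl fun i hi => ?_
  have hi' : i ≤ d := Nat.lt_succ_iff.1 (Finset.mem_range.1 hi)
  have h1 : x ^ 2 / s ^ 2 - a = (x ^ 2 - a * s ^ 2) / s ^ 2 := by field_simp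
  have h2 : s ^ (2 * d) = s ^ (2 * (d - i)) * (s ^ 2) ^ i := by
    rw [← pow_mul, ← pow_add]; congr 1; omega
  rw [h1, div_pow, h2]; field_simp

lemma natDegree_foldPoly_le (b : ℕ → ℝ) (d : ℕ) (a s : ℝ) :
    (foldPoly b d a s).natDegree ≤ 2 * d + 1 := by
  refine natDegree_sum_le_of_forall_le _ _ fun i hi => ?_
  have := Finset.mem_range.1 hi
  refine (natDegree_C_mul_le _ _).trans (natDegree_mul_le.trans ?_)
  have h2 : ((X:ℝ[X]) ^ 2 - C (a * s ^ 2)).natDegree ≤ 2 := by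
    rw [natDegree_X_pow_sub_C]
  have h3 := natDegree_pow_le_of_le i h2
  rw [natDegree_X]; omega

lemma coeff_foldPoly (b : ℕ → ℝ) (d : ℕ) (a s : ℝ) :
    (foldPoly b d a s).coeff (2 * d + 1) = 2 * b d := by
  have hdeg : ∀ i, (((X:ℝ[X]) ^ 2 - C (a * s ^ 2)) ^ i).natDegree = i * 2 := fun i => by
    rw [natDegree_pow, natDegree_X_pow_sub_C]
  rw [foldPoly, finsetSum_coeff, Finset.sum_range_succ, Finset.sum_eq_zero, zero_add]
  · have hm : (((X:ℝ[X]) ^ 2 - C (a * s ^ 2)) ^ d).coeff (2 * d) = 1 := by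
      have := ((monic_X_pow_sub_C (a * s ^ 2) two_ne_zero).pow d).coeff_natDegree
      rwa [hdeg, mul_comm d] at this
    rw [coeff_C_mul, coeff_X_mul, hm]; simp
  · intro i hi
    have := Finset.mem_range.1 hi
    rw [coeff_C_mul, coeff_X_mul, coeff_eq_zero_of_natDegree_lt, mul_zero]
    rw [hdeg]; omega

lemma exists_fold_close {b : ℕ → ℝ} {d : ℕ} (hb : b d = (d + 1) / 2) (a L : ℝ) {μ κ : ℝ}
    (hμ : 0 < μ) (hκ : 0 < κ) : ∃ s, 0 < s ∧ s < κ ∧ ∀ x, |x| ≤ L →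
      |(foldPoly b d a s).eval x - (d + 1) * x ^ (2 * d + 1)| ≤ μ ∧
      |foldDeriv b d a s x - (d + 1) * ((2 * d + 1) * x ^ (2 * d))| ≤ μ ∧
      |foldPot b d a s x - x ^ (2 * d + 2) / 2| ≤ μ := by
  set f : ℝ × ℝ → ℝ × (ℝ × ℝ) := fun p =>
    ((foldPoly b d a p.1).eval p.2, foldDeriv b d a p.1 p.2, foldPot b d a p.1 p.2) with hf
  have hfc : Continuous f := by
    simp only [hf, eval_foldPoly, foldDeriv, foldPot]; fun_prop
  have hz : ∀ i ∈ Finset.range d, (0:ℝ) ^ (2 * (d - i)) = 0 := fun i hi => by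
    have := Finset.mem_range.1 hi
    exact zero_pow (by omega)
  have hf0 : ∀ x, f (0, x) = ((d + 1) * x ^ (2 * d + 1), (d + 1) * ((2 * d + 1) * x ^ (2 * d)),
      x ^ (2 * d + 2) / 2) := by
    intro x
    have hd : (d:ℝ) + 1 ≠ 0 := by positivity
    simp only [hf, eval_foldPoly, foldDeriv, foldPot, Finset.sum_range_succ, Prod.mk.injEq]
    rw [Finset.sum_eq_zero (fun i hi => by rw [hz i hi]; ring),
      Finset.sum_eq_zero (fun i hi => by rw [hz i hi]; ring),
      Finset.sum_eq_zero (fun i hi => by rw [hz i hi]; ring), hb]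
    refine ⟨?_, ?_, ?_⟩
    · simp [← pow_mul]; ring
    · rcases d with _ | d
      · simp
      · simp [← pow_mul]; ring
    · simp [← pow_mul]; field_simp; ring
  obtain ⟨ζ, hζ, h⟩ := (isCompact_singleton.prod isCompact_Icc :
    IsCompact (({0} : Set ℝ) ×ˢ Set.Icc (-L) L)).exists_dist_lt (fun p _ => hfc.continuousAt) hμ
  refine ⟨min κ ζ / 2, by positivity, by linarith [min_le_left κ ζ], fun x hx => ?_⟩
  have h1 := h (0, x) ⟨rfl, abs_le.1 hx⟩ (min κ ζ / 2, x) (by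
    have : 0 < min κ ζ := by positivity
    rw [Prod.dist_eq, dist_self, max_eq_left dist_nonneg, dist_comm, Real.dist_eq, sub_zero,
      abs_of_pos (by positivity)]
    linarith [min_le_right κ ζ])
  rw [hf0, dist_comm, hf] at h1
  simp only [Prod.dist_eq, max_lt_iff, Real.dist_eq] at h1
  exact ⟨h1.1.le, h1.2.1.le, h1.2.2.le⟩

/-- The system with restoring force `g` and damping primitive `E` has `N` limit cycles in the strip
`|x| < L` whenever `E` is `η`-close to `F` there and the damping is weak enough. -/
def RobustCycles (g F : ℝ[X]) (L η : ℝ) (N : ℕ) : Prop :=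
  ∀ E E' : ℝ → ℝ, (∀ x, HasDerivAt E (E' x) x) → Continuous E' →
    (∀ x, |x| ≤ L → |E x - F.eval x| ≤ η ∧ |E' x - F.derivative.eval x| ≤ η) →
    ∃ ε₀, 0 < ε₀ ∧ ∀ ε, 0 < ε → ε ≤ ε₀ → ∃ Γ : Fin N → Set (ℝ × ℝ), Function.Injective Γ ∧
      ∀ j, IsLimitCycle (liePlane E (fun x => g.eval x) ε) (Γ j) ∧ ∀ p ∈ Γ j, |p.1| < L

lemma RobustCycles.unfold {g F : ℝ[X]} {L η : ℝ} {N : ℕ} (h : RobustCycles g F L η N) {d : ℕ}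
    {s a c L₁ : ℝ} (hc : c = 1 ∨ c = -1) (hs : 0 < s) (hs1 : s ≤ 1) (ha : a = L + 1) (hL : 0 < L)
    (hsL : s * (2 * L + 1) < L₁) (hg : g.natDegree ≤ d) {E E' : ℝ → ℝ}
    (hE : ∀ x, HasDerivAt E (E' x) x) (hE' : Continuous E')
    (hclose : ∀ x, |x| ≤ L₁ →
      |E x - s ^ (d + 1) * F.eval (x ^ 2 / s ^ 2 - a)| ≤ η * s ^ (d + 1) ∧
      |E' x - s ^ (d + 1) * (F.derivative.eval (x ^ 2 / s ^ 2 - a) * (2 * x / s ^ 2))| ≤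
        η * s ^ (d + 1)) :
    ∃ ε₀, 0 < ε₀ ∧ ∀ ε, 0 < ε → ε ≤ ε₀ → ∃ Γ : Fin N → Set (ℝ × ℝ), Function.Injective Γ ∧
      ∀ j, IsLimitCycle (liePlane E (fun x => (foldPoly g.coeff d a s).eval x) ε) (Γ j) ∧
        ∀ p ∈ Γ j, |p.1| < L₁ ∧ 0 < c * p.1 := by
  have hcc : c * c = 1 := by rcases hc with rfl | rfl <;> norm_num
  have hc2 : c ^ 2 = 1 := by rw [sq, hcc]
  have hca : |c| = 1 := by rcases hc with rfl | rfl <;> simp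
  have hsp : 0 < s ^ (d + 1) := by positivity
  set χ : ℝ → ℝ := fun u => c * (s * √(u + a)) with hχ
  have hroot : ∀ u, |u| ≤ L → 1 ≤ √(u + a) ∧ √(u + a) ^ 2 = u + a ∧ √(u + a) ≤ 2 * L + 1 := by
    intro u hu
    have h1 := abs_le.1 hu
    have h2 : 1 ≤ u + a := by linarith
    refine ⟨Real.one_le_sqrt.2 h2, Real.sq_sqrt (by linarith), ?_⟩
    exact Real.sqrt_le_iff.2 ⟨by linarith, by nlinarith⟩
  have hsq : ∀ u, |u| ≤ L → χ u ^ 2 / s ^ 2 - a = u := by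
    intro u hu
    simp only [hχ]
    rw [mul_pow, mul_pow, hc2, (hroot u hu).2.1]; field_simp; ring
  have hχL : ∀ u, |u| ≤ L → |χ u| < L₁ := by
    intro u hu
    obtain ⟨h1, -, h3⟩ := hroot u hu
    rw [hχ, abs_mul, hca, one_mul, abs_of_pos (by positivity)]
    exact (mul_le_mul_of_nonneg_left h3 hs.le).trans_lt hsL
  have hχd : ∀ u, |u| ≤ L → HasDerivAt χ (c * (s * (1 / (2 * √(u + a))))) u := by
    intro u hu
    obtain ⟨h1, h2, -⟩ := hroot u hu
    have : u + a ≠ 0 := by rw [← h2]; positivity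
    exact ((((hasDerivAt_id' u).add_const a).sqrt this).const_mul s).const_mul c
  obtain ⟨F₂, F₂', hF₂, hF₂', heq⟩ := exists_hasDerivAt_extension hL
    (F := fun u => E (χ u) / s ^ (d + 1))
    (F' := fun u => E' (χ u) * (c * (s * (1 / (2 * √(u + a))))) / s ^ (d + 1))
    (fun u hu => ((hE _).comp u (hχd u hu)).div_const _) (by
      have : ContinuousOn (fun u => 1 / (2 * √(u + a))) (Set.Icc (-L) L) :=
        ContinuousOn.div (by fun_prop) (by fun_prop) fun u hu => by
          have := (hroot u (abs_le.2 hu)).1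
          positivity
      have hχc : Continuous χ := by fun_prop
      exact ((hE'.comp hχc).continuousOn.mul
        (continuousOn_const.mul (continuousOn_const.mul this))).div_const _)
  obtain ⟨ε₀, hε₀, hmain⟩ := h F₂ F₂' hF₂ hF₂' (fun u hu => by
    obtain ⟨h1, h2⟩ := hclose _ (hχL u hu).le
    obtain ⟨hr1, hr2, -⟩ := hroot u hu
    rw [hsq u hu] at h1 h2
    rw [(heq u hu).1, (heq u hu).2]
    constructor
    · rw [show E (χ u) / s ^ (d + 1) - F.eval u = (E (χ u) - s ^ (d + 1) * F.eval u) / s ^ (d + 1) by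
        field_simp, abs_div, abs_of_pos hsp, div_le_iff₀ hsp]
      exact h1
    · have hcs : |c * (s * (1 / (2 * √(u + a))))| ≤ 1 := by
        rw [abs_mul, hca, one_mul, abs_of_pos (by positivity), mul_one_div, div_le_one (by positivity)]
        linarith
      have hchi : 2 * χ u / s ^ 2 * (c * (s * (1 / (2 * √(u + a))))) = 1 := by
        simp only [hχ]; field_simp; rw [hc2]
      rw [show E' (χ u) * (c * (s * (1 / (2 * √(u + a))))) / s ^ (d + 1) - F.derivative.eval u =
        (E' (χ u) - s ^ (d + 1) * (F.derivative.eval u * (2 * χ u / s ^ 2))) *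
          (c * (s * (1 / (2 * √(u + a))))) / s ^ (d + 1) by
        rw [sub_mul, mul_assoc (s ^ (d + 1)), mul_assoc (F.derivative.eval u), hchi]
        field_simp, abs_div, abs_of_pos hsp, div_le_iff₀ hsp, abs_mul]
      exact (mul_le_of_le_one_right (abs_nonneg _) hcs).trans h2)
  refine ⟨ε₀, hε₀, fun ε hε hle => ?_⟩
  obtain ⟨Γ, hinj, hΓ⟩ := hmain ε hε hle
  set Ψ : ℝ × ℝ → ℝ × ℝ := fun p => (χ p.1, s ^ (d + 1) * p.2) with hΨ
  have hΨi : Set.InjOn Ψ {p | |p.1| < L} := by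
    intro p hp p' hp' he
    obtain ⟨h1, h2⟩ := Prod.mk.inj he
    refine Prod.ext ?_ (mul_left_cancel₀ hsp.ne' h2)
    rw [← hsq p.1 (le_of_lt hp), ← hsq p'.1 (le_of_lt hp'), h1]
  refine ⟨fun j => Ψ '' Γ j, fun i j hij => hinj ?_, fun j => ⟨?_, ?_⟩⟩
  · exact (hΨi.image_eq_image_iff (hΓ i).2 (hΓ j).2).1 hij
  · refine isLimitCycle_unfold hc hs (by linarith) (fun x => eval_foldPoly_eq hg a x hs.ne')
      (fun u hu => ?_) (hΓ j).1 (hΓ j).2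
    rw [(heq u hu.le).1, div_mul_cancel₀ _ hsp.ne']
  · rintro _ ⟨p, hp, rfl⟩
    have hp' := ((hΓ j).2 p hp).le
    refine ⟨hχL _ hp', ?_⟩
    have := (hroot _ hp').1
    simp only [hΨ, hχ]
    rw [← mul_assoc, hcc]; positivity

/-- One folding step: two small copies of the given limit cycles, and `N'` new ones around them. -/
lemma RobustCycles.exists_double {g F : ℝ[X]} {L η : ℝ} {N : ℕ} (h : RobustCycles g F L η N)
    (hL : 0 < L) (hη : 0 < η) {d : ℕ} (hg : g.natDegree ≤ d) (hgd : g.coeff d = (d + 1) / 2)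
    (N' : ℕ) : ∃ (g₁ F₁ : ℝ[X]) (L₁ η₁ : ℝ), 0 < L₁ ∧ 0 < η₁ ∧ g₁.natDegree ≤ 2 * d + 1 ∧
      g₁.coeff (2 * d + 1) = d + 1 ∧ F₁.natDegree ≤ max (2 * F.natDegree) (2 * N' + 1) ∧
      (N' = 0 → F₁.natDegree ≤ 2 * F.natDegree ∧ (F = 0 → F₁ = 0)) ∧
      RobustCycles g₁ F₁ L₁ η₁ (N + (N + N')) := by
  obtain ⟨P, hPdeg, hP0, hPodd, L₁, μ, hL₁, hμ, hrob⟩ := exists_robust_odd d N'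
  set a := L + 1 with ha
  obtain ⟨s, hs, hsκ, hclose⟩ := exists_fold_close (b := g.coeff) (d := d) hgd a L₁ hμ
    (κ := min 1 (L₁ / (2 * L + 1))) (by positivity)
  have hs1 : s ≤ 1 := hsκ.le.trans (min_le_left _ _)
  have hsL : s * (2 * L + 1) < L₁ :=
    (lt_div_iff₀ (by positivity)).1 (hsκ.trans_le (min_le_right _ _))
  have hsp : 0 < s ^ (d + 1) := by positivity
  obtain ⟨M, hM0, hM⟩ : ∃ M : ℝ, 0 ≤ M ∧ ∀ x, |x| ≤ L₁ → |P.eval x| ≤ M ∧ |P.derivative.eval x| ≤ M := by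
    obtain ⟨M₁, h₁⟩ := isCompact_Icc.exists_bound_of_continuousOn (s := Set.Icc (-L₁) L₁)
      P.continuous.continuousOn
    obtain ⟨M₂, h₂⟩ := isCompact_Icc.exists_bound_of_continuousOn (s := Set.Icc (-L₁) L₁)
      P.derivative.continuous.continuousOn
    refine ⟨max 0 (max M₁ M₂), le_max_left _ _, fun x hx => ⟨?_, ?_⟩⟩
    · exact (h₁ x (abs_le.1 hx)).trans ((le_max_left _ _).trans (le_max_right _ _))
    · exact (h₂ x (abs_le.1 hx)).trans ((le_max_right _ _).trans (le_max_right _ _))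
  set δ := η * s ^ (d + 1) / (2 * (M + 1)) with hδ
  have hδ0 : 0 < δ := by positivity
  have hδM : δ * M ≤ η * s ^ (d + 1) / 2 := by
    rw [hδ, div_mul_eq_mul_div, div_le_div_iff₀ (by positivity) two_pos]
    nlinarith [mul_pos hη hsp]
  set η₁ := min (δ * μ) (η * s ^ (d + 1) / 2) with hη₁
  set Q : ℝ[X] := C (1 / s ^ 2) * X ^ 2 - C a with hQ
  have hQe : ∀ x, Q.eval x = x ^ 2 / s ^ 2 - a := fun x => by simp [hQ]; ring
  have hQd : Q.natDegree ≤ 2 := by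
    rw [hQ, natDegree_sub_C]
    exact natDegree_C_mul_X_pow_le _ _
  set F₁ : ℝ[X] := C (s ^ (d + 1)) * F.comp Q + C δ * P with hF₁
  have hF₁e : ∀ x, F₁.eval x = s ^ (d + 1) * F.eval (x ^ 2 / s ^ 2 - a) + δ * P.eval x := fun x => by
    simp [hF₁, eval_comp, hQe]
  have hF₁d : ∀ x, F₁.derivative.eval x =
      s ^ (d + 1) * (F.derivative.eval (x ^ 2 / s ^ 2 - a) * (2 * x / s ^ 2)) + δ * P.derivative.eval x := by
    intro x
    have : Q.derivative.eval x = 2 * x / s ^ 2 := by simp [hQ]; ring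
    simp only [hF₁, derivative_add, derivative_C_mul, derivative_comp, eval_add, eval_mul, eval_C,
      eval_comp, hQe, this]
    ring
  have hcomp : (C (s ^ (d + 1)) * F.comp Q).natDegree ≤ 2 * F.natDegree := by
    refine (natDegree_C_mul_le _ _).trans (natDegree_comp_le.trans ?_)
    rw [mul_comm]; exact Nat.mul_le_mul_right _ hQd
  have hP'e : ∀ x, P.derivative.eval (-x) = P.derivative.eval x := by
    intro x
    have h1 := (P.hasDerivAt (-x)).comp x (hasDerivAt_neg x)
    have h2 := (P.hasDerivAt x).neg
    have : ((fun x => P.eval x) ∘ fun x => -x) = -fun x => P.eval x := by funext y; simp [hPodd]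
    rw [this] at h1
    linarith [h1.unique h2]
  refine ⟨foldPoly g.coeff d a s, F₁, L₁, η₁, hL₁, by positivity, natDegree_foldPoly_le _ _ _ _, ?_, ?_,
    ?_, ?_⟩
  · rw [coeff_foldPoly, hgd]; ring
  · exact natDegree_add_le_of_le hcomp ((natDegree_C_mul_le _ _).trans hPdeg)
  · intro h0
    have : F₁ = C (s ^ (d + 1)) * F.comp Q := by rw [hF₁, hP0 h0, mul_zero, add_zero]
    rw [this]
    exact ⟨hcomp, fun hF => by simp [hF]⟩
  intro E E' hE hE' hEF
  have hin : ∀ c : ℝ, c = 1 ∨ c = -1 → _ := fun c hc =>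
    h.unfold (E := E) (E' := E') hc hs hs1 ha hL hsL hg hE hE' fun x hx => by
      obtain ⟨h1, h2⟩ := hEF x hx
      obtain ⟨h3, h4⟩ := hM x hx
      have h5 : η₁ ≤ η * s ^ (d + 1) / 2 := min_le_right _ _
      constructor
      · rw [show E x - s ^ (d + 1) * F.eval (x ^ 2 / s ^ 2 - a) = (E x - F₁.eval x) + δ * P.eval x by
          rw [hF₁e]; ring]
        refine (abs_add_le _ _).trans ?_
        rw [abs_mul, abs_of_pos hδ0]
        linarith [mul_le_mul_of_nonneg_left h3 hδ0.le]
      · rw [show E' x - s ^ (d + 1) * (F.derivative.eval (x ^ 2 / s ^ 2 - a) * (2 * x / s ^ 2)) =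
          (E' x - F₁.derivative.eval x) + δ * P.derivative.eval x by rw [hF₁d]; ring]
        refine (abs_add_le _ _).trans ?_
        rw [abs_mul, abs_of_pos hδ0]
        linarith [mul_le_mul_of_nonneg_left h4 hδ0.le]
  obtain ⟨ε₁, hε₁, hin₁⟩ := hin 1 (Or.inl rfl)
  obtain ⟨ε₂, hε₂, hin₂⟩ := hin (-1) (Or.inr rfl)
  obtain ⟨ε₃, hε₃, hout⟩ := hrob _ _ _ (hasDerivAt_foldPot g.coeff d a s)
    (hasDerivAt_foldPoly g.coeff d a s) (by unfold foldDeriv; fun_prop)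
    (eval_foldPoly_neg _ _ _ _) (foldPot_neg _ _ _ _) hclose (fun x => E x / δ) (fun x => E' x / δ)
    (fun x => (hE x).div_const _) (by fun_prop) fun x hx => by
      obtain ⟨h1, h2⟩ := hEF x hx
      obtain ⟨h3, h4⟩ := hEF (-x) (by rwa [abs_neg])
      have h5 : η₁ ≤ δ * μ := min_le_left _ _
      rw [hF₁e] at h1 h3
      rw [hF₁d] at h2 h4
      rw [neg_sq, hPodd] at h3
      rw [neg_sq, hP'e] at h4
      rw [abs_le] at h1 h2 h3 h4
      constructor
      · rw [show oddPart (fun x => E x / δ) x - P.eval x = ((E x - E (-x)) / 2 - δ * P.eval x) / δ by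
          simp only [oddPart]; field_simp, abs_div, abs_of_pos hδ0, div_le_iff₀ hδ0, abs_le]
        constructor <;> linarith
      · rw [show evenPart (fun x => E' x / δ) x - P.derivative.eval x =
          ((E' x + E' (-x)) / 2 - δ * P.derivative.eval x) / δ by
          simp only [evenPart]; field_simp, abs_div, abs_of_pos hδ0, div_le_iff₀ hδ0, abs_le]
        rw [show 2 * -x / s ^ 2 = -(2 * x / s ^ 2) by ring] at h4
        constructor <;> linarith
  refine ⟨min ε₁ (min ε₂ (ε₃ / δ)), by positivity, fun ε hε hle => ?_⟩
  obtain ⟨hle₁, hle'⟩ := le_min_iff.1 hle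
  obtain ⟨hle₂, hle₃⟩ := le_min_iff.1 hle'
  obtain ⟨Γ₁, hi₁, hΓ₁⟩ := hin₁ ε hε hle₁
  obtain ⟨Γ₂, hi₂, hΓ₂⟩ := hin₂ ε hε hle₂
  obtain ⟨Γ₃, hi₃, hΓ₃⟩ := hout (ε * δ) (by positivity) ((le_div_iff₀ hδ0).1 hle₃)
  have hsc : liePlane (fun x => E x / δ) (fun x => (foldPoly g.coeff d a s).eval x) (ε * δ) =
      liePlane E (fun x => (foldPoly g.coeff d a s).eval x) ε := by
    funext p; simp only [liePlane]; congr 2; field_simp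
  rw [hsc] at hΓ₃
  have hne : ∀ i, (Γ₁ i).Nonempty := fun i => by
    obtain ⟨⟨γ, -, -, -, hγ⟩, -⟩ := (hΓ₁ i).1
    rw [hγ]; exact Set.range_nonempty γ
  have hinj : Function.Injective (Sum.elim Γ₁ (Sum.elim Γ₂ Γ₃)) := by
    refine hi₁.sumElim (hi₂.sumElim hi₃ fun i j he => ?_) ?_
    · obtain ⟨p, hp, hp'⟩ := (hΓ₃ j).2.2.1
      have := ((hΓ₂ i).2 p (he ▸ hp)).2
      linarith
    · rintro i (j | j) he
      · obtain ⟨p, hp⟩ := hne i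
        have h1 := ((hΓ₁ i).2 p hp).2
        have h2 := ((hΓ₂ j).2 p (by rw [he] at hp; exact hp)).2
        linarith
      · obtain ⟨p, hp, hp'⟩ := (hΓ₃ j).2.2.2
        have := ((hΓ₁ i).2 p (by rw [he]; exact hp)).2
        linarith
  set e : Fin (N + (N + N')) ≃ Fin N ⊕ (Fin N ⊕ Fin N') :=
    finSumFinEquiv.symm.trans (Equiv.sumCongr (Equiv.refl _) finSumFinEquiv.symm) with he
  refine ⟨fun j => Sum.elim Γ₁ (Sum.elim Γ₂ Γ₃) (e j), hinj.comp e.injective, fun j => ?_⟩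
  dsimp only
  rcases e j with i | i | i
  · exact ⟨(hΓ₁ i).1, fun p hp => ((hΓ₁ i).2 p hp).1⟩
  · exact ⟨(hΓ₂ i).1, fun p hp => ((hΓ₂ i).2 p hp).1⟩
  · exact ⟨(hΓ₃ i).1, (hΓ₃ i).2.1⟩

lemma exists_robustCycles (r k p : ℕ) : ∃ (g F : ℝ[X]) (L η : ℝ) (N : ℕ), 0 < L ∧ 0 < η ∧
    g.natDegree ≤ 2 ^ p - 1 ∧ g.coeff (2 ^ p - 1) = 2 ^ p / 2 ∧ (F.natDegree + r ≤ 2 ^ p * k ∨ F = 0) ∧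
    (p : ℝ) * (2 ^ p * k) / 2 - (2 ^ p - 1) * (1 + ((r / 2 : ℕ) : ℝ)) ≤ N ∧
    RobustCycles g F L η N := by
  induction p with
  | zero =>
    refine ⟨C (1 / 2), 0, 1, 1, 0, one_pos, one_pos, by simp, by simp, Or.inr rfl, by simp, ?_⟩
    exact fun E E' hE hE' h => ⟨1, one_pos, fun ε hε hle =>
      ⟨fun i => i.elim0, fun i => i.elim0, fun i => i.elim0⟩⟩
  | succ p ih =>
    obtain ⟨g, F, L, η, N, hL, hη, hg, hgc, hF, hN, hR⟩ := ih
    have h2p : 1 ≤ 2 ^ p := Nat.one_le_two_pow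
    have hpow : 2 * (2 ^ p - 1) + 1 = 2 ^ (p + 1) - 1 := by rw [pow_succ]; omega
    have hcast : (((2 ^ p - 1 : ℕ) : ℝ)) + 1 = 2 ^ p := by
      have : (2 ^ p - 1) + 1 = 2 ^ p := by omega
      exact_mod_cast this
    set N' := (2 ^ (p + 1) * k - 1 - r) / 2 with hN'
    obtain ⟨g₁, F₁, L₁, η₁, hL₁, hη₁, hg₁, hgc₁, hF₁, hF₁', hR₁⟩ :=
      hR.exists_double hL hη hg (by rw [hgc, hcast]) N'
    have hkk : 2 ^ (p + 1) * k = 2 * (2 ^ p * k) := by ring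
    refine ⟨g₁, F₁, L₁, η₁, _, hL₁, hη₁, hpow ▸ hg₁, ?_, ?_, ?_, hR₁⟩
    · rw [← hpow, hgc₁, hcast, pow_succ]; ring
    · by_cases h0 : N' = 0
      · rcases hF with hF | hF
        · left; have := (hF₁' h0).1; omega
        · exact Or.inr ((hF₁' h0).2 hF)
      · left
        have hFd : F.natDegree + r ≤ 2 ^ p * k ∨ F.natDegree = 0 := hF.imp_right fun h => by simp [h]
        rcases le_max_iff.1 hF₁ with h | h <;> omega
    · have h1 : 2 ^ p * k ≤ N' + 1 + r / 2 := by omega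
      have h2 : (2:ℝ) ^ p * k ≤ N' + 1 + ((r / 2 : ℕ) : ℝ) := by exact_mod_cast h1
      push_cast
      rw [pow_succ]
      linarith

lemma isLimitCycle_lienard {g F : ℝ[X]} {ε : ℝ} {Γ : Set (ℝ × ℝ)}
    (h : IsLimitCycle (liePlane (fun x => F.eval x) (fun x => g.eval x) ε) Γ) :
    IsLimitCycle (lienard F.derivative g ε) ((fun p => (p.1, p.2 - ε * F.eval p.1)) '' Γ) := by
  refine IsLimitCycle.image (A := Set.univ) (B := Set.univ) (c := 1) (s := fun _ => 1) (t := fun _ => 1)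
    (Φ := fun p => (p.1, p.2 + ε * F.eval p.1)) ?_ ?_ isOpen_univ
    (Continuous.continuousOn (by fun_prop)) (Set.mapsTo_univ _ _) (fun p _ => by simp)
    (fun p _ => by simp) h (Set.subset_univ _)
  · refine ⟨Or.inl rfl, fun p _ => by simp, continuousOn_const, ?_, fun γ t _ h => ?_⟩
    · exact Set.LeftInvOn.injOn (f₁' := fun p => (p.1, p.2 - ε * F.eval p.1)) fun p _ => by simp
    · obtain ⟨h1, h2⟩ := h.fst_snd
      refine (h1.prodMk (h2.add (((F.hasDerivAt _).comp t h1).const_mul ε))).congr_deriv ?_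
      simp only [lienard, liePlane, one_smul, Prod.mk.injEq]
      constructor <;> ring
  · refine ⟨Or.inl rfl, fun p _ => by simp, continuousOn_const, ?_, fun γ t _ h => ?_⟩
    · exact Set.LeftInvOn.injOn (f₁' := fun p => (p.1, p.2 + ε * F.eval p.1)) fun p _ => by simp
    · obtain ⟨h1, h2⟩ := h.fst_snd
      refine (h1.prodMk (h2.sub (((F.hasDerivAt _).comp t h1).const_mul ε))).congr_deriv ?_
      simp only [lienard, liePlane, one_smul, Prod.mk.injEq]
      exact ⟨trivial, by ring⟩

lemma RobustCycles.hGe {g F : ℝ[X]} {L η c : ℝ} {N n m : ℕ} (h : RobustCycles g F L η N)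
    (hη : 0 < η) (hF : F.derivative.natDegree ≤ n) (hg : g.natDegree ≤ m) (hc : c ≤ N) :
    HGe n m c := by
  obtain ⟨ε₀, hε₀, h⟩ := h (fun x => F.eval x) (fun x => F.derivative.eval x) F.hasDerivAt
    F.derivative.continuous fun x _ => by simp [hη.le]
  refine ⟨F.derivative, g, hF, hg, ε₀, hε₀, fun ε hε hle => ?_⟩
  obtain ⟨Γ, hinj, hΓ⟩ := h ε hε hle
  set Ψ : ℝ × ℝ → ℝ × ℝ := fun p => (p.1, p.2 - ε * F.eval p.1) with hΨ
  have hΨi : Function.Injective Ψ :=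
    Function.LeftInverse.injective (g := fun p => (p.1, p.2 + ε * F.eval p.1)) fun p => by simp [hΨ]
  classical
  refine ⟨Finset.univ.image fun j => Ψ '' Γ j, fun S hS => ?_, ?_⟩
  · obtain ⟨j, -, rfl⟩ := Finset.mem_image.1 hS
    exact isLimitCycle_lienard (hΓ j).1
  · rw [Finset.card_image_of_injective (f := fun j => Ψ '' Γ j) _ (hΨi.image_injective.comp hinj), Finset.card_univ,
      Fintype.card_fin]
    exact hc

theorem stmt13 (r k : ℕ) (hr : 1 ≤ r) (hk : 2 ≤ k) :
    ∃ B : ℝ,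
      B ≥ -((1 + ((r / 2 : ℕ) : ℝ)) / (k : ℝ) + Real.log k / (2 * Real.log 2)) ∧
      ∀ p : ℕ, 1 ≤ p → ∀ m : ℕ, m = 2 ^ p * k - 1 → r < m →
        HGe (m - r) m
          (((m : ℝ) + 1) * Real.log ((m : ℝ) + 1) / (2 * Real.log 2)
            + B * ((m : ℝ) + 1) + 1 + ((r / 2 : ℕ) : ℝ)) := by
  refine ⟨_, le_rfl, fun p _ m hm hrm => ?_⟩
  obtain ⟨g, F, L, η, N, -, hη, hg, -, hF, hN, hR⟩ := exists_robustCycles r k p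
  have h2p : 1 ≤ 2 ^ p := Nat.one_le_two_pow
  have hpk : 2 ^ p ≤ 2 ^ p * k := Nat.le_mul_of_pos_right _ (by omega)
  refine hR.hGe hη ?_ (by omega) (le_trans (le_of_eq ?_) hN)
  · rcases hF with hF | rfl
    · have := natDegree_derivative_le F
      omega
    · simp
  · have hm1 : (m : ℝ) + 1 = 2 ^ p * k := by
      have : m + 1 = 2 ^ p * k := by omega
      exact_mod_cast this
    have hk0 : (k : ℝ) ≠ 0 := by positivity
    have hl2 : Real.log 2 ≠ 0 := (Real.log_pos one_lt_two).ne'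
    rw [hm1, Real.log_mul (by positivity) hk0, Real.log_pow]
    field_simp
    ring
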